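/- Fix a sign s ∈ {+1,−1}, a real ε > 0, positive integers k and H, and a real κ ∈ (0,1), and assume the multiplicity bound with exponent κ. Then there exists a constant c > 0 (depending on s, ε, k, H, κ and the constants in the multiplicity bound) such that for all sufficiently large real X there are at least c·X^{1−κ−ε} positive integers d ≤ X with the following two properties: (1) for each 1 ≤ i ≤ k, every cubic field K with s·Δ_K = d+i satisfies h(K) > H; and (2) the number of isomorphism classes of cubic fields K with s·Δ_K ∈ {d+1, d+2, …, d+k} is at least k/2. -/

import Mathlib

open NumberField IntermediateField Polynomial

noncomputable section

/-- The set of cubic subfields of `ℂ` whose discriminant satisfies `P`. -/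
def CubicSet (P : ℤ → Prop) : Set (IntermediateField ℚ ℂ) :=
  {F | ∃ h : Module.finrank ℚ F = 3,
    letI : FiniteDimensional ℚ F := FiniteDimensional.of_finrank_eq_succ h
    letI : NumberField F := ⟨⟩
    P (NumberField.discr F)}

/-- Cubic subfields of `ℂ`, up to `ℚ`-algebra isomorphism.  Since every cubic field
embeds into `ℂ`, these classes are exactly the isomorphism classes of cubic fields. -/
def cubicSetoid (P : ℤ → Prop) : Setoid (CubicSet P) where
  r F G := Nonempty (F.1 ≃ₐ[ℚ] G.1)
  iseqv := ⟨fun _ => ⟨AlgEquiv.refl⟩, fun ⟨e⟩ => ⟨e.symm⟩, fun ⟨e⟩ ⟨f⟩ => ⟨e.trans f⟩⟩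

/-- The number of isomorphism classes of cubic fields whose discriminant satisfies `P`. -/
def cubicCount (P : ℤ → Prop) : ℕ := Nat.card (Quotient (cubicSetoid P))

/-- value of a binary cubic form -/
def bcfEv (f : Fin 4 → ℤ) (x y : ℤ) : ℤ :=
  f 0 * x ^ 3 + f 1 * x ^ 2 * y + f 2 * x * y ^ 2 + f 3 * y ^ 3

/-- discriminant of a binary cubic form with coefficients in a ring -/
def bcfDisc {R : Type*} [CommRing R] (a b c d : R) : R :=
  b ^ 2 * c ^ 2 - 4 * a * c ^ 3 - 4 * b ^ 3 * d - 27 * a ^ 2 * d ^ 2 + 18 * a * b * c * d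

/-- discriminant of an integral binary cubic form -/
def bcfD (f : Fin 4 → ℤ) : ℤ := bcfDisc (f 0) (f 1) (f 2) (f 3)

/-- substitution `s ↦ x s + z t`, `t ↦ y s + w t` -/
def bcfAct (f : Fin 4 → ℤ) (x y z w : ℤ) : Fin 4 → ℤ :=
  ![bcfEv f x y,
    3 * f 0 * x ^ 2 * z + f 1 * (x ^ 2 * w + 2 * x * y * z)
      + f 2 * (2 * x * y * w + y ^ 2 * z) + 3 * f 3 * y ^ 2 * w,
    3 * f 0 * x * z ^ 2 + f 1 * (2 * x * z * w + y * z ^ 2)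
      + f 2 * (x * w ^ 2 + 2 * y * z * w) + 3 * f 3 * y * w ^ 2,
    bcfEv f z w]

theorem bcfEv_act (f : Fin 4 → ℤ) (x y z w s t : ℤ) :
    bcfEv (bcfAct f x y z w) s t = bcfEv f (x * s + z * t) (y * s + w * t) := by
  simp [bcfEv, bcfAct]; ring

theorem bcf_ext_of_ev (f g : Fin 4 → ℤ) (h : ∀ s t, bcfEv f s t = bcfEv g s t) : f = g := by
  have h1 := h 1 0
  have h2 := h 0 1
  have h3 := h 1 1
  have h4 := h 1 (-1)
  simp [bcfEv] at h1 h2 h3 h4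
  ext i; fin_cases i <;> simp <;> lia

/-- Delone-Faddeev relations -/
def DF {R : Type*} [CommRing R] (a b c d ω θ : R) : Prop :=
  ω ^ 2 = -(a * c) + b * ω - a * θ ∧ ω * θ = -(a * d) ∧ θ ^ 2 = -(b * d) + d * ω - c * θ

theorem DF.shear {R : Type*} [CommRing R] {a b c d ω θ : R} (h : DF a b c d ω θ) (t : R) :
    DF a (3 * a * t + b) (3 * a * t ^ 2 + 2 * b * t + c)
      (a * t ^ 3 + b * t ^ 2 + c * t + d) (ω + t * a) (θ + t * ω - t * b - t ^ 2 * a) := by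
  obtain ⟨h1, h2, h3⟩ := h
  refine ⟨?_, ?_, ?_⟩
  · linear_combination h1
  · linear_combination h2 + t * h1
  · linear_combination h3 + t ^ 2 * h1 + 2 * t * h2

theorem DF.swap {R : Type*} [CommRing R] {a b c d ω θ : R} (h : DF a b c d ω θ) :
    DF (-d) (-c) (-b) (-a) θ ω := by
  obtain ⟨h1, h2, h3⟩ := h
  refine ⟨?_, ?_, ?_⟩
  · linear_combination h3
  · linear_combination h2
  · linear_combination h1

theorem DF.cubic_left {R : Type*} [CommRing R] {a b c d ω θ : R} (h : DF a b c d ω θ) :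
    ω ^ 3 - b * ω ^ 2 + a * c * ω - a ^ 2 * d = 0 := by
  obtain ⟨h1, h2, h3⟩ := h
  linear_combination ω * h1 - a * h2

theorem DF.cubic_right {R : Type*} [CommRing R] {a b c d ω θ : R} (h : DF a b c d ω θ) :
    θ ^ 3 + c * θ ^ 2 + b * d * θ + a * d ^ 2 = 0 := by
  obtain ⟨h1, h2, h3⟩ := h
  linear_combination θ * h3 + d * h2

theorem bcfDisc_shear {R : Type*} [CommRing R] (a b c d t : R) :
    bcfDisc a (3 * a * t + b) (3 * a * t ^ 2 + 2 * b * t + c)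
      (a * t ^ 3 + b * t ^ 2 + c * t + d) = bcfDisc a b c d := by
  unfold bcfDisc; ring

theorem bcfDisc_swap {R : Type*} [CommRing R] (a b c d : R) :
    bcfDisc (-d) (-c) (-b) (-a) = bcfDisc a b c d := by
  unfold bcfDisc; ring

/-- the discriminant of a Delone-Faddeev basis -/
theorem discr_of_DF {R A : Type*} [CommRing R] [CommRing A] [Algebra R A]
    (e : Module.Basis (Fin 3) R A) {a b c d : R} {ω θ : A} (h0 : e 0 = 1) (h1 : e 1 = ω)
    (h2 : e 2 = θ)
    (h : DF (algebraMap R A a) (algebraMap R A b) (algebraMap R A c) (algebraMap R A d) ω θ) :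
    Algebra.discr R e = bcfDisc a b c d := by
  classical
  obtain ⟨k1, k2, k3⟩ := h
  have hrep : ∀ (x y z : R), e.repr (algebraMap R A x + algebraMap R A y * ω
      + algebraMap R A z * θ) = Finsupp.single 0 x + Finsupp.single 1 y + Finsupp.single 2 z := by
    intro x y z
    have : algebraMap R A x + algebraMap R A y * ω + algebraMap R A z * θ
        = x • e 0 + y • e 1 + z • e 2 := by
      rw [h0, h1, h2]; simp [Algebra.smul_def]
    rw [this]; simp
  have tr : ∀ (α : A) (x y z x' y' z' x'' y'' z'' : R),
      α = algebraMap R A x + algebraMap R A y * ω + algebraMap R A z * θ →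
      α * ω = algebraMap R A x' + algebraMap R A y' * ω + algebraMap R A z' * θ →
      α * θ = algebraMap R A x'' + algebraMap R A y'' * ω + algebraMap R A z'' * θ →
      Algebra.trace R A α = x + y' + z'' := by
    intro α x y z x' y' z' x'' y'' z'' e1 e2 e3
    rw [Algebra.trace_eq_matrix_trace e, Matrix.trace]
    simp only [Fin.sum_univ_three, Matrix.diag, Algebra.leftMulMatrix_eq_repr_mul, h0, h1, h2,
      mul_one]
    rw [e2, e3, e1, hrep, hrep, hrep]
    simp
  have t1 : Algebra.trace R A (1 : A) = 3 := by
    rw [tr 1 1 0 0 0 1 0 0 0 1 (by simp) (by simp) (by simp)]; ring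
  have tω : Algebra.trace R A ω = b := by
    rw [tr ω 0 1 0 (-(a * c)) b (-a) (-(a * d)) 0 0 (by simp)
      (by simp only [map_neg, map_mul]; linear_combination k1)
      (by simp only [map_neg, map_mul, map_zero]; linear_combination k2)]; ring
  have tθ : Algebra.trace R A θ = -c := by
    rw [tr θ 0 0 1 (-(a * d)) 0 0 (-(b * d)) d (-c)  (by simp)
      (by simp only [map_neg, map_mul, map_zero]; linear_combination k2)
      (by simp only [map_neg, map_mul]; linear_combination k3)]; ring
  have hs : ∀ x y z : R, Algebra.trace R A (algebraMap R A x + algebraMap R A y * ω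
      + algebraMap R A z * θ) = 3 * x + y * b - z * c := by
    intro x y z
    have : algebraMap R A x + algebraMap R A y * ω + algebraMap R A z * θ
        = x • (1 : A) + y • ω + z • θ := by simp [Algebra.smul_def]
    rw [this, map_add, map_add, map_smul, map_smul, map_smul, t1, tω, tθ]
    simp only [smul_eq_mul]; ring
  have tωω : Algebra.trace R A (ω * ω) = b ^ 2 - 2 * a * c := by
    rw [show ω * ω = algebraMap R A (-(a * c)) + algebraMap R A b * ω
      + algebraMap R A (-a) * θ by simp only [map_neg, map_mul]; linear_combination k1, hs]
    ring
  have tωθ : Algebra.trace R A (ω * θ) = -3 * a * d := by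
    rw [show ω * θ = algebraMap R A (-(a * d)) + algebraMap R A 0 * ω
      + algebraMap R A 0 * θ by simp only [map_neg, map_mul, map_zero]; linear_combination k2, hs]
    ring
  have tθθ : Algebra.trace R A (θ * θ) = c ^ 2 - 2 * b * d := by
    rw [show θ * θ = algebraMap R A (-(b * d)) + algebraMap R A d * ω
      + algebraMap R A (-c) * θ by simp only [map_neg, map_mul]; linear_combination k3, hs]
    ring
  rw [Algebra.discr_def, Matrix.det_fin_three]
  simp only [Algebra.traceMatrix_apply, Algebra.traceForm_apply, h0, h1, h2, one_mul, mul_one,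
    t1, tω, tθ, tωω, tωθ, tθθ, mul_comm θ ω]
  unfold bcfDisc
  ring

/-- `1, ω, θ` is a `ℤ`-basis -/
def IB {A : Type*} [CommRing A] (ω θ : A) : Prop :=
  (∀ α : A, ∃ x y z : ℤ, α = x + y * ω + z * θ) ∧
  (∀ x y z : ℤ, (x : A) + y * ω + z * θ = 0 → x = 0 ∧ y = 0 ∧ z = 0)

theorem IB.basis {A : Type*} [CommRing A] {ω θ : A} (h : IB ω θ) :
    ∃ e : Module.Basis (Fin 3) ℤ A, e 0 = 1 ∧ e 1 = ω ∧ e 2 = θ := by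
  have li : LinearIndependent ℤ ![(1 : A), ω, θ] := by
    rw [Fintype.linearIndependent_iff]
    intro g hg
    simp [Fin.sum_univ_three] at hg
    obtain ⟨h1, h2, h3⟩ := h.2 (g 0) (g 1) (g 2) hg
    intro i; fin_cases i <;> simpa
  suffices hsp : ⊤ ≤ Submodule.span ℤ (Set.range ![(1 : A), ω, θ]) by
    exact ⟨Module.Basis.mk li hsp, by simp, by simp, by simp⟩
  intro α _
  obtain ⟨x, y, z, rfl⟩ := h.1 α
  have e : (x : A) + y * ω + z * θ = x • (1 : A) + y • ω + z • θ := by simp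
  rw [e]
  refine Submodule.add_mem _ (Submodule.add_mem _ ?_ ?_) ?_ <;>
    refine Submodule.smul_mem _ _ (Submodule.subset_span ?_)
  · exact ⟨0, rfl⟩
  · exact ⟨1, rfl⟩
  · exact ⟨2, rfl⟩

theorem IB.shear {A : Type*} [CommRing A] {ω θ : A} (h : IB ω θ) (m n t : ℤ) :
    IB (ω + m) (θ + t * ω + n) := by
  constructor
  · intro α
    obtain ⟨x, y, z, rfl⟩ := h.1 α
    refine ⟨x - (y - t * z) * m - z * n, y - t * z, z, ?_⟩
    push_cast; ring
  · intro x y z hx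
    have := h.2 (x + y * m + z * n) (y + t * z) z (by push_cast; linear_combination hx)
    obtain ⟨h1, h2, rfl⟩ := this
    simp at h2
    subst h2
    simpa using h1

theorem IB.swap {A : Type*} [CommRing A] {ω θ : A} (h : IB ω θ) : IB θ ω := by
  constructor
  · intro α
    obtain ⟨x, y, z, rfl⟩ := h.1 α
    exact ⟨x, z, y, by ring⟩
  · intro x y z hx
    have := h.2 x z y (by linear_combination hx)
    tauto

theorem IB.inj {A : Type*} [CommRing A] {ω θ : A} (h : IB ω θ) {x y z x' y' z' : ℤ}
    (e : (x : A) + y * ω + z * θ = x' + y' * ω + z' * θ) : x = x' ∧ y = y' ∧ z = z' := by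
  have := h.2 (x - x') (y - y') (z - z') (by push_cast; linear_combination e)
  lia

theorem IB.exists_DF {A : Type*} [CommRing A] {ω θ : A} (h : IB ω θ) :
    ∃ (ω' θ' : A) (f : Fin 4 → ℤ), IB ω' θ' ∧
      DF (f 0 : A) (f 1 : A) (f 2 : A) (f 3 : A) ω' θ' := by
  obtain ⟨n, u, v, hn⟩ := h.1 (ω * θ)
  have h' := h.shear (-v) (-u) 0
  set ω' : A := ω + ((-v : ℤ) : A) with hω
  set θ' : A := θ + ((0 : ℤ) : A) * ω + ((-u : ℤ) : A) with hθ
  have hp : ω' * θ' = ((n + u * v : ℤ) : A) := by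
    rw [hω, hθ]; push_cast; linear_combination hn
  obtain ⟨l, b, a', hl⟩ := h'.1 (ω' ^ 2)
  obtain ⟨m, d, c', hm⟩ := h'.1 (θ' ^ 2)
  set N := n + u * v with hN
  obtain ⟨e1, e2, e3⟩ := h'.inj (x := b * N + a' * m) (y := a' * d) (z := l + a' * c')
    (x' := 0) (y' := N) (z' := 0) (by
      push_cast
      linear_combination (-θ') * hl - a' * hm + (ω' - b) * hp)
  obtain ⟨k1, k2, k3⟩ := h'.inj (x := d * l + c' * N) (y := m + d * b) (z := d * a')
    (x' := 0) (y' := 0) (z' := N) (by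
      push_cast
      linear_combination (-ω') * hm - d * hl + (θ' - c') * hp)
  refine ⟨ω', θ', ![-a', b, -c', d], h', ?_, ?_, ?_⟩
  · have : l = -(a' * c') := by lia
    simp
    rw [hl, this]; push_cast; ring
  · rw [hp, ← e2]; simp
  · have : m = -(d * b) := by lia
    simp
    rw [hm, this]; push_cast; ring

theorem exists_IB (K : Type*) [Field K] [NumberField K] (hK : Module.finrank ℚ K = 3) :
    ∃ ω θ : 𝓞 K, IB ω θ := by
  classical
  let W : Submodule ℤ (𝓞 K) := Submodule.span ℤ {(1 : 𝓞 K)}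
  have hmem : ∀ x : 𝓞 K, x ∈ W ↔ ∃ n : ℤ, (n : 𝓞 K) = x := by
    intro x
    rw [Submodule.mem_span_singleton]
    simp
  have htf : ∀ (n : ℤ) (α : 𝓞 K), n ≠ 0 → n • α ∈ W → α ∈ W := by
    intro n α hn h
    rw [hmem] at h ⊢
    obtain ⟨m, hm⟩ := h
    have h1 : (α : K) = algebraMap ℚ K ((m : ℚ) / n) := by
      have := congrArg (algebraMap (𝓞 K) K) hm
      simp at this
      have hn' : (n : K) ≠ 0 := by exact_mod_cast hn
      simp
      field_simp
      rw [this]; ring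
    have h2 : IsIntegral ℤ (algebraMap ℚ K ((m : ℚ) / n)) := by
      rw [← h1]; exact α.isIntegral_coe
    have h3 : IsIntegral ℤ ((m : ℚ) / n) :=
      (isIntegral_algebraMap_iff (algebraMap ℚ K).injective).1 h2
    obtain ⟨k, hk⟩ := IsIntegrallyClosed.isIntegral_iff.1 h3
    refine ⟨k, ?_⟩
    apply RingOfIntegers.ext
    rw [h1, ← hk]; simp
  haveI : Module.IsTorsionFree ℤ (𝓞 K ⧸ W) := by
    rw [Module.isTorsionFree_iff_smul_eq_zero]
    intro n q h
    by_contra! hc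
    obtain ⟨α, rfl⟩ := W.mkQ_surjective q
    apply hc.2
    rw [← map_smul] at h
    rw [Submodule.mkQ_apply, Submodule.Quotient.mk_eq_zero] at h ⊢
    exact htf n α hc.1 h
  have bQ := Module.finBasis ℤ (𝓞 K ⧸ W)
  have hli : LinearIndependent ℤ (fun _ : Fin 1 => (1 : 𝓞 K)) := by
    rw [Fintype.linearIndependent_iff]
    intro g hg i
    simp at hg
    rwa [Subsingleton.elim i 0]
  let bW0 := Module.Basis.span hli
  have hW : Submodule.span ℤ (Set.range (fun _ : Fin 1 => (1 : 𝓞 K))) = W := by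
    simp [W]
  let bW : Module.Basis (Fin 1) ℤ W := bW0.map (LinearEquiv.ofEq _ _ hW)
  have hbW : (bW 0 : 𝓞 K) = 1 := by
    simp [bW, bW0, Module.Basis.span_apply]
  let e := Module.Basis.sumQuot bW bQ
  have hc : Module.finrank ℤ (𝓞 K ⧸ W) = 2 := by
    have := Module.finrank_eq_card_basis e
    rw [RingOfIntegers.rank, hK] at this
    simp at this
    lia
  rw [hc] at bQ
  let e' := (Module.Basis.sumQuot bW bQ)
  refine ⟨e' (Sum.inr 0), e' (Sum.inr 1), ?_, ?_⟩
  · intro α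
    refine ⟨e'.repr α (Sum.inl 0), e'.repr α (Sum.inr 0), e'.repr α (Sum.inr 1), ?_⟩
    conv_lhs => rw [← e'.sum_repr α]
    simp [Fintype.sum_sum_type, e', hbW, add_assoc]
  · intro x y z h
    have := Fintype.linearIndependent_iff.1 e'.linearIndependent
      (Sum.elim (fun _ => x) ![y, z]) (by
        simp [Fintype.sum_sum_type, e', hbW]
        simpa [e', add_assoc] using h)
    exact ⟨by simpa using this (Sum.inl 0), by simpa using this (Sum.inr 0),
      by simpa using this (Sum.inr 1)⟩

theorem discr_of_IB (K : Type*) [Field K] [NumberField K] {ω θ : 𝓞 K} (h : IB ω θ)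
    {f : Fin 4 → ℤ} (hf : DF (f 0 : 𝓞 K) (f 1 : 𝓞 K) (f 2 : 𝓞 K) (f 3 : 𝓞 K) ω θ) :
    NumberField.discr K = bcfD f := by
  obtain ⟨e, h0, h1, h2⟩ := h.basis
  rw [← NumberField.discr_eq_discr K e, bcfD]
  exact discr_of_DF e h0 h1 h2 (by simpa using hf)

/-- index form lemma -/
theorem index_form {A : Type*} [CommRing A] {ω₀ θ₀ : A} (h : IB ω₀ θ₀) {f g : Fin 4 → ℤ}
    (hg : DF (g 0 : A) (g 1 : A) (g 2 : A) (g 3 : A) ω₀ θ₀) {ω θ : A}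
    (hf : DF (f 0 : A) (f 1 : A) (f 2 : A) (f 3 : A) ω θ) {n x y m z w : ℤ}
    (hω : ω = n + x * ω₀ + y * θ₀) (hθ : θ = m + z * ω₀ + w * θ₀) :
    (x * w - y * z) • f = bcfAct g x y z w := by
  obtain ⟨g1, g2, g3⟩ := hg
  obtain ⟨f1, f2, f3⟩ := hf
  subst hω hθ
  obtain ⟨-, p1, q1⟩ := h.inj
    (x := n ^ 2 - x ^ 2 * g 0 * g 2 - y ^ 2 * g 1 * g 3 - 2 * x * y * g 0 * g 3)
    (y := 2 * n * x + x ^ 2 * g 1 + y ^ 2 * g 3) (z := 2 * n * y - x ^ 2 * g 0 - y ^ 2 * g 2)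
    (x' := -(f 0 * f 2) + f 1 * n - f 0 * m) (y' := f 1 * x - f 0 * z)
    (z' := f 1 * y - f 0 * w) (by
      push_cast
      linear_combination f1 - x ^ 2 * g1 - y ^ 2 * g3 - 2 * x * y * g2)
  obtain ⟨-, p2, q2⟩ := h.inj
    (x := n * m - x * z * g 0 * g 2 - y * w * g 1 * g 3 - (x * w + y * z) * g 0 * g 3)
    (y := n * z + m * x + x * z * g 1 + y * w * g 3)
    (z := n * w + m * y - x * z * g 0 - y * w * g 2)
    (x' := -(f 0 * f 3)) (y' := 0) (z' := 0) (by
      push_cast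
      linear_combination f2 - x * z * g1 - y * w * g3 - (x * w + y * z) * g2)
  obtain ⟨-, p3, q3⟩ := h.inj
    (x := m ^ 2 - z ^ 2 * g 0 * g 2 - w ^ 2 * g 1 * g 3 - 2 * z * w * g 0 * g 3)
    (y := 2 * m * z + z ^ 2 * g 1 + w ^ 2 * g 3) (z := 2 * m * w - z ^ 2 * g 0 - w ^ 2 * g 2)
    (x' := -(f 1 * f 3) + f 3 * n - f 2 * m) (y' := f 3 * x - f 2 * z)
    (z' := f 3 * y - f 2 * w) (by
      push_cast
      linear_combination f3 - z ^ 2 * g1 - w ^ 2 * g3 - 2 * z * w * g2)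
  apply bcf_ext_of_ev
  intro s t
  rw [bcfEv_act]
  simp only [bcfEv, Pi.smul_apply, smul_eq_mul]
  linear_combination -(s ^ 3 * (y * p1 - x * q1) + s ^ 2 * t * (w * p1 - z * q1)
    + s ^ 2 * t * 2 * (y * p2 - x * q2)
    + 2 * s * t ^ 2 * (w * p2 - z * q2) + s * t ^ 2 * (y * p3 - x * q3)
    + t ^ 3 * (w * p3 - z * q3))

theorem IB.not_dvd {A : Type*} [CommRing A] {ω θ : A} (h : IB ω θ) {p : ℤ} (hp : Prime p) :
    (¬ ∃ β : A, ω = p * β) ∧ (¬ ∃ β : A, θ = p * β) := by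
  have key : ∀ ω θ : A, IB ω θ → ¬ ∃ β : A, θ = p * β := by
    rintro ω θ h ⟨β, hβ⟩
    obtain ⟨x, y, z, rfl⟩ := h.1 β
    obtain ⟨h1, h2, h3⟩ := h.inj (x := 0) (y := 0) (z := 1) (x' := p * x) (y' := p * y)
      (z' := p * z) (by push_cast; linear_combination hβ)
    exact hp.not_isUnit (IsUnit.of_mul_eq_one _ h3.symm)
  exact ⟨key _ _ h.swap, key _ _ h⟩

theorem integral_div {K : Type*} [Field K] [NumberField K] {θ : 𝓞 K} {p u v w : ℤ}
    (hp : p ≠ 0) (h : θ ^ 3 + ((p * u : ℤ) : 𝓞 K) * θ ^ 2 + ((p ^ 2 * v : ℤ) : 𝓞 K) * θ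
      + ((p ^ 3 * w : ℤ) : 𝓞 K) = 0) : ∃ β : 𝓞 K, θ = p * β := by
  have hp' : (p : K) ≠ 0 := by exact_mod_cast hp
  have hi : IsIntegral ℤ ((θ : K) / p) := by
    refine ⟨X ^ 3 + C u * X ^ 2 + C v * X + C w, by monicity!, ?_⟩
    have := congrArg (algebraMap (𝓞 K) K) h
    simp at this
    simp only [eval₂_add, eval₂_mul, eval₂_C, eval₂_X_pow, eval₂_X, algebraMap_int_eq]
    simp only [eq_intCast]
    field_simp
    linear_combination this
  obtain ⟨β, hβ⟩ : ∃ β : 𝓞 K, (β : K) = (θ : K) / p := ⟨⟨_, hi⟩, rfl⟩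
  refine ⟨β, ?_⟩
  apply FaithfulSMul.algebraMap_injective (𝓞 K) K
  rw [map_mul, map_intCast]
  change (θ : K) = p * (β : K)
  rw [hβ]
  field_simp

theorem ram_form {A : Type*} [CommRing A] {ω θ : A} (h : IB ω θ) {f : Fin 4 → ℤ}
    (hf : DF (f 0 : A) (f 1 : A) (f 2 : A) (f 3 : A) ω θ) {p : ℤ} (hp : Prime p)
    (hp2 : ¬ p ∣ 2) (hp3 : ¬ p ∣ 3) (hD : p ∣ bcfD f) :
    ∃ (ω' θ' : A) (a b c d : ℤ), IB ω' θ' ∧ DF (a : A) (b : A) (c : A) (d : A) ω' θ' ∧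
      p ∣ c ∧ p ∣ d ∧ bcfDisc a b c d = bcfD f := by
  have shear : ∀ t : ℤ, ∃ (ω' θ' : A), IB ω' θ' ∧ DF ((f 0 : ℤ) : A)
      ((3 * f 0 * t + f 1 : ℤ) : A) ((3 * f 0 * t ^ 2 + 2 * f 1 * t + f 2 : ℤ) : A)
      ((f 0 * t ^ 3 + f 1 * t ^ 2 + f 2 * t + f 3 : ℤ) : A) ω' θ' := by
    intro t
    refine ⟨_, _, h.shear (t * f 0) (-(t * f 1) - t ^ 2 * f 0) t, ?_⟩
    have := hf.shear (t : A)
    push_cast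
    convert this using 1
    ring
  have hDf : bcfD f = bcfDisc (f 0) (f 1) (f 2) (f 3) := rfl
  rw [hDf] at hD ⊢
  generalize f 0 = a at *
  generalize f 1 = b at *
  generalize f 2 = c at *
  generalize f 3 = d at *
  by_cases hP : p ∣ b ^ 2 - 3 * a * c
  · have hQ : p ∣ b * c - 9 * a * d := by
      apply hp.dvd_of_dvd_pow (n := 2)
      have : (b * c - 9 * a * d) ^ 2 = (b ^ 2 - 3 * a * c) * (4 * (c ^ 2 - 3 * b * d))
        - bcfDisc a b c d * 3 := by unfold bcfDisc; ring
      rw [this]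
      exact dvd_sub (hP.mul_right _) (hD.mul_right _)
    by_cases ha : p ∣ a
    · have hb : p ∣ b := by
        apply hp.dvd_of_dvd_pow (n := 2)
        have : b ^ 2 = (b ^ 2 - 3 * a * c) + a * (3 * c) := by ring
        rw [this]
        exact dvd_add hP (ha.mul_right _)
      refine ⟨θ, ω, -d, -c, -b, -a, h.swap, ?_, by simpa, by simpa, bcfDisc_swap _ _ _ _⟩
      simpa using hf.swap
    · have hco : IsCoprime p (3 * a) :=
        (hp.coprime_iff_not_dvd).2 (fun h => (hp.dvd_or_dvd h).elim hp3 ha)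
      obtain ⟨u, v, huv⟩ := hco
      obtain ⟨ω', θ', h1, h2⟩ := shear (-(v * b))
      set t := -(v * b) with ht
      have hb : p ∣ 3 * a * t + b := ⟨u * b, by rw [ht]; linear_combination -b * huv⟩
      have hc : p ∣ 3 * a * t ^ 2 + 2 * b * t + c := by
        have : p ∣ (3 * a) * (3 * a * t ^ 2 + 2 * b * t + c) := by
          have e : (3 * a) * (3 * a * t ^ 2 + 2 * b * t + c)
            = (3 * a * t + b) * (3 * a * t + b) - (b ^ 2 - 3 * a * c) := by ring
          rw [e]
          exact dvd_sub (hb.mul_right _) hP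
        exact (hp.dvd_or_dvd this).resolve_left (fun h => (hp.dvd_or_dvd h).elim hp3 ha)
      have hd : p ∣ a * t ^ 3 + b * t ^ 2 + c * t + d := by
        have : p ∣ (3 * (3 * a)) * (a * t ^ 3 + b * t ^ 2 + c * t + d) := by
          have e : (3 * (3 * a)) * (a * t ^ 3 + b * t ^ 2 + c * t + d)
            = (3 * a * t + b) * (3 * a * t ^ 2 + 2 * b * t + c) - (b * c - 9 * a * d)
              - (b ^ 2 - 3 * a * c) * (2 * t) := by ring
          rw [e]
          exact dvd_sub (dvd_sub (hb.mul_right _) hQ) (hP.mul_right _)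
        refine (hp.dvd_or_dvd this).resolve_left (fun h => ?_)
        exact (hp.dvd_or_dvd h).elim hp3 (fun h => (hp.dvd_or_dvd h).elim hp3 ha)
      exact ⟨ω', θ', _, _, _, _, h1, h2, hc, hd, bcfDisc_shear _ _ _ _ _⟩
  · set P := b ^ 2 - 3 * a * c with hPd
    have hco : IsCoprime p (2 * P) :=
      (hp.coprime_iff_not_dvd).2 (fun h => (hp.dvd_or_dvd h).elim hp2 hP)
    obtain ⟨u, v, huv⟩ := hco
    obtain ⟨ω', θ', h1, h2⟩ := shear (-(v * (b * c - 9 * a * d)))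
    set t := -(v * (b * c - 9 * a * d)) with ht
    have hDD := bcfDisc_shear a b c d t
    have hPP : P = (3 * a * t + b) ^ 2 - 3 * a * (3 * a * t ^ 2 + 2 * b * t + c) := by
      rw [hPd]; ring
    have hQQ : p ∣ (3 * a * t + b) * (3 * a * t ^ 2 + 2 * b * t + c)
        - 9 * a * (a * t ^ 3 + b * t ^ 2 + c * t + d) := by
      have e : (3 * a * t + b) * (3 * a * t ^ 2 + 2 * b * t + c)
        - 9 * a * (a * t ^ 3 + b * t ^ 2 + c * t + d) = (b * c - 9 * a * d) + 2 * P * t := by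
        rw [hPd]; ring
      rw [e]
      refine ⟨u * (b * c - 9 * a * d), ?_⟩
      rw [ht]; linear_combination -(b * c - 9 * a * d) * huv
    generalize 3 * a * t + b = b' at *
    generalize 3 * a * t ^ 2 + 2 * b * t + c = c' at *
    generalize a * t ^ 3 + b * t ^ 2 + c * t + d = d' at *
    have hR : p ∣ c' ^ 2 - 3 * b' * d' := by
      have : p ∣ (2 * (2 * P)) * (c' ^ 2 - 3 * b' * d') := by
        have e : (2 * (2 * P)) * (c' ^ 2 - 3 * b' * d')
          = (b' * c' - 9 * a * d') * (b' * c' - 9 * a * d') + bcfDisc a b c d * 3 := by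
          rw [← hDD, hPP]; unfold bcfDisc; ring
        rw [e]
        exact dvd_add (hQQ.mul_right _) (hD.mul_right _)
      refine (hp.dvd_or_dvd this).resolve_left (fun h => ?_)
      exact (hp.dvd_or_dvd h).elim hp2 (fun h => (hp.dvd_or_dvd h).elim hp2 hP)
    have hc : p ∣ c' := by
      have : p ∣ P * c' := by
        have e : P * c' = (b' * c' - 9 * a * d') * b' - (c' ^ 2 - 3 * b' * d') * (3 * a) := by
          rw [hPP]; ring
        rw [e]
        exact dvd_sub (hQQ.mul_right _) (hR.mul_right _)
      exact (hp.dvd_or_dvd this).resolve_left hP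
    have hd : p ∣ d' := by
      have : p ∣ (3 * P) * d' := by
        have e : (3 * P) * d' = (b' * c' - 9 * a * d') * c' - (c' ^ 2 - 3 * b' * d') * b' := by
          rw [hPP]; ring
        rw [e]
        exact dvd_sub (hQQ.mul_right _) (hR.mul_right _)
      exact (hp.dvd_or_dvd this).resolve_left (fun h => (hp.dvd_or_dvd h).elim hp3 hP)
    exact ⟨ω', θ', _, _, _, _, h1, h2, hc, hd, hDD⟩

theorem ram_sq (K : Type*) [Field K] [NumberField K] (hK : Module.finrank ℚ K = 3)
    {p : ℕ} (hp : p.Prime) (hp5 : 5 ≤ p) (hD : (p : ℤ) ^ 2 ∣ NumberField.discr K) :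
    ¬ (p : ℤ) ^ 3 ∣ NumberField.discr K ∧
      ∃ P : Ideal (𝓞 K), P ^ 3 = Ideal.span {(p : 𝓞 K)} := by
  have hq : Prime (p : ℤ) := Nat.prime_iff_prime_int.1 hp
  have hq2 : ¬ (p : ℤ) ∣ 2 := fun h => by have := Int.le_of_dvd (by norm_num) h; lia
  have hq3 : ¬ (p : ℤ) ∣ 3 := fun h => by have := Int.le_of_dvd (by norm_num) h; lia
  obtain ⟨ω₁, θ₁, hB₁⟩ := exists_IB K hK
  obtain ⟨ω₀, θ₀, f, hB₀, hf₀⟩ := hB₁.exists_DF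
  have hdis := discr_of_IB K hB₀ hf₀
  obtain ⟨ω, θ, a, b, c, d, hB, hF, ⟨c', rfl⟩, ⟨d', rfl⟩, hDe⟩ := ram_form hB₀ hf₀ hq hq2 hq3
    (by rw [← hdis]; exact (dvd_pow_self _ two_ne_zero).trans hD)
  rw [hdis, ← hDe] at hD ⊢
  have hpc : ((p : ℤ) : 𝓞 K) = (p : 𝓞 K) := by simp
  generalize (p : ℤ) = q at *
  have hq0 : q ≠ 0 := hq.ne_zero
  obtain ⟨nω, nθ⟩ := hB.not_dvd hq
  have hnθ : ∀ v w, q ^ 2 * v = b * (q * d') → q ^ 3 * w = a * (q * d') ^ 2 → False := by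
    intro v w hv hw
    apply nθ
    apply integral_div (u := c') (v := v) (w := w) hq0
    rw [hv, hw]
    have := hF.cubic_right
    push_cast at this ⊢
    exact this
  have hd' : ¬ q ∣ d' := by
    rintro ⟨e, rfl⟩
    exact hnθ (b * e) (a * e ^ 2 * q) (by ring) (by ring)
  have hb : q ∣ b := by
    have h1 : q ^ 2 ∣ q * (4 * b ^ 3 * d') := by
      obtain ⟨x, hx⟩ := hD
      refine ⟨b ^ 2 * c' ^ 2 - 4 * a * c' ^ 3 * q - 27 * a ^ 2 * d' ^ 2
        + 18 * a * b * c' * d' - x, ?_⟩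
      unfold bcfDisc at hx
      linear_combination -hx
    rw [pow_two] at h1
    have h2 := (mul_dvd_mul_iff_left hq0).1 h1
    rcases hq.dvd_or_dvd h2 with h | h
    · rcases hq.dvd_or_dvd h with h | h
      · exact absurd (hq.dvd_of_dvd_pow (show q ∣ 2 ^ 2 by norm_num; exact h)) hq2
      · exact hq.dvd_of_dvd_pow h
    · exact absurd h hd'
  obtain ⟨b', rfl⟩ := hb
  have ha : ¬ q ∣ a := by
    rintro ⟨a', rfl⟩
    apply nω
    apply integral_div (u := -b') (v := a' * c') (w := -(a' ^ 2 * d')) hq0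
    have := hF.cubic_left
    push_cast at this ⊢
    linear_combination this
  refine ⟨?_, ?_⟩
  · rintro ⟨x, hx⟩
    have : q ^ 2 * q ∣ q ^ 2 * (27 * a ^ 2 * d' ^ 2) := by
      refine ⟨q * b' ^ 2 * c' ^ 2 - 4 * a * c' ^ 3 - 4 * b' ^ 3 * d' * q
        + 18 * a * b' * c' * d' - x, ?_⟩
      unfold bcfDisc at hx
      linear_combination -hx
    have h2 := (mul_dvd_mul_iff_left (pow_ne_zero 2 hq0)).1 this
    rcases hq.dvd_or_dvd h2 with h | h
    · rcases hq.dvd_or_dvd h with h | h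
      · exact absurd (hq.dvd_of_dvd_pow (show q ∣ 3 ^ 3 by norm_num; exact h)) hq3
      · exact ha (hq.dvd_of_dvd_pow h)
    · exact hd' (hq.dvd_of_dvd_pow h)
  · rw [← hpc]
    set P : Ideal (𝓞 K) := Ideal.span {(q : 𝓞 K), ω} with hP
    have mp : (q : 𝓞 K) ∈ P := Ideal.subset_span (by simp)
    have mω : ω ∈ P := Ideal.subset_span (by simp)
    have mul3 : ∀ x y z, x ∈ P → y ∈ P → z ∈ P → x * y * z ∈ P ^ 3 := by
      intro x y z hx hy hz
      rw [pow_succ, pow_two]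
      exact Ideal.mul_mem_mul (Ideal.mul_mem_mul hx hy) hz
    have hcub := hF.cubic_left
    push_cast at hcub
    refine ⟨P, le_antisymm ?_ ?_⟩
    · have h1 : P * P ≤ Ideal.span {(q : 𝓞 K), ω ^ 2} := by
        rw [Ideal.mul_le]
        intro x hx y hy
        rw [hP, Ideal.mem_span_pair] at hx hy
        obtain ⟨u, v, rfl⟩ := hx
        obtain ⟨u', v', rfl⟩ := hy
        rw [Ideal.mem_span_pair]
        exact ⟨u * u' * q + u * v' * ω + u' * v * ω, v * v', by ring⟩
      rw [pow_succ, pow_two]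
      refine (Ideal.mul_mono_left h1).trans ?_
      rw [Ideal.mul_le]
      intro x hx y hy
      rw [hP, Ideal.mem_span_pair] at hy
      rw [Ideal.mem_span_pair] at hx
      obtain ⟨u, v, rfl⟩ := hx
      obtain ⟨u', v', rfl⟩ := hy
      rw [Ideal.mem_span_singleton]
      refine ⟨u * (u' * q + v' * ω) + v * u' * ω ^ 2
        + v * v' * (b' * ω ^ 2 - a * c' * ω + a ^ 2 * d'), ?_⟩
      linear_combination v * v' * hcub
    · rw [Ideal.span_singleton_le_iff_mem]
      have hco : IsCoprime q (a ^ 2 * d') :=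
        (hq.coprime_iff_not_dvd).2 (fun h => (hq.dvd_or_dvd h).elim
          (fun h => ha (hq.dvd_of_dvd_pow h)) hd')
      obtain ⟨u, v, huv⟩ := hco
      have huv' : (u : 𝓞 K) * q + v * (a ^ 2 * d') = 1 := by exact_mod_cast huv
      have e1 : (q : 𝓞 K) * ω * ω ∈ P ^ 3 := mul3 _ _ _ mp mω mω
      have e2 : (q : 𝓞 K) * q * ω ∈ P ^ 3 := mul3 _ _ _ mp mp mω
      have e3 : (q : 𝓞 K) * q * q ∈ P ^ 3 := mul3 _ _ _ mp mp mp
      have e4 : ω * ω * ω ∈ P ^ 3 := mul3 _ _ _ mω mω mω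
      have e5 : (q : 𝓞 K) * ω ∈ P ^ 3 := by
        have : (q : 𝓞 K) * ω = u * (q * q * ω)
            + v * (ω * (ω * ω * ω - b' * (q * ω * ω)) + a * c' * (q * ω * ω)) := by
          linear_combination (-(q : 𝓞 K) * ω) * huv' - v * ω * hcub
        rw [this]
        exact add_mem (Ideal.mul_mem_left _ _ e2) (Ideal.mul_mem_left _ _
          (add_mem (Ideal.mul_mem_left _ _ (sub_mem e4 (Ideal.mul_mem_left _ _ e1)))
            (Ideal.mul_mem_left _ _ e1)))
      have e6 : (q : 𝓞 K) * (a ^ 2 * d') ∈ P ^ 3 := by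
        have : (q : 𝓞 K) * (a ^ 2 * d') = ω * ω * ω - b' * (q * ω * ω) + a * c' * (q * ω) := by
          linear_combination -hcub
        rw [this]
        exact add_mem (sub_mem e4 (Ideal.mul_mem_left _ _ e1)) (Ideal.mul_mem_left _ _ e5)
      have : (q : 𝓞 K) = u ^ 2 * (q * q * q)
          + (2 * u * v * q + v ^ 2 * (a ^ 2 * d')) * (q * (a ^ 2 * d')) := by
        linear_combination (-(q : 𝓞 K) * (u * q + v * (a ^ 2 * d') + 1)) * huv'
      rw [this]
      exact add_mem (Ideal.mul_mem_left _ _ e3) (Ideal.mul_mem_left _ _ e6)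

theorem lin3 {K : Type*} [Field K] [NumberField K] {z : K}
    (hz : (minpoly ℚ z).natDegree = 3) {x y w : ℚ}
    (h : (x : K) + y * z + w * z ^ 2 = 0) : x = 0 ∧ y = 0 ∧ w = 0 := by
  set g : ℚ[X] := C x + C y * X + C w * X ^ 2 with hg
  have hev : aeval z g = 0 := by simp [hg, h]
  have hg0 : g = 0 := by
    by_contra hne
    have h1 := minpoly.degree_le_of_ne_zero ℚ z hne hev
    have h2 : g.degree ≤ 2 := by rw [hg]; compute_degree
    rw [Polynomial.degree_eq_natDegree (minpoly.ne_zero_of_finite ℚ z), hz] at h1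
    have := h1.trans h2
    norm_num at this
  have c0 := congrArg (fun q => coeff q 0) hg0
  have c1 := congrArg (fun q => coeff q 1) hg0
  have c2 := congrArg (fun q => coeff q 2) hg0
  simp [hg, coeff_X, coeff_C] at c0 c1 c2
  exact ⟨c0, c1, c2⟩

theorem minpoly_three {K : Type*} [Field K] [NumberField K] (hK : Module.finrank ℚ K = 3)
    {z : K} (hz : ∀ q : ℚ, (q : K) ≠ z) : (minpoly ℚ z).natDegree = 3 := by
  have h1 : (minpoly ℚ z).natDegree ∣ 3 := hK ▸ minpoly.degree_dvd (Algebra.IsIntegral.isIntegral z)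
  rcases (Nat.dvd_prime Nat.prime_three).1 h1 with h | h
  · rw [minpoly.natDegree_eq_one_iff] at h
    obtain ⟨q, hq⟩ := h
    exact absurd (by simpa using hq) (hz q)
  · exact h

/-- A cube root of a rational number in a cubic field which is not pure is rational. -/
theorem cube_rational {K : Type*} [Field K] [NumberField K] (hK : Module.finrank ℚ K = 3)
    (hns : ∀ q : ℚ, (-3 * NumberField.discr K : ℚ) ≠ q ^ 2) {z : K} {m : ℚ} (hm : m ≠ 0)
    (hz : z ^ 3 = m) : ∃ q : ℚ, (q : K) = z := by
  classical
  by_contra! hq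
  have h3 := minpoly_three hK hq
  have li : LinearIndependent ℚ ![(1 : K), z, -z ^ 2] := by
    rw [Fintype.linearIndependent_iff]
    intro g hg
    simp [Fin.sum_univ_three, Algebra.smul_def] at hg
    obtain ⟨h1, h2, h3⟩ := lin3 h3 (x := g 0) (y := g 1) (w := - g 2)
      (by push_cast; linear_combination hg)
    intro i; fin_cases i
    · exact h1
    · exact h2
    · simpa using h3
  let e := basisOfLinearIndependentOfCardEqFinrank li (by simp [hK])
  have he : ⇑e = ![(1 : K), z, -z ^ 2] := by simp [e]
  have hd : Algebra.discr ℚ e = bcfDisc 1 0 0 m :=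
    discr_of_DF e (by simp [he]) (ω := z) (θ := -z ^ 2) (by simp [he]) (by simp [he]) (by
      refine ⟨?_, ?_, ?_⟩
      · simp
      · simp; linear_combination hz
      · simp; linear_combination z * hz)
  let b0 := integralBasis K
  have hcard : Fintype.card (Module.Free.ChooseBasisIndex ℤ (𝓞 K)) = 3 := by
    rw [← Module.finrank_eq_card_basis b0, hK]
  let σ := Fintype.equivFinOfCardEq hcard
  let b := b0.reindex σ
  have hb : Algebra.discr ℚ b = NumberField.discr K := by
    rw [NumberField.coe_discr, Module.Basis.coe_reindex, Algebra.discr_reindex]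
  have h1 := Algebra.discr_of_matrix_vecMul (A := ℚ) (⇑b) (b.toMatrix e)
  rw [Module.Basis.toMatrix_map_vecMul, hb, hd] at h1
  set t := (b.toMatrix ⇑e).det
  have ht : t ≠ 0 := by
    intro h0
    rw [h0] at h1
    simp [bcfDisc, hm] at h1
  apply hns (9 * m / t)
  field_simp
  unfold bcfDisc at h1
  linear_combination 3 * h1

theorem unit_classes (K : Type*) [Field K] [NumberField K] (hK : Module.finrank ℚ K = 3) :
    ∃ χ : (𝓞 K)ˣ → Fin 27, ∀ u u', χ u = χ u' → ∃ v : (𝓞 K)ˣ, u = u' * v ^ 3 := by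
  classical
  obtain ⟨g, hg⟩ := IsCyclic.exists_generator (α := Units.torsion K)
  have hrk : Units.rank K ≤ 2 := by
    have h1 := InfinitePlace.card_add_two_mul_card_eq_rank K
    have h2 := InfinitePlace.card_eq_nrRealPlaces_add_nrComplexPlaces K
    rw [Units.rank, h2]
    lia
  have hrep : ∀ u : (𝓞 K)ˣ, ∃ (k : ℤ) (e : Fin (Units.rank K) → ℤ),
      u = (g : (𝓞 K)ˣ) ^ k * ∏ i, (Units.fundSystem K i) ^ (e i) := by
    intro u
    obtain ⟨⟨ζ, e⟩, h, -⟩ := Units.exist_unique_eq_mul_prod K u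
    obtain ⟨k, hk⟩ := hg ζ
    refine ⟨k, e, ?_⟩
    rw [h, ← hk]
    simp
  choose k e hke using hrep
  let χ0 : (𝓞 K)ˣ → ZMod 3 × (Fin (Units.rank K) → ZMod 3) :=
    fun u => ((k u : ZMod 3), fun i => (e u i : ZMod 3))
  have hcard : Fintype.card (ZMod 3 × (Fin (Units.rank K) → ZMod 3)) ≤ 27 := by
    simp [ZMod.card]
    calc 3 * 3 ^ (Units.rank K) ≤ 3 * 3 ^ 2 := by gcongr; norm_num
      _ = 27 := by norm_num
  obtain ⟨ι⟩ : Nonempty (ZMod 3 × (Fin (Units.rank K) → ZMod 3) ↪ Fin 27) :=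
    Function.Embedding.nonempty_of_card_le (by simpa using hcard)
  refine ⟨fun u => ι (χ0 u), ?_⟩
  intro u u' h
  have h' := ι.injective h
  simp only [χ0, Prod.mk.injEq, funext_iff] at h'
  obtain ⟨h1, h2⟩ := h'
  have d1 : ∃ q, k u = k u' + 3 * q := by
    obtain ⟨q, hq⟩ := (ZMod.intCast_eq_intCast_iff_dvd_sub _ _ 3).1 h1.symm
    exact ⟨q, by push_cast at hq; lia⟩
  have d2 : ∀ i, ∃ q, e u i = e u' i + 3 * q := by
    intro i
    obtain ⟨q, hq⟩ := (ZMod.intCast_eq_intCast_iff_dvd_sub _ _ 3).1 (h2 i).symm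
    exact ⟨q, by push_cast at hq; lia⟩
  obtain ⟨q, hq⟩ := d1
  choose r hr using d2
  refine ⟨(g : (𝓞 K)ˣ) ^ q * ∏ i, (Units.fundSystem K i) ^ (r i), ?_⟩
  rw [hke u, hke u', hq]
  simp only [hr, zpow_add, mul_pow, Finset.prod_mul_distrib, ← Finset.prod_pow, zpow_mul]
  have : ∀ x : (𝓞 K)ˣ, ∀ n : ℤ, (x ^ (3 : ℤ)) ^ n = (x ^ n) ^ 3 := by
    intro x n; rw [← zpow_mul, mul_comm, zpow_mul]; rfl
  simp only [this]
  rw [mul_mul_mul_comm]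

theorem prod_pow_cube {r : ℕ} {p : Fin r → ℕ} (hp : ∀ j, (p j).Prime)
    (hinj : Function.Injective p) {e e' : Fin r → Fin 3} {q : ℚ}
    (h : ((∏ j, p j ^ (e j : ℕ) : ℕ) : ℚ) = q ^ 3 * ((∏ j, p j ^ (e' j : ℕ) : ℕ) : ℚ)) :
    e = e' := by
  have hne : ∀ e : Fin r → Fin 3, (∏ j, p j ^ (e j : ℕ)) ≠ 0 := fun e =>
    Finset.prod_ne_zero_iff.2 (fun j _ => pow_ne_zero _ (hp j).ne_zero)
  have hq : q ≠ 0 := by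
    rintro rfl
    simp at h
    have := hne e
    rw [Finset.prod_ne_zero_iff] at this
    rw [Finset.prod_eq_zero_iff] at h
    obtain ⟨j, hj, h0⟩ := h
    exact this j hj (by exact_mod_cast h0)
  have hval : ∀ (e : Fin r → Fin 3) i, padicValRat (p i) ((∏ j, p j ^ (e j : ℕ) : ℕ) : ℚ)
      = (e i : ℕ) := by
    intro e i
    rw [padicValRat.of_nat]
    rw [← Nat.factorization_def _ (hp i), Nat.factorization_prod
      (fun j _ => pow_ne_zero _ (hp j).ne_zero)]
    simp only [Finsupp.finsetSum_apply, (hp _).factorization_pow]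
    rw [Finset.sum_eq_single i]
    · simp
    · intro j _ hj
      simp [hinj.ne hj]
    · simp
  funext i
  have := Fact.mk (hp i)
  have := congrArg (padicValRat (p i)) h
  rw [padicValRat.mul (pow_ne_zero _ hq) (by exact_mod_cast hne e'), hval, hval,
    padicValRat.pow] at this
  have h1 := (e i).2
  have h2 := (e' i).2
  push_cast at this
  apply Fin.ext
  omega

theorem class_lower (K : Type*) [Field K] [NumberField K] (hK : Module.finrank ℚ K = 3)
    (hns : ∀ q : ℚ, (-3 * NumberField.discr K : ℚ) ≠ q ^ 2) {r : ℕ} {p : Fin r → ℕ}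
    (hp : ∀ j, (p j).Prime) (hinj : Function.Injective p)
    (hP : ∀ j, ∃ P : Ideal (𝓞 K), P ^ 3 = Ideal.span {(p j : 𝓞 K)}) :
    3 ^ r ≤ 27 * NumberField.classNumber K := by
  classical
  choose P hP using hP
  obtain ⟨χ, hχ⟩ := unit_classes K hK
  have hpne : ∀ j, (p j : 𝓞 K) ≠ 0 := fun j => by exact_mod_cast (hp j).ne_zero
  have hP0 : ∀ j, P j ≠ 0 := by
    intro j h0
    have := hP j
    rw [h0, zero_pow (by norm_num), eq_comm] at this
    exact hpne j (Ideal.span_singleton_eq_bot.1 this)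
  let I : (Fin r → Fin 3) → nonZeroDivisors (Ideal (𝓞 K)) := fun e =>
    ⟨∏ j, P j ^ (e j : ℕ), mem_nonZeroDivisors_of_ne_zero
      (Finset.prod_ne_zero_iff.2 (fun j _ => pow_ne_zero _ (hP0 j)))⟩
  have hI3 : ∀ e, (I e : Ideal (𝓞 K)) ^ 3
      = Ideal.span {((∏ j, p j ^ (e j : ℕ) : ℕ) : 𝓞 K)} := by
    intro e
    simp only [I]
    rw [← Finset.prod_pow]
    push_cast
    rw [← Ideal.prod_span_singleton]
    refine Finset.prod_congr rfl (fun j _ => ?_)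
    rw [← pow_mul, mul_comm, pow_mul, hP, Ideal.span_singleton_pow]
  let Φ : (Fin r → Fin 3) → ClassGroup (𝓞 K) := fun e => ClassGroup.mk0 (I e)
  have hfib : ∀ C : ClassGroup (𝓞 K),
      (Finset.univ.filter (fun e => Φ e = C)).card ≤ 27 := by
    intro C
    rcases (Finset.univ.filter (fun e => Φ e = C)).eq_empty_or_nonempty with h | ⟨e0, he0⟩
    · rw [h]; simp
    have key : ∀ e ∈ Finset.univ.filter (fun e => Φ e = C), ∃ (u : (𝓞 K)ˣ) (x y : 𝓞 K),
        x ≠ 0 ∧ y ≠ 0 ∧ x ^ 3 * ((∏ j, p j ^ (e j : ℕ) : ℕ) : 𝓞 K) * u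
          = y ^ 3 * ((∏ j, p j ^ (e0 j : ℕ) : ℕ) : 𝓞 K) := by
      intro e he
      simp at he he0
      have : ClassGroup.mk0 (I e) = ClassGroup.mk0 (I e0) := by
        change Φ e = Φ e0
        rw [he, he0]
      rw [ClassGroup.mk0_eq_mk0_iff] at this
      obtain ⟨x, y, hx, hy, hxy⟩ := this
      have h3 := congrArg (· ^ 3) hxy
      simp only [mul_pow, hI3, Ideal.span_singleton_pow, Ideal.span_singleton_mul_span_singleton]
        at h3
      rw [Ideal.span_singleton_eq_span_singleton] at h3
      obtain ⟨u, hu⟩ := h3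
      exact ⟨u, x, y, hx, hy, hu⟩
    choose! u x y hx hy hxy using key
    have : (Finset.univ.filter (fun e => Φ e = C)).card ≤ (Finset.univ : Finset (Fin 27)).card := by
      refine Finset.card_le_card_of_injOn (fun e => χ (u e)) (by simp) ?_
      intro e he e' he' hee
      obtain ⟨v, hv⟩ := hχ _ _ hee
      have h1 := hxy e he
      have h2 := hxy e' he'
      rw [hv] at h1
      push_cast at h1 h2
      have hpr : ∀ e : Fin r → Fin 3, ((∏ j, p j ^ (e j : ℕ) : ℕ) : ℚ) ≠ 0 := fun e => by
        exact_mod_cast Finset.prod_ne_zero_iff.2 (fun j _ => pow_ne_zero _ (hp j).ne_zero)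
      have a1 : algebraMap (𝓞 K) K (x e) ≠ 0 := by simpa using hx e he
      have a2 : algebraMap (𝓞 K) K (y e) ≠ 0 := by simpa using hy e he
      have a3 : algebraMap (𝓞 K) K (x e') ≠ 0 := by simpa using hx e' he'
      have a4 : algebraMap (𝓞 K) K (y e') ≠ 0 := by simpa using hy e' he'
      have a5 : algebraMap (𝓞 K) K (v : 𝓞 K) ≠ 0 := by simp
      have a6 : algebraMap (𝓞 K) K (u e' : 𝓞 K) ≠ 0 := by simp
      have b1 := congrArg (algebraMap (𝓞 K) K) h1
      have b2 := congrArg (algebraMap (𝓞 K) K) h2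
      simp only [map_mul, map_pow, map_prod, map_natCast] at b1 b2
      have hn := hpr e
      have hn' := hpr e'
      have c1 : ((∏ j, p j ^ (e j : ℕ) : ℕ) : K) = ∏ j, (p j : K) ^ (e j : ℕ) := by push_cast; rfl
      have c2 : ((∏ j, p j ^ (e' j : ℕ) : ℕ) : K) = ∏ j, (p j : K) ^ (e' j : ℕ) := by
        push_cast; rfl
      rw [← c1] at b1
      rw [← c2] at b2
      have hzz : (algebraMap (𝓞 K) K (y e) * algebraMap (𝓞 K) K (x e') /
          (algebraMap (𝓞 K) K (x e) * algebraMap (𝓞 K) K (y e') *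
            algebraMap (𝓞 K) K (v : 𝓞 K))) ^ 3
          = ((((∏ j, p j ^ (e j : ℕ) : ℕ) : ℚ) / ((∏ j, p j ^ (e' j : ℕ) : ℕ) : ℚ) : ℚ) : K) := by
        have hn'K : ((∏ j, p j ^ (e' j : ℕ) : ℕ) : K) ≠ 0 := by exact_mod_cast hn'
        rw [Rat.cast_div, Rat.cast_natCast, Rat.cast_natCast]
        rw [div_pow, div_eq_div_iff (by positivity) hn'K]
        apply mul_left_cancel₀ a6
        generalize ((∏ j, p j ^ (e j : ℕ) : ℕ) : K) = n at *
        generalize ((∏ j, p j ^ (e' j : ℕ) : ℕ) : K) = n' at *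
        generalize (∏ j, (p j : K) ^ (e0 j : ℕ)) = n0 at *
        linear_combination (algebraMap (𝓞 K) K (y e)) ^ 3 * b2
            - (algebraMap (𝓞 K) K (y e')) ^ 3 * b1
      obtain ⟨q, hq⟩ := cube_rational hK hns (div_ne_zero hn hn') hzz
      apply prod_pow_cube hp hinj (q := q)
      have hz3 : (q : K) ^ 3 = (((∏ j, p j ^ (e j : ℕ) : ℕ) : ℚ)
          / ((∏ j, p j ^ (e' j : ℕ) : ℕ) : ℚ) : ℚ) := by
        rw [hq, hzz]
      have hz4 : q ^ 3 = (((∏ j, p j ^ (e j : ℕ) : ℕ) : ℚ)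
          / ((∏ j, p j ^ (e' j : ℕ) : ℕ) : ℚ)) := by exact_mod_cast hz3
      rw [hz4, div_mul_cancel₀ _ hn']
    simpa using this
  have := Finset.card_le_mul_card_image (f := Φ) (Finset.univ : Finset (Fin r → Fin 3)) 27
    (fun C _ => hfib C)
  calc 3 ^ r = (Finset.univ : Finset (Fin r → Fin 3)).card := by simp
    _ ≤ 27 * (Finset.univ.image Φ).card := this
    _ ≤ 27 * NumberField.classNumber K := by
      gcongr
      exact Finset.card_le_univ _

/-- the form is divisible by `p` -/
def BadC (p : ℤ) (f : Fin 4 → ℤ) : Prop := ∀ i, p ∣ f i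

/-- the form is nonmaximal at `p` (up to content) -/
def BadNC (p : ℤ) (f : Fin 4 → ℤ) : Prop :=
  ∃ u v : ℤ, ¬ (p ∣ u ∧ p ∣ v) ∧ p ^ 2 ∣ bcfEv f u v ∧
    p ∣ 3 * f 0 * u ^ 2 + 2 * f 1 * u * v + f 2 * v ^ 2 ∧
    p ∣ f 1 * u ^ 2 + 2 * f 2 * u * v + 3 * f 3 * v ^ 2

theorem bad_of_index {p : ℤ} (hp : Prime p) (f : Fin 4 → ℤ) : ∀ (M : ℕ) (g : Fin 4 → ℤ)
    (x y z w : ℤ), (x * w - y * z).natAbs = M → x * w - y * z ≠ 0 →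
    (x * w - y * z) • f = bcfAct g x y z w → p ∣ x * w - y * z → BadC p f ∨ BadNC p f := by
  intro M
  induction M using Nat.strong_induction_on with
  | _ M ih =>
  intro g x y z w hM hN h hpN
  have h0 := congrFun h 0
  have h1 := congrFun h 1
  have h2 := congrFun h 2
  have h3 := congrFun h 3
  simp [bcfAct, bcfEv] at h0 h1 h2 h3
  by_cases c1 : ¬ (p ∣ z ∧ p ∣ x)
  · right
    obtain ⟨n, hn⟩ := hpN
    refine ⟨z, -x, by simpa using c1, ?_, ?_, ?_⟩
    · refine ⟨-(n ^ 2 * g 3), ?_⟩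
      apply mul_left_cancel₀ hN
      have : p ^ 2 * -(n ^ 2 * g 3) = -(x * w - y * z) ^ 2 * g 3 := by rw [hn]; ring
      rw [this]
      simp only [bcfEv]
      linear_combination z ^ 3 * h0 + z ^ 2 * (-x) * h1 + z * x ^ 2 * h2 - x ^ 3 * h3
    · refine ⟨n * (x * g 2 + 3 * y * g 3), ?_⟩
      apply mul_left_cancel₀ hN
      have : p * (n * (x * g 2 + 3 * y * g 3)) = (x * w - y * z) * (x * g 2 + 3 * y * g 3) := by
        rw [hn]; ring
      rw [this]
      linear_combination 3 * z ^ 2 * h0 + 2 * z * (-x) * h1 + x ^ 2 * h2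
    · refine ⟨n * (z * g 2 + 3 * w * g 3), ?_⟩
      apply mul_left_cancel₀ hN
      have : p * (n * (z * g 2 + 3 * w * g 3)) = (x * w - y * z) * (z * g 2 + 3 * w * g 3) := by
        rw [hn]; ring
      rw [this]
      linear_combination z ^ 2 * h1 + 2 * z * (-x) * h2 + 3 * x ^ 2 * h3
  by_cases c2 : ¬ (p ∣ w ∧ p ∣ y)
  · right
    obtain ⟨n, hn⟩ := hpN
    refine ⟨w, -y, by simpa using c2, ?_, ?_, ?_⟩
    · refine ⟨(n ^ 2 * g 0), ?_⟩
      apply mul_left_cancel₀ hN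
      have : p ^ 2 * (n ^ 2 * g 0) = (x * w - y * z) ^ 2 * g 0 := by rw [hn]; ring
      rw [this]
      simp only [bcfEv]
      linear_combination w ^ 3 * h0 + w ^ 2 * (-y) * h1 + w * y ^ 2 * h2 - y ^ 3 * h3
    · refine ⟨n * (3 * x * g 0 + y * g 1), ?_⟩
      apply mul_left_cancel₀ hN
      have : p * (n * (3 * x * g 0 + y * g 1)) = (x * w - y * z) * (3 * x * g 0 + y * g 1) := by
        rw [hn]; ring
      rw [this]
      linear_combination 3 * w ^ 2 * h0 + 2 * w * (-y) * h1 + y ^ 2 * h2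
    · refine ⟨n * (3 * z * g 0 + w * g 1), ?_⟩
      apply mul_left_cancel₀ hN
      have : p * (n * (3 * z * g 0 + w * g 1)) = (x * w - y * z) * (3 * z * g 0 + w * g 1) := by
        rw [hn]; ring
      rw [this]
      linear_combination w ^ 2 * h1 + 2 * w * (-y) * h2 + 3 * y ^ 2 * h3
  push Not at c1 c2
  obtain ⟨⟨z', rfl⟩, ⟨x', rfl⟩⟩ := c1
  obtain ⟨⟨w', rfl⟩, ⟨y', rfl⟩⟩ := c2
  have hNN : p * x' * (p * w') - p * y' * (p * z') = p ^ 2 * (x' * w' - y' * z') := by ring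
  rw [hNN] at hN hM
  have hN1 : x' * w' - y' * z' ≠ 0 := fun h => hN (by rw [h, mul_zero])
  have hp2 : p ^ 2 ≠ 0 := pow_ne_zero 2 hp.ne_zero
  have hact : (x' * w' - y' * z') • f = bcfAct (p • g) x' y' z' w' := by
    funext i
    apply mul_left_cancel₀ hp2
    have hi := congrFun h i
    rw [hNN] at hi
    simp only [Pi.smul_apply, smul_eq_mul] at hi ⊢
    rw [← mul_assoc, hi]
    fin_cases i <;> simp [bcfAct, bcfEv] <;> ring
  by_cases hd : p ∣ x' * w' - y' * z'
  · refine ih (x' * w' - y' * z').natAbs ?_ (p • g) x' y' z' w' rfl hN1 hact hd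
    rw [← hM, Int.natAbs_mul]
    have h1 : 0 < (x' * w' - y' * z').natAbs := Int.natAbs_pos.2 hN1
    have h2 : 1 < (p ^ 2).natAbs := by
      have : p.natAbs ≠ 1 := fun h => hp.not_isUnit (Int.isUnit_iff_natAbs_eq.2 h)
      have h0 : p.natAbs ≠ 0 := Int.natAbs_ne_zero.2 hp.ne_zero
      rw [Int.natAbs_pow]
      exact Nat.one_lt_pow (by norm_num) (by lia)
    nlinarith
  · left
    intro i
    have hi := congrFun hact i
    have : p ∣ (x' * w' - y' * z') * f i := by
      simp only [Pi.smul_apply, smul_eq_mul] at hi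
      rw [hi]
      fin_cases i <;> simp [bcfAct, bcfEv] <;> refine ⟨?_, ?_⟩ 
      · exact g 0 * x' ^ 3 + g 1 * x' ^ 2 * y' + g 2 * x' * y' ^ 2 + g 3 * y' ^ 3
      · ring
      · exact 3 * g 0 * x' ^ 2 * z' + g 1 * (x' ^ 2 * w' + 2 * x' * y' * z')
          + g 2 * (2 * x' * y' * w' + y' ^ 2 * z') + 3 * g 3 * y' ^ 2 * w'
      · ring
      · exact 3 * g 0 * x' * z' ^ 2 + g 1 * (2 * x' * z' * w' + y' * z' ^ 2)
          + g 2 * (x' * w' ^ 2 + 2 * y' * z' * w') + 3 * g 3 * y' * w' ^ 2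
      · ring
      · exact g 0 * z' ^ 3 + g 1 * z' ^ 2 * w' + g 2 * z' * w' ^ 2 + g 3 * w' ^ 3
      · ring
    exact (hp.dvd_or_dvd this).resolve_left hd

theorem IB.of_unit {A : Type*} [CommRing A] {ω₀ θ₀ ω θ : A} (h : IB ω₀ θ₀)
    {n x y m z w : ℤ} (hω : ω = n + x * ω₀ + y * θ₀) (hθ : θ = m + z * ω₀ + w * θ₀)
    (hu : IsUnit (x * w - y * z)) : IB ω θ := by
  obtain ⟨e, he⟩ := hu.exists_right_inv
  have he' : ((x : A) * w - y * z) * e = 1 := by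
    have := congrArg (Int.cast : ℤ → A) he
    push_cast at this
    exact this
  have e1 : ω₀ = e * (w * (ω - n) - y * (θ - m)) := by
    rw [hω, hθ]; linear_combination -ω₀ * he'
  have e2 : θ₀ = e * (-z * (ω - n) + x * (θ - m)) := by
    rw [hω, hθ]; linear_combination -θ₀ * he'
  constructor
  · intro α
    obtain ⟨p, q, r, hα⟩ := h.1 α
    refine ⟨p + q * (e * (-w * n + y * m)) + r * (e * (z * n - x * m)),
      q * e * w - r * e * z, -q * e * y + r * e * x, ?_⟩
    rw [hα]
    nth_rw 1 [e1]
    nth_rw 1 [e2]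
    push_cast; ring
  · intro p q r h0
    rw [hω, hθ] at h0
    obtain ⟨k1, k2, k3⟩ := h.2 (p + q * n + r * m) (q * x + r * z) (q * y + r * w)
      (by push_cast; linear_combination h0)
    have hq : q = 0 := by linear_combination -q * he + e * w * k2 - e * z * k3
    have hr : r = 0 := by linear_combination -r * he - e * y * k2 + e * x * k3
    subst hq hr
    simpa using k1

theorem IB.max {A : Type*} [CommRing A] {ω₀ θ₀ ω θ : A} (h : IB ω₀ θ₀) {f g : Fin 4 → ℤ}
    (hg : DF (g 0 : A) (g 1 : A) (g 2 : A) (g 3 : A) ω₀ θ₀)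
    (hf : DF (f 0 : A) (f 1 : A) (f 2 : A) (f 3 : A) ω θ) 
    (hli : ∀ x y z : ℤ, (x : A) + y * ω + z * θ = 0 → x = 0 ∧ y = 0 ∧ z = 0)
    (hmax : ∀ p : ℕ, p.Prime → ¬ BadC p f ∧ ¬ BadNC p f) : IB ω θ := by
  obtain ⟨n, x, y, hω⟩ := h.1 ω
  obtain ⟨m, z, w, hθ⟩ := h.1 θ
  have hact := index_form h hg hf hω hθ
  refine h.of_unit hω hθ ?_
  have hN : x * w - y * z ≠ 0 := by
    intro h0
    have h0' : (x : A) * w - y * z = 0 := by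
      have := congrArg (Int.cast : ℤ → A) h0
      push_cast at this
      exact this
    obtain ⟨-, k1, k2⟩ := hli (-(w * n) + y * m) w (-y) (by
      rw [hω, hθ]; push_cast; linear_combination ω₀ * h0')
    obtain ⟨-, k3, k4⟩ := hli (-(z * n) + x * m) z (-x) (by
      rw [hω, hθ]; push_cast; linear_combination (-θ₀) * h0')
    have hx : x = 0 := by lia
    have hy : y = 0 := by lia
    have := hli (-n) 1 0 (by rw [hω, hx, hy]; push_cast; ring)
    lia
  rw [Int.isUnit_iff_natAbs_eq]
  by_contra hne
  obtain ⟨p, hp, hpd⟩ := Nat.exists_prime_and_dvd hne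
  have := bad_of_index (Nat.prime_iff_prime_int.1 hp) f _ g x y z w rfl hN hact
    (Int.natCast_dvd.2 hpd)
  have hm := hmax p hp
  tauto

theorem IB.unit {A : Type*} [CommRing A] {ω₀ θ₀ ω θ : A} (h : IB ω₀ θ₀) (h' : IB ω θ)
    {n x y m z w : ℤ} (hω : ω = n + x * ω₀ + y * θ₀) (hθ : θ = m + z * ω₀ + w * θ₀) :
    IsUnit (x * w - y * z) := by
  obtain ⟨n', x', y', hω'⟩ := h'.1 ω₀
  obtain ⟨m', z', w', hθ'⟩ := h'.1 θ₀
  obtain ⟨-, a1, a2⟩ := h.inj (x := 0) (y := 1) (z := 0) (x' := n' + x' * n + y' * m)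
    (y' := x' * x + y' * z) (z' := x' * y + y' * w) (by
      push_cast; linear_combination hω' + x' * hω + y' * hθ)
  obtain ⟨-, b1, b2⟩ := h.inj (x := 0) (y := 0) (z := 1) (x' := m' + z' * n + w' * m)
    (y' := z' * x + w' * z) (z' := z' * y + w' * w) (by
      push_cast; linear_combination hθ' + z' * hω + w' * hθ)
  refine IsUnit.of_mul_eq_one (x' * w' - y' * z') ?_
  linear_combination -(z' * y + w' * w) * a1 + (z' * x + w' * z) * a2 - b2

/-- A maximal anisotropic form comes from a cubic subfield of `ℂ`. -/
theorem field_of_form (f : Fin 4 → ℤ) (hirr : ∀ u v : ℤ, bcfEv f u v = 0 → u = 0 ∧ v = 0)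
    (hmax : ∀ p : ℕ, p.Prime → ¬ BadC p f ∧ ¬ BadNC p f) :
    ∃ F : IntermediateField ℚ ℂ, Module.finrank ℚ F = 3 ∧ ∃ ω θ : 𝓞 F, IB ω θ ∧
      DF (f 0 : 𝓞 F) (f 1 : 𝓞 F) (f 2 : 𝓞 F) (f 3 : 𝓞 F) ω θ := by
  classical
  have ha : f 0 ≠ 0 := by
    intro h
    have := hirr 1 0 (by simp [bcfEv, h])
    lia
  have haQ : (f 0 : ℚ) ≠ 0 := by exact_mod_cast ha
  set P : ℚ[X] := C (f 0 : ℚ) * X ^ 3 + C (f 1 : ℚ) * X ^ 2 + C (f 2 : ℚ) * X + C (f 3 : ℚ) with hP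
  have hdeg : P.natDegree = 3 := natDegree_cubic haQ
  have hP0 : P ≠ 0 := by rintro h; rw [h] at hdeg; simp at hdeg
  have hIrr : Irreducible P := by
    rw [Polynomial.irreducible_iff_roots_eq_zero_of_degree_le_three (by lia) (by lia)]
    rw [Multiset.eq_zero_iff_forall_notMem]
    intro q hq
    rw [mem_roots hP0, IsRoot.def] at hq
    simp [hP] at hq
    have hd : (q.den : ℚ) ≠ 0 := by exact_mod_cast q.den_nz
    have : bcfEv f q.num q.den = 0 := by
      have h2 : ((bcfEv f q.num q.den : ℤ) : ℚ) = 0 := by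
        simp only [bcfEv]
        push_cast
        have hq' := Rat.num_div_den q
        have hn : (q.num : ℚ) = q * q.den := by rw [Rat.mul_den_eq_num]
        rw [hn]
        linear_combination (q.den : ℚ) ^ 3 * hq
      exact_mod_cast h2
    have := (hirr _ _ this).2
    exact q.den_nz (by exact_mod_cast this)
  obtain ⟨ξ, hξ⟩ := IsAlgClosed.exists_aeval_eq_zero ℂ P (by
    rw [Polynomial.degree_eq_natDegree hP0, hdeg]; norm_num)
  have hInteg : IsIntegral ℚ ξ := (show IsAlgebraic ℚ ξ from ⟨P, hP0, hξ⟩).isIntegral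
  have hmp : (minpoly ℚ ξ).natDegree = 3 := by
    rw [← minpoly.eq_of_irreducible hIrr hξ, natDegree_mul_C (by
      simpa using hP0), hdeg]
  have hfin : Module.finrank ℚ ℚ⟮ξ⟯ = 3 := by
    rw [IntermediateField.adjoin.finrank hInteg, hmp]
  refine ⟨ℚ⟮ξ⟯, hfin, ?_⟩
  haveI : FiniteDimensional ℚ ℚ⟮ξ⟯ := FiniteDimensional.of_finrank_eq_succ hfin
  haveI : NumberField ℚ⟮ξ⟯ := ⟨⟩
  generalize hF : ℚ⟮ξ⟯ = F at *
  obtain ⟨t, ht⟩ : ∃ t : F, (t : ℂ) = ξ := by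
    subst hF
    exact ⟨AdjoinSimple.gen ℚ ξ, by simp⟩
  have hmt : (minpoly ℚ t).natDegree = 3 := by
    rw [← hmp, ← ht]
    congr 1
    exact (minpoly.algebraMap_eq (algebraMap F ℂ).injective t).symm
  have hroot : (f 0 : F) * t ^ 3 + f 1 * t ^ 2 + f 2 * t + f 3 = 0 := by
    apply (algebraMap F ℂ).injective
    simp [hP] at hξ
    simp
    rw [ht]
    exact hξ
  have hDF : DF (f 0 : F) (f 1 : F) (f 2 : F) (f 3 : F) (-(f 0) * t)
      (-(f 0) * t ^ 2 - f 1 * t - f 2) := by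
    refine ⟨by ring, ?_, ?_⟩
    · linear_combination f 0 * hroot
    · linear_combination (f 0 * t + f 1) * hroot
  have hωi : IsIntegral ℤ (-(f 0 : F) * t) := by
    refine ⟨X ^ 3 - C (f 1) * X ^ 2 + C (f 0 * f 2) * X - C (f 0 ^ 2 * f 3), by monicity!, ?_⟩
    have := hDF.cubic_left
    simp only [eval₂_add, eval₂_sub, eval₂_mul, eval₂_C, eval₂_X_pow, eval₂_X, algebraMap_int_eq]
    simp only [eq_intCast]
    push_cast
    linear_combination this
  have hθi : IsIntegral ℤ (-(f 0 : F) * t ^ 2 - f 1 * t - f 2) := by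
    refine ⟨X ^ 3 + C (f 2) * X ^ 2 + C (f 1 * f 3) * X + C (f 0 * f 3 ^ 2), by monicity!, ?_⟩
    have := hDF.cubic_right
    simp only [eval₂_add, eval₂_sub, eval₂_mul, eval₂_C, eval₂_X_pow, eval₂_X, algebraMap_int_eq]
    simp only [eq_intCast]
    push_cast
    linear_combination this
  obtain ⟨ω, hω⟩ : ∃ β : 𝓞 F, algebraMap (𝓞 F) F β = -(f 0 : F) * t := ⟨⟨_, hωi⟩, rfl⟩
  obtain ⟨θ, hθ⟩ : ∃ β : 𝓞 F, algebraMap (𝓞 F) F β = -(f 0 : F) * t ^ 2 - f 1 * t - f 2 :=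
    ⟨⟨_, hθi⟩, rfl⟩
  have hDF' : DF (f 0 : 𝓞 F) (f 1 : 𝓞 F) (f 2 : 𝓞 F) (f 3 : 𝓞 F) ω θ := by
    obtain ⟨h1, h2, h3⟩ := hDF
    refine ⟨?_, ?_, ?_⟩ <;> apply FaithfulSMul.algebraMap_injective (𝓞 F) F <;>
      simp only [map_add, map_sub, map_neg, map_mul, map_pow, map_intCast, hω, hθ] <;> assumption
  have hli : ∀ x y z : ℤ, (x : 𝓞 F) + y * ω + z * θ = 0 → x = 0 ∧ y = 0 ∧ z = 0 := by
    intro x y z h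
    have h' := congrArg (algebraMap (𝓞 F) F) h
    simp only [map_add, map_mul, map_intCast, hω, hθ, map_zero] at h'
    obtain ⟨k1, k2, k3⟩ := lin3 hmt (x := x - z * f 2) (y := -(y * f 0) - z * f 1)
      (w := -(z * f 0)) (by push_cast; linear_combination h')
    have hz : z = 0 := by
      have : (z : ℚ) * f 0 = 0 := by linear_combination -k3
      have := (mul_eq_zero.1 this).resolve_right haQ
      exact_mod_cast this
    subst hz
    have hy : y = 0 := by
      have : (y : ℚ) * f 0 = 0 := by linear_combination -k2
      have := (mul_eq_zero.1 this).resolve_right haQ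
      exact_mod_cast this
    subst hy
    refine ⟨?_, rfl, rfl⟩
    simpa using k1
  obtain ⟨ω₁, θ₁, hB₁⟩ := exists_IB F hfin
  obtain ⟨ω₀, θ₀, g, hB₀, hg₀⟩ := hB₁.exists_DF
  exact ⟨ω, θ, hB₀.max hg₀ hDF' hli hmax, hDF'⟩

theorem IB.map {A B : Type*} [CommRing A] [CommRing B] (φ : A ≃+* B) {ω θ : A} (h : IB ω θ) :
    IB (φ ω) (φ θ) := by
  constructor
  · intro α
    obtain ⟨x, y, z, hx⟩ := h.1 (φ.symm α)
    refine ⟨x, y, z, ?_⟩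
    have := congrArg φ hx
    simpa using this
  · intro x y z hx
    apply h.2
    apply φ.injective
    simpa using hx

theorem DF.map {A B : Type*} [CommRing A] [CommRing B] (φ : A →+* B) {a b c d ω θ : A}
    (h : DF a b c d ω θ) : DF (φ a) (φ b) (φ c) (φ d) (φ ω) (φ θ) := by
  obtain ⟨h1, h2, h3⟩ := h
  refine ⟨?_, ?_, ?_⟩
  · have := congrArg φ h1; simpa using this
  · have := congrArg φ h2; simpa using this
  · have := congrArg φ h3; simpa using this

/-- isomorphic cubic fields have equivalent forms -/
theorem equiv_of_iso {F G : Type*} [Field F] [Field G] [Algebra ℚ F] [Algebra ℚ G]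
    (e : F ≃ₐ[ℚ] G) {f f' : Fin 4 → ℤ} {ω θ : 𝓞 F} {ω' θ' : 𝓞 G} (h : IB ω θ) (h' : IB ω' θ')
    (hf : DF (f 0 : 𝓞 F) (f 1 : 𝓞 F) (f 2 : 𝓞 F) (f 3 : 𝓞 F) ω θ)
    (hf' : DF (f' 0 : 𝓞 G) (f' 1 : 𝓞 G) (f' 2 : 𝓞 G) (f' 3 : 𝓞 G) ω' θ') :
    ∃ x y z w : ℤ, IsUnit (x * w - y * z) ∧ (x * w - y * z) • f' = bcfAct f x y z w := by
  let φ : 𝓞 F ≃+* 𝓞 G := RingOfIntegers.mapRingEquiv e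
  have h1 := h.map φ
  have h2 := hf.map (φ : 𝓞 F →+* 𝓞 G)
  simp only [map_intCast] at h2
  obtain ⟨n, x, y, hω⟩ := h1.1 ω'
  obtain ⟨m, z, w, hθ⟩ := h1.1 θ'
  exact ⟨x, y, z, w, h1.unit h' hω hθ, index_form h1 h2 hf' hω hθ⟩

theorem bcfD_act (f : Fin 4 → ℤ) (x y z w : ℤ) :
    bcfD (bcfAct f x y z w) = (x * w - y * z) ^ 6 * bcfD f := by
  simp [bcfD, bcfDisc, bcfAct, bcfEv]; ring

theorem sq_dvd_of_bad {p : ℤ} (hp : Prime p) {f : Fin 4 → ℤ} (h : BadC p f ∨ BadNC p f) :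
    p ^ 2 ∣ bcfD f := by
  rcases h with h | ⟨u, v, huv, h0, h1, h2⟩
  · obtain ⟨a, ha⟩ := h 0
    obtain ⟨b, hb⟩ := h 1
    obtain ⟨c, hc⟩ := h 2
    obtain ⟨d, hd⟩ := h 3
    refine ⟨p ^ 2 * bcfDisc a b c d, ?_⟩
    simp only [bcfD, ha, hb, hc, hd, bcfDisc]; ring
  · have key : ∀ z w : ℤ, ¬ p ∣ u * w - v * z → p ^ 2 ∣ bcfD f := by
      intro z w hd
      have hco : IsCoprime (p ^ 2) ((u * w - v * z) ^ 6) :=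
        ((hp.coprime_iff_not_dvd).2 hd).pow
      apply hco.dvd_of_dvd_mul_left
      rw [← bcfD_act]
      obtain ⟨k0, e0⟩ := h0
      obtain ⟨k1, e1⟩ := h1
      obtain ⟨k2, e2⟩ := h2
      have b0 : (bcfAct f u v z w) 0 = p ^ 2 * k0 := by simpa [bcfAct] using e0
      have b1 : (bcfAct f u v z w) 1 = p * (z * k1 + w * k2) := by
        simp [bcfAct]
        linear_combination z * e1 + w * e2
      unfold bcfD
      rw [b0, b1]
      generalize (bcfAct f u v z w) 2 = c
      generalize (bcfAct f u v z w) 3 = d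
      refine ⟨(z * k1 + w * k2) ^ 2 * c ^ 2 - 4 * k0 * c ^ 3 - 4 * p * (z * k1 + w * k2) ^ 3 * d
        - 27 * p ^ 2 * k0 ^ 2 * d ^ 2 + 18 * k0 * p * (z * k1 + w * k2) * c * d, ?_⟩
      unfold bcfDisc; ring
    by_cases hu : p ∣ u
    · have hv : ¬ p ∣ v := fun hv => huv ⟨hu, hv⟩
      exact key (-1) 0 (by simpa using hv)
    · exact key 0 1 (by simpa using hu)

/-- corner of the box -/
def boxA (s : ℤ) : Fin 4 → ℤ := if s = 1 then ![0, 100, 100, 0] else ![100, 0, 0, 100]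

/-- the box of forms -/
def fBox (s T : ℤ) : Finset (Fin 4 → ℤ) :=
  Fintype.piFinset fun i => Finset.Ico (boxA s i * T) (boxA s i * T + T)

theorem mem_fBox_one {T : ℤ} {f : Fin 4 → ℤ} (h : f ∈ fBox 1 T) :
    0 ≤ f 0 ∧ f 0 ≤ T ∧ 100 * T ≤ f 1 ∧ f 1 ≤ 101 * T ∧ 100 * T ≤ f 2 ∧ f 2 ≤ 101 * T ∧
    0 ≤ f 3 ∧ f 3 ≤ T ∧ 0 < T := by
  simp only [fBox, Fintype.mem_piFinset, Finset.mem_Ico] at h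
  have h0 := h 0
  have h1 := h 1
  have h2 := h 2
  have h3 := h 3
  simp [boxA] at h0 h1 h2 h3
  lia

theorem mem_fBox_neg {T : ℤ} {f : Fin 4 → ℤ} (h : f ∈ fBox (-1) T) :
    100 * T ≤ f 0 ∧ f 0 ≤ 101 * T ∧ 0 ≤ f 1 ∧ f 1 ≤ T ∧ 0 ≤ f 2 ∧ f 2 ≤ T ∧
    100 * T ≤ f 3 ∧ f 3 ≤ 101 * T ∧ 0 < T := by
  simp only [fBox, Fintype.mem_piFinset, Finset.mem_Ico] at h
  have h0 := h 0
  have h1 := h 1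
  have h2 := h 2
  have h3 := h 3
  simp [boxA] at h0 h1 h2 h3
  lia

theorem fBox_abs {s T : ℤ} (hs : s = 1 ∨ s = -1) {f : Fin 4 → ℤ} (h : f ∈ fBox s T) (i : Fin 4) :
    |f i| ≤ 101 * T ∧ 0 < T := by
  rw [abs_le]
  rcases hs with rfl | rfl
  · have := mem_fBox_one h
    fin_cases i <;> simp <;> lia
  · have := mem_fBox_neg h
    fin_cases i <;> simp <;> lia

/-- the Hessian -/
def hes (f : Fin 4 → ℤ) (x y : ℤ) : ℤ :=
  (f 1 ^ 2 - 3 * f 0 * f 2) * x ^ 2 + (f 1 * f 2 - 9 * f 0 * f 3) * x * y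
    + (f 2 ^ 2 - 3 * f 1 * f 3) * y ^ 2

theorem hxsq (x : ℤ) (h : 2 ≤ x ^ 2) : 4 ≤ x ^ 2 := by
  by_contra! h'
  have h1 : |x| < 2 := by
    rw [← sq_lt_sq₀ (abs_nonneg x) (by norm_num), sq_abs]; lia
  rw [abs_lt] at h1
  have : x = -1 ∨ x = 0 ∨ x = 1 := by lia
  rcases this with rfl | rfl | rfl <;> norm_num at h

theorem hes_one_bd {T a b c d x y : ℤ} (ha : 0 ≤ a) (ha' : a ≤ T) (hb : 100 * T ≤ b)
    (hb' : b ≤ 101 * T) (hc : 100 * T ≤ c) (hc' : c ≤ 101 * T) (hd : 0 ≤ d) (hd' : d ≤ T)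
    (hT : 0 < T)
    (hH : (b ^ 2 - 3 * a * c) * x ^ 2 + (b * c - 9 * a * d) * x * y
      + (c ^ 2 - 3 * b * d) * y ^ 2 ≤ 10201 * T ^ 2) : |x| ≤ 1 ∧ |y| ≤ 1 := by
  have hac : a * c ≤ T * (101 * T) := mul_le_mul ha' hc' (by lia) (by lia)
  have hbd : d * b ≤ T * (101 * T) := mul_le_mul hd' hb' (by lia) (by lia)
  have had : a * d ≤ T * T := mul_le_mul ha' hd' (by lia) (by lia)
  have had0 : 0 ≤ a * d := mul_nonneg ha hd
  have hbb : (100 * T) * (100 * T) ≤ b * b := mul_le_mul hb hb (by lia) (by lia)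
  have hcc : (100 * T) * (100 * T) ≤ c * c := mul_le_mul hc hc (by lia) (by lia)
  have hbc : (100 * T) * (100 * T) ≤ b * c := mul_le_mul hb hc (by lia) (by lia)
  have hbc' : b * c ≤ (101 * T) * (101 * T) := mul_le_mul hb' hc' (by lia) (by lia)
  have hTT : 0 < T ^ 2 := by positivity
  have hP : 9697 * T ^ 2 ≤ b ^ 2 - 3 * a * c := by linarith
  have hR : 9697 * T ^ 2 ≤ c ^ 2 - 3 * b * d := by linarith
  have hQ0 : 0 ≤ b * c - 9 * a * d := by linarith
  have hQ1 : b * c - 9 * a * d ≤ 10201 * T ^ 2 := by linarith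
  generalize b ^ 2 - 3 * a * c = P at *
  generalize c ^ 2 - 3 * b * d = R at *
  generalize b * c - 9 * a * d = Q at *
  have e1 : 0 ≤ (P - 9697 * T ^ 2) * x ^ 2 := mul_nonneg (by lia) (sq_nonneg _)
  have e2 : 0 ≤ (R - 9697 * T ^ 2) * y ^ 2 := mul_nonneg (by lia) (sq_nonneg _)
  have e3 : 0 ≤ Q * (x + y) ^ 2 := mul_nonneg hQ0 (sq_nonneg _)
  have e4 : 0 ≤ (10201 * T ^ 2 - Q) * (x ^ 2 + y ^ 2) := mul_nonneg (by lia) (by positivity)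
  have e5 : T ^ 2 * (9193 * (x ^ 2 + y ^ 2)) ≤ T ^ 2 * 20402 := by
    clear hP hR hQ0 hQ1 hac hbd had had0 hbb hcc hbc hbc' ha ha' hb hb' hc hc' hd hd'
    linarith
  have e6 := le_of_mul_le_mul_left e5 hTT
  have e7 := sq_nonneg x
  have e8 := sq_nonneg y
  constructor <;> rw [← sq_le_one_iff_abs_le_one]
  · by_contra! h
    have : 2 ≤ x ^ 2 := h
    nlinarith only [e6, e7, e8, this, sq_nonneg (|x| - 1), hxsq x this]
  · by_contra! h
    have : 2 ≤ y ^ 2 := h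
    nlinarith only [e6, e7, e8, this, hxsq y this]

theorem hes_neg_bd {T a b c d x y : ℤ} (ha : 100 * T ≤ a) (ha' : a ≤ 101 * T) (hb : 0 ≤ b)
    (hb' : b ≤ T) (hc : 0 ≤ c) (hc' : c ≤ T) (hd : 100 * T ≤ d) (hd' : d ≤ 101 * T)
    (hT : 0 < T)
    (hH : |(b ^ 2 - 3 * a * c) * x ^ 2 + (b * c - 9 * a * d) * x * y
      + (c ^ 2 - 3 * b * d) * y ^ 2| ≤ 303 * T ^ 2)
    (hf : |a * x ^ 3 + b * x ^ 2 * y + c * x * y ^ 2 + d * y ^ 3| ≤ 101 * T) (hxy : |y| ≤ |x|) :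
    |x| ≤ 1 := by
  by_contra! hx
  have hac : a * c ≤ (101 * T) * T := mul_le_mul ha' hc' (by lia) (by lia)
  have hbd : d * b ≤ (101 * T) * T := mul_le_mul hd' hb' (by lia) (by lia)
  have hac0 : 0 ≤ a * c := mul_nonneg (by lia) hc
  have hbd0 : 0 ≤ d * b := mul_nonneg (by lia) hb
  have had : (100 * T) * (100 * T) ≤ a * d := mul_le_mul ha hd (by lia) (by lia)
  have hbb : b * b ≤ T * T := mul_le_mul hb' hb' (by lia) (by lia)
  have hcc : c * c ≤ T * T := mul_le_mul hc' hc' (by lia) (by lia)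
  have hbc : b * c ≤ T * T := mul_le_mul hb' hc' (by lia) (by lia)
  have hTT : 0 < T ^ 2 := by positivity
  have hP : |b ^ 2 - 3 * a * c| ≤ 303 * T ^ 2 := by
    rw [abs_le]; have := mul_nonneg hb hb; constructor <;> linarith
  have hR : |c ^ 2 - 3 * b * d| ≤ 303 * T ^ 2 := by
    rw [abs_le]; have := mul_nonneg hc hc; constructor <;> linarith
  have hQ : 89999 * T ^ 2 ≤ |b * c - 9 * a * d| := by
    rw [le_abs]; right; linarith
  have h1 : |b * c - 9 * a * d| * (|x| * |y|) ≤ 303 * T ^ 2 + 303 * T ^ 2 * |x| ^ 2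
      + 303 * T ^ 2 * |y| ^ 2 := by
    have e : (b * c - 9 * a * d) * (x * y) = ((b ^ 2 - 3 * a * c) * x ^ 2
      + (b * c - 9 * a * d) * x * y + (c ^ 2 - 3 * b * d) * y ^ 2)
      + -((b ^ 2 - 3 * a * c) * x ^ 2) + -((c ^ 2 - 3 * b * d) * y ^ 2) := by ring
    rw [← abs_mul, ← abs_mul, e]
    refine (abs_add_three _ _ _).trans ?_
    rw [abs_neg, abs_neg, abs_mul, abs_mul (c ^ 2 - 3 * b * d), abs_pow, abs_pow]
    gcongr
  have hf' : a * |x| ^ 3 ≤ 101 * T + b * |x| ^ 2 * |y| + c * |x| * |y| ^ 2 + d * |y| ^ 3 := by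
    have e : a * x ^ 3 = (a * x ^ 3 + b * x ^ 2 * y + c * x * y ^ 2 + d * y ^ 3)
      + -(b * x ^ 2 * y) + -(c * x * y ^ 2) + -(d * y ^ 3) := by ring
    have h2 : |a * x ^ 3| ≤ 101 * T + |b * x ^ 2 * y| + |c * x * y ^ 2| + |d * y ^ 3| := by
      nth_rw 1 [e]
      refine (abs_add_le _ _).trans ?_
      rw [abs_neg]
      gcongr
      refine (abs_add_three _ _ _).trans ?_
      rw [abs_neg, abs_neg]
      gcongr
    simp only [abs_mul, abs_pow] at h2 ⊢
    rwa [abs_of_nonneg (show 0 ≤ a by lia), abs_of_nonneg hb, abs_of_nonneg hc,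
      abs_of_nonneg (show 0 ≤ d by lia)] at h2
  have hy0 : 0 ≤ |y| := abs_nonneg y
  generalize |x| = X at *
  generalize |y| = Y at *
  have h3 : T ^ 2 * (89999 * (X * Y)) ≤ T ^ 2 * (303 * (1 + X ^ 2 + Y ^ 2)) := by
    have : 89999 * T ^ 2 * (X * Y) ≤ |b * c - 9 * a * d| * (X * Y) :=
      mul_le_mul_of_nonneg_right hQ (by positivity)
    linarith
  have h4 := le_of_mul_le_mul_left h3 hTT
  have h5 : 100 * Y ≤ X := by
    by_contra! h
    have i1 : X * X ≤ X * (100 * Y) := mul_le_mul_of_nonneg_left h.le (by lia)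
    have i2 : Y * Y ≤ X * Y := mul_le_mul_of_nonneg_right hxy hy0
    have i3 : 2 * 2 ≤ X * X := mul_le_mul (by lia) (by lia) (by norm_num) (by lia)
    linarith only [i1, i2, i3, h4]
  have h6 : (100 * T) * X ^ 3 ≤ a * X ^ 3 := mul_le_mul_of_nonneg_right ha (by positivity)
  have h7 : b * X ^ 2 * Y ≤ T * X ^ 2 * X := by gcongr
  have h8 : c * X * Y ^ 2 ≤ T * X * X ^ 2 := by gcongr
  have h9 : 1000000 * (d * Y ^ 3) ≤ (101 * T) * X ^ 3 := by
    calc 1000000 * (d * Y ^ 3) = d * (100 * Y) ^ 3 := by ring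
      _ ≤ (101 * T) * X ^ 3 := by gcongr
  have h10 : T * (97 * X ^ 3) ≤ T * 101 := by
    have : 0 ≤ T * X ^ 3 := by positivity
    linarith
  have h11 := le_of_mul_le_mul_left h10 hT
  have : 2 ^ 3 ≤ X ^ 3 := pow_le_pow_left₀ (by norm_num) (by lia) 3
  lia

theorem hes_act (f : Fin 4 → ℤ) (x y z w s t : ℤ) : hes (bcfAct f x y z w) s t
    = (x * w - y * z) ^ 2 * hes f (x * s + z * t) (y * s + w * t) := by
  simp [hes, bcfAct, bcfEv]; ring

theorem hes_smul (f : Fin 4 → ℤ) (n s t : ℤ) : hes (n • f) s t = n ^ 2 * hes f s t := by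
  simp [hes]; ring

theorem box_equiv_bd {s T : ℤ} (hs : s = 1 ∨ s = -1) {f f' : Fin 4 → ℤ} (hf : f ∈ fBox s T)
    (hf' : f' ∈ fBox s T) {x y z w e : ℤ} (he : IsUnit e) (hu : IsUnit (x * w - y * z))
    (h : e • f' = bcfAct f x y z w) : |x| ≤ 1 ∧ |y| ≤ 1 ∧ |z| ≤ 1 ∧ |w| ≤ 1 := by
  have hu2 : (x * w - y * z) ^ 2 = 1 := by
    rcases Int.isUnit_iff.1 hu with h | h <;> rw [h] <;> norm_num
  have he2 : e ^ 2 = 1 := by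
    rcases Int.isUnit_iff.1 he with h | h <;> rw [h] <;> norm_num
  have he1 : |e| = 1 := by
    rcases Int.isUnit_iff.1 he with h | h <;> rw [h] <;> norm_num
  have hh : ∀ s t, hes f' s t = hes f (x * s + z * t) (y * s + w * t) := by
    intro s t
    have h1 := hes_smul f' e s t
    rw [h, hes_act, hu2, he2] at h1
    linarith
  have hev : ∀ s t, |bcfEv f' s t| = |bcfEv f (x * s + z * t) (y * s + w * t)| := by
    intro s t
    rw [← bcfEv_act, ← h]
    have : bcfEv (e • f') s t = e * bcfEv f' s t := by simp [bcfEv]; ring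
    rw [this, abs_mul, he1, one_mul]
  have a1 := hh 1 0
  have a2 := hh 0 1
  have b1 := hev 1 0
  have b2 := hev 0 1
  simp [hes, bcfEv] at a1 a2 b1 b2
  rcases hs with rfl | rfl
  · obtain ⟨p1, p2, p3, p4, p5, p6, p7, p8, p9⟩ := mem_fBox_one hf
    obtain ⟨q1, q2, q3, q4, q5, q6, q7, q8, q9⟩ := mem_fBox_one hf'
    have r1 := hes_one_bd p1 p2 p3 p4 p5 p6 p7 p8 p9 (x := x) (y := y) (by
      rw [← a1]
      have : f' 1 * f' 1 ≤ (101 * T) * (101 * T) := mul_le_mul q4 q4 (by lia) (by lia)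
      have : 0 ≤ f' 0 * f' 2 := mul_nonneg q1 (by lia)
      linarith)
    have r2 := hes_one_bd p1 p2 p3 p4 p5 p6 p7 p8 p9 (x := z) (y := w) (by
      rw [← a2]
      have : f' 2 * f' 2 ≤ (101 * T) * (101 * T) := mul_le_mul q6 q6 (by lia) (by lia)
      have : 0 ≤ f' 1 * f' 3 := mul_nonneg (by lia) (by lia)
      linarith)
    exact ⟨r1.1, r1.2, r2.1, r2.2⟩
  · obtain ⟨p1, p2, p3, p4, p5, p6, p7, p8, p9⟩ := mem_fBox_neg hf
    obtain ⟨q1, q2, q3, q4, q5, q6, q7, q8, q9⟩ := mem_fBox_neg hf'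
    have A1 : |f' 1 ^ 2 - 3 * f' 0 * f' 2| ≤ 303 * T ^ 2 := by
      have h1 : f' 1 * f' 1 ≤ T * T := mul_le_mul q4 q4 (by lia) (by lia)
      have h2 : 0 ≤ f' 0 * f' 2 := mul_nonneg (by lia) (by lia)
      have h3 : f' 0 * f' 2 ≤ (101 * T) * T := mul_le_mul q2 q6 (by lia) (by lia)
      have h4 := mul_self_nonneg (f' 1)
      have h5 := mul_self_nonneg (f' 2)
      rw [abs_le]; constructor <;> linarith
    have A2 : |f' 2 ^ 2 - 3 * f' 1 * f' 3| ≤ 303 * T ^ 2 := by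
      have h1 : f' 2 * f' 2 ≤ T * T := mul_le_mul q6 q6 (by lia) (by lia)
      have h2 : 0 ≤ f' 3 * f' 1 := mul_nonneg (by lia) (by lia)
      have h3 : f' 3 * f' 1 ≤ (101 * T) * T := mul_le_mul q8 q4 (by lia) (by lia)
      have h4 := mul_self_nonneg (f' 1)
      have h5 := mul_self_nonneg (f' 2)
      rw [abs_le]; constructor <;> linarith
    have B1 : |f' 0| ≤ 101 * T := by rw [abs_le]; lia
    have B2 : |f' 3| ≤ 101 * T := by rw [abs_le]; lia
    rw [a1] at A1
    rw [a2] at A2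
    rw [b1] at B1
    rw [b2] at B2
    have both : ∀ x y : ℤ, |(f 1 ^ 2 - 3 * f 0 * f 2) * x ^ 2 + (f 1 * f 2 - 9 * f 0 * f 3) * x * y
        + (f 2 ^ 2 - 3 * f 1 * f 3) * y ^ 2| ≤ 303 * T ^ 2 →
        |f 0 * x ^ 3 + f 1 * x ^ 2 * y + f 2 * x * y ^ 2 + f 3 * y ^ 3| ≤ 101 * T →
        |x| ≤ 1 ∧ |y| ≤ 1 := by
      intro x y h1 h2
      rcases le_total |y| |x| with h | h
      · have := hes_neg_bd p1 p2 p3 p4 p5 p6 p7 p8 p9 h1 h2 h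
        exact ⟨this, h.trans this⟩
      · have := hes_neg_bd p7 p8 p5 p6 p3 p4 p1 p2 p9 (x := y) (y := x)
          (by convert h1 using 2; ring) (by convert h2 using 2; ring) h
        exact ⟨h.trans this, this⟩
    have r1 := both x y A1 B1
    have r2 := both z w A2 B2
    exact ⟨r1.1, r1.2, r2.1, r2.2⟩

/-- singular-at-a-point condition -/
def BadAt (p : ℤ) (f : Fin 4 → ℤ) (u v : ℤ) : Prop :=
  p ^ 2 ∣ bcfEv f u v ∧ p ∣ 3 * f 0 * u ^ 2 + 2 * f 1 * u * v + f 2 * v ^ 2 ∧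
    p ∣ f 1 * u ^ 2 + 2 * f 2 * u * v + 3 * f 3 * v ^ 2

theorem BadAt.scale {p : ℤ} {f : Fin 4 → ℤ} {u v : ℤ} (h : BadAt p f u v) (l a b : ℤ) :
    BadAt p f (l * u + p * a) (l * v + p * b) := by
  obtain ⟨⟨k0, e0⟩, ⟨k1, e1⟩, ⟨k2, e2⟩⟩ := h
  refine ⟨⟨l ^ 3 * k0 + l ^ 2 * (a * k1 + b * k2) + l * (3 * f 0 * u * a ^ 2
      + f 1 * (2 * u * a * b + v * a ^ 2) + f 2 * (u * b ^ 2 + 2 * v * a * b) + 3 * f 3 * v * b ^ 2)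
      + p * bcfEv f a b, ?_⟩, ⟨l ^ 2 * k1 + 6 * f 0 * l * u * a + 3 * f 0 * p * a ^ 2
      + 2 * f 1 * (l * u * b + l * v * a + p * a * b) + 2 * f 2 * l * v * b + f 2 * p * b ^ 2, ?_⟩,
      ⟨l ^ 2 * k2 + 2 * f 1 * l * u * a + f 1 * p * a ^ 2
      + 2 * f 2 * (l * u * b + l * v * a + p * a * b) + 6 * f 3 * l * v * b + 3 * f 3 * p * b ^ 2, ?_⟩⟩
  · unfold bcfEv at *
    linear_combination l ^ 3 * e0 + l ^ 2 * p * a * e1 + l ^ 2 * p * b * e2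
  · linear_combination l ^ 2 * e1
  · linear_combination l ^ 2 * e2

theorem BadAt.transfer {p : ℤ} (hp : Prime p) {f : Fin 4 → ℤ} {u v : ℤ} (h : BadAt p f u v)
    (huv : ¬ (p ∣ u ∧ p ∣ v)) {x y : ℤ} (hxy : p ∣ x * v - y * u) : BadAt p f x y := by
  obtain ⟨k, hk⟩ := hxy
  by_cases hu : p ∣ u
  · have hv : ¬ p ∣ v := fun hv => huv ⟨hu, hv⟩
    obtain ⟨a, b, hab⟩ := (hp.coprime_iff_not_dvd).2 hv
    -- a p + b v = 1
    have := h.scale (b * y) (a * x + b * k) (a * y)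
    convert this using 1
    · linear_combination (-x) * hab + b * hk
    · linear_combination (-y) * hab
  · obtain ⟨a, b, hab⟩ := (hp.coprime_iff_not_dvd).2 hu
    have := h.scale (b * x) (a * x) (a * y - b * k)
    convert this using 1
    · linear_combination (-x) * hab
    · linear_combination (-y) * hab - b * hk

theorem thue_prim {p : ℕ} (hp : p.Prime) (u v : ℤ) : ∃ x y : ℤ, IsCoprime x y ∧ x ^ 2 ≤ p ∧
    y ^ 2 ≤ p ∧ (p : ℤ) ∣ x * v - y * u := by
  set r := Nat.sqrt p with hr
  have : NeZero p := ⟨hp.ne_zero⟩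
  have hcard : (Finset.univ : Finset (ZMod p)).card < (Finset.range (r + 1) ×ˢ Finset.range (r + 1)).card := by
    rw [Finset.card_univ, ZMod.card, Finset.card_product, Finset.card_range]
    exact Nat.lt_succ_sqrt p
  obtain ⟨⟨a, b⟩, hab, ⟨c, d⟩, hcd, hne, heq⟩ := Finset.exists_ne_map_eq_of_card_lt_of_maps_to hcard
    (f := fun q : ℕ × ℕ => ((q.1 : ZMod p) * v - q.2 * u)) (by intro q _; simp)
  simp only [Finset.mem_product, Finset.mem_range] at hab hcd
  have hdvd : (p : ℤ) ∣ ((a : ℤ) - c) * v - ((b : ℤ) - d) * u := by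
    rw [← ZMod.intCast_zmod_eq_zero_iff_dvd]
    push_cast
    simp only at heq
    linear_combination heq
  have hrp : (r : ℤ) ^ 2 ≤ p := by
    have := Nat.sqrt_le' p
    exact_mod_cast this
  have hA : |(a : ℤ) - c| ≤ r := by rw [abs_le]; lia
  have hB : |(b : ℤ) - d| ≤ r := by rw [abs_le]; lia
  have hne' : ¬ ((a : ℤ) - c = 0 ∧ (b : ℤ) - d = 0) := by
    rintro ⟨h1, h2⟩; apply hne; ext <;> simp <;> lia
  generalize (a : ℤ) - c = A at *
  generalize (b : ℤ) - d = B at *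
  have hg : 0 < Int.gcd A B := by
    rw [Int.gcd_pos_iff]; tauto
  obtain ⟨x, y, hco, hx, hy⟩ := Int.exists_gcd_one hg
  have hg1 : (1 : ℤ) ≤ Int.gcd A B := by exact_mod_cast hg
  generalize (Int.gcd A B : ℤ) = g at *
  have hrlt : (r : ℤ) < p := by
    have : Nat.sqrt p < p := Nat.sqrt_lt_self hp.one_lt
    exact_mod_cast this
  have hpg : ¬ (p : ℤ) ∣ g := by
    intro h
    have h1 : (p : ℤ) ∣ A := hx ▸ h.mul_left _
    have h2 : (p : ℤ) ∣ B := hy ▸ h.mul_left _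
    exact hne' ⟨Int.eq_zero_of_abs_lt_dvd h1 (by lia), Int.eq_zero_of_abs_lt_dvd h2 (by lia)⟩
  have hle : ∀ A x : ℤ, |A| ≤ r → A = x * g → x ^ 2 ≤ p := by
    intro A x h1 h2
    refine le_trans ?_ hrp
    rw [← sq_abs x]
    refine pow_le_pow_left₀ (abs_nonneg _) (le_trans ?_ h1) 2
    rw [h2, abs_mul]
    exact le_mul_of_one_le_right (abs_nonneg _) (by rw [le_abs]; lia)
  refine ⟨x, y, Int.isCoprime_iff_gcd_eq_one.2 hco, hle A x hA hx, hle B y hB hy, ?_⟩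
  have hpp : Prime (p : ℤ) := Nat.prime_iff_prime_int.1 hp
  refine (hpp.dvd_or_dvd (a := g) ?_).resolve_left hpg
  have e : g * (x * v - y * u) = A * v - B * u := by rw [hx, hy]; ring
  rw [e]; exact hdvd

/-- short complement, when `|x|` is the max -/
theorem short_compl {p x y z w m : ℤ} (hd : x * w - y * z = 1) (hm : |x| = m) (hy : |y| ≤ m)
    (hm1 : 1 ≤ m) (hmp : m ^ 2 ≤ p) :
    ∃ k : ℤ, m * |p * z + k * x| ≤ 2 * p ∧ m * |p * w + k * y| ≤ 2 * p := by
  have hx0 : x ≠ 0 := by rintro rfl; simp at hm; lia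
  refine ⟨-(p * z / x), ?_⟩
  have h1 : p * z + -(p * z / x) * x = (p * z) % x := by
    have := Int.mul_ediv_add_emod (p * z) x; linarith
  have h2 : |p * z + -(p * z / x) * x| ≤ m := by
    rw [h1, abs_of_nonneg (Int.emod_nonneg _ hx0), ← hm]
    exact (Int.emod_lt_abs _ hx0).le
  have h3 : x * (p * w + -(p * z / x) * y) = p + y * (p * z + -(p * z / x) * x) := by
    linear_combination p * hd
  generalize p * z + -(p * z / x) * x = a at *
  generalize p * w + -(p * z / x) * y = b at *
  constructor
  · nlinarith [mul_le_mul_of_nonneg_left h2 (by lia : (0:ℤ) ≤ m)]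
  · rw [← hm, ← abs_mul, h3]
    refine (abs_add_le _ _).trans ?_
    rw [abs_mul, abs_of_nonneg (by nlinarith : (0:ℤ) ≤ p)]
    have := mul_le_mul hy h2 (abs_nonneg _) (by lia)
    nlinarith

theorem short_compl' {p x y z w m : ℤ} (hd : x * w - y * z = 1) (hm : max |x| |y| = m)
    (hm1 : 1 ≤ m) (hmp : m ^ 2 ≤ p) :
    ∃ k : ℤ, m * |p * z + k * x| ≤ 2 * p ∧ m * |p * w + k * y| ≤ 2 * p := by
  rcases le_total |x| |y| with h | h
  · rw [max_eq_right h] at hm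
    obtain ⟨k, h1, h2⟩ := short_compl (p := p) (x := y) (y := x) (z := -w) (w := -z)
      (by linarith) hm (by lia) hm1 hmp
    refine ⟨-k, ?_, ?_⟩
    · rw [← abs_neg]; convert h2 using 3; ring
    · rw [← abs_neg]; convert h1 using 3; ring
  · rw [max_eq_left h] at hm
    exact short_compl hd hm (by lia) hm1 hmp

theorem abs_cubic_bd {B V W a b c d f0 f1 f2 f3 : ℤ} (h0 : |f0| ≤ B) (h1 : |f1| ≤ B) (h2 : |f2| ≤ B)
    (h3 : |f3| ≤ B) (ha : |a| ≤ V) (hb : |b| ≤ V) (hc : |c| ≤ W) (hd : |d| ≤ W) :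
    |f0 * a ^ 3 + f1 * a ^ 2 * b + f2 * a * b ^ 2 + f3 * b ^ 3| ≤ 4 * B * V ^ 3 ∧
    |f0 * (3 * a ^ 2 * c) + f1 * (a ^ 2 * d + 2 * a * b * c) + f2 * (2 * a * b * d + b ^ 2 * c)
      + f3 * (3 * b ^ 2 * d)| ≤ 12 * B * V ^ 2 * W := by
  have hV : 0 ≤ V := (abs_nonneg _).trans ha
  have hW : 0 ≤ W := (abs_nonneg _).trans hc
  have hB : 0 ≤ B := (abs_nonneg _).trans h0
  constructor
  · refine (abs_add_le _ _).trans ?_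
    refine (add_le_add_left (abs_add_three _ _ _) _).trans ?_
    simp only [abs_mul, abs_pow]
    calc _ ≤ B * V ^ 3 + B * V ^ 2 * V + B * V * V ^ 2 + B * V ^ 3 := by gcongr
      _ = _ := by ring
  · refine (abs_add_le _ _).trans ?_
    refine (add_le_add_left (abs_add_three _ _ _) _).trans ?_
    have e1 : |a ^ 2 * d + 2 * a * b * c| ≤ 3 * V ^ 2 * W := by
      refine (abs_add_le _ _).trans ?_
      simp only [abs_mul, abs_pow, abs_two]
      calc _ ≤ V ^ 2 * W + 2 * V * V * W := by gcongr
        _ = _ := by ring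
    have e2 : |2 * a * b * d + b ^ 2 * c| ≤ 3 * V ^ 2 * W := by
      refine (abs_add_le _ _).trans ?_
      simp only [abs_mul, abs_pow, abs_two]
      calc _ ≤ 2 * V * V * W + V ^ 2 * W := by gcongr
        _ = _ := by ring
    have e3 : |3 * a ^ 2 * c| ≤ 3 * V ^ 2 * W := by
      simp only [abs_mul, abs_pow]
      rw [abs_of_pos (by norm_num : (0:ℤ) < 3)]; gcongr
    have e4 : |3 * b ^ 2 * d| ≤ 3 * V ^ 2 * W := by
      simp only [abs_mul, abs_pow]
      rw [abs_of_pos (by norm_num : (0:ℤ) < 3)]; gcongr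
    rw [abs_mul f0, abs_mul f1, abs_mul f2, abs_mul f3]
    calc _ ≤ B * (3 * V ^ 2 * W) + B * (3 * V ^ 2 * W) + B * (3 * V ^ 2 * W)
        + B * (3 * V ^ 2 * W) := by gcongr
      _ = _ := by ring

/-- reduction of a nonmaximal form -/
theorem bad_reduce {p : ℕ} (hp : p.Prime) {B : ℤ} {f : Fin 4 → ℤ} (hB : ∀ i, |f i| ≤ B)
    (han : ∀ u v, bcfEv f u v = 0 → u = 0 ∧ v = 0) (hbad : BadNC p f) :
    ∃ (m : ℕ) (k x y z w : ℤ) (g : Fin 4 → ℤ), 1 ≤ m ∧ m ^ 2 ≤ p ∧ x * w - y * z = 1 ∧ 0 ≤ k ∧ k < p ∧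
      ((p : ℤ) ^ 2) • g = bcfAct (bcfAct f x y z w) 1 0 k p ∧ g 0 ≠ 0 ∧ (p : ℤ) ∣ bcfEv g (-k) 1 ∧
      |g 0| * p ^ 2 ≤ 4 * B * m ^ 3 ∧ |g 1| * p ≤ 24 * B * m ∧ |g 2| * m ≤ 48 * B ∧
      |g 3| * m ^ 3 ≤ 32 * B * p := by
  have hpp : Prime (p : ℤ) := Nat.prime_iff_prime_int.1 hp
  have hp0 : (0 : ℤ) < p := by exact_mod_cast hp.pos
  obtain ⟨u, v, huv, hb⟩ := hbad
  obtain ⟨x, y, hco, hx, hy, hd⟩ := thue_prim hp u v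
  have hxy : BadAt p f x y := BadAt.transfer hpp hb huv hd
  obtain ⟨w1, z1, hzw⟩ := hco
  obtain ⟨m, hm⟩ : ∃ m : ℕ, (m : ℤ) = max |x| |y| :=
    ⟨(max |x| |y|).toNat, Int.toNat_of_nonneg (le_max_of_le_left (abs_nonneg _))⟩
  have hne : ¬ (x = 0 ∧ y = 0) := by rintro ⟨rfl, rfl⟩; simp at hzw
  have hm1 : 1 ≤ (m : ℤ) := by
    rw [hm, le_max_iff]
    by_cases h : x = 0
    · right; exact Int.one_le_abs (fun h' => hne ⟨h, h'⟩)
    · left; exact Int.one_le_abs h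
  have hmp : (m : ℤ) ^ 2 ≤ p := by
    rw [hm]
    rcases max_choice |x| |y| with h | h <;> rw [h, sq_abs] <;> assumption
  obtain ⟨k, hk1, hk2⟩ := short_compl' (p := p) (x := x) (y := y) (z := -z1) (w := w1)
    (by linarith) hm.symm hm1 hmp
  have hkd := Int.mul_ediv_add_emod k p
  set k0 := k % p
  set j := k / p
  set z := -z1 + j * x with hz
  set w := w1 + j * y with hw
  have eW1 : (p : ℤ) * -z1 + k * x = p * z + k0 * x := by rw [hz, ← hkd]; ring
  have eW2 : (p : ℤ) * w1 + k * y = p * w + k0 * y := by rw [hw, ← hkd]; ring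
  rw [eW1] at hk1
  rw [eW2] at hk2
  obtain ⟨⟨A, eA⟩, ⟨k1, e1⟩, ⟨k2, e2⟩⟩ := hxy
  set h2 := (bcfAct f x y z w) 2 with hh2
  set h3 := (bcfAct f x y z w) 3 with hh3
  set C := z * k1 + w * k2 with hC
  have b0 : (bcfAct f x y z w) 0 = p ^ 2 * A := by simpa [bcfAct] using eA
  have b1 : (bcfAct f x y z w) 1 = p * C := by
    simp [bcfAct]
    linear_combination z * e1 + w * e2
  let g : Fin 4 → ℤ := ![A, 3 * A * k0 + C, 3 * A * k0 ^ 2 + 2 * C * k0 + h2,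
    A * k0 ^ 3 + C * k0 ^ 2 + h2 * k0 + p * h3]
  have hg : ((p : ℤ) ^ 2) • g = bcfAct (bcfAct f x y z w) 1 0 k0 p := by
    generalize bcfAct f x y z w = h at *
    ext i
    fin_cases i <;> simp [bcfAct, bcfEv, g, b0, b1, ← hh2, ← hh3] <;> ring
  have hdet : x * w - y * z = 1 := by rw [hz, hw]; linear_combination hzw
  have hgf : ((p : ℤ) ^ 2) • g = bcfAct f x y (p * z + k0 * x) (p * w + k0 * y) := by
    rw [hg]; apply bcf_ext_of_ev
    intro s t
    rw [bcfEv_act, bcfEv_act, bcfEv_act]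
    congr 1 <;> ring
  have hxm : |x| ≤ m := hm ▸ le_max_left _ _
  have hym : |y| ≤ m := hm ▸ le_max_right _ _
  have hgi := fun i => congrFun hgf i
  have m0 : (0 : ℤ) < m := by lia
  refine ⟨m, k0, x, y, z, w, g, by exact_mod_cast hm1, by exact_mod_cast hmp, hdet,
    Int.emod_nonneg _ hp0.ne', Int.emod_lt_of_pos _ hp0, hg, ?_, ?_, ?_, ?_, ?_, ?_⟩
  · intro h0
    have h0' : A = 0 := by simpa [g] using h0
    rw [h0', mul_zero] at eA
    exact hne (han x y eA)
  · simp [bcfEv, g]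
    exact ⟨h3, by ring⟩
  all_goals
    generalize (p : ℤ) * z + k0 * x = a at *
    generalize (p : ℤ) * w + k0 * y = b at *
  · have := hgi 0
    simp [bcfAct, bcfEv] at this
    rw [← abs_of_nonneg (show (0 : ℤ) ≤ (p : ℤ) ^ 2 by positivity), ← abs_mul, mul_comm, this]
    exact (abs_cubic_bd (hB 0) (hB 1) (hB 2) (hB 3) hxm hym (le_refl |(0 : ℤ)|) (le_refl |(0 : ℤ)|)).1
  all_goals
    have ha : |m * a| ≤ 2 * p := by rw [abs_mul, Nat.abs_cast]; exact hk1
    have hb : |m * b| ≤ 2 * p := by rw [abs_mul, Nat.abs_cast]; exact hk2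
  · have h1 := hgi 1
    have h2 := (abs_cubic_bd (hB 0) (hB 1) (hB 2) (hB 3) hxm hym ha hb).2
    have h3 : (p : ℤ) ^ 2 * m * g 1 = f 0 * (3 * x ^ 2 * (m * a)) + f 1 * (x ^ 2 * (m * b) + 2 * x * y * (m * a))
        + f 2 * (2 * x * y * (m * b) + y ^ 2 * (m * a)) + f 3 * (3 * y ^ 2 * (m * b)) := by
      simp [bcfAct] at h1
      linear_combination (m : ℤ) * h1
    rw [← h3, abs_mul, abs_of_nonneg (by positivity)] at h2
    refine le_of_mul_le_mul_left (a := (p : ℤ) * m) ?_ (by positivity)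
    linarith
  · have h1 := hgi 2
    have h2 := (abs_cubic_bd (hB 0) (hB 1) (hB 2) (hB 3) ha hb hxm hym).2
    have h3 : (p : ℤ) ^ 2 * m ^ 2 * g 2 = f 0 * (3 * (m * a) ^ 2 * x)
        + f 1 * ((m * a) ^ 2 * y + 2 * (m * a) * (m * b) * x)
        + f 2 * (2 * (m * a) * (m * b) * y + (m * b) ^ 2 * x) + f 3 * (3 * (m * b) ^ 2 * y) := by
      simp [bcfAct] at h1
      linear_combination (m : ℤ) ^ 2 * h1
    rw [← h3, abs_mul, abs_of_nonneg (by positivity)] at h2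
    refine le_of_mul_le_mul_left (a := (p : ℤ) ^ 2 * m) ?_ (by positivity)
    linarith
  · have h1 := hgi 3
    have h2 := (abs_cubic_bd (hB 0) (hB 1) (hB 2) (hB 3) ha hb hxm hym).1
    have h3 : (p : ℤ) ^ 2 * m ^ 3 * g 3 = f 0 * (m * a) ^ 3 + f 1 * (m * a) ^ 2 * (m * b)
        + f 2 * (m * a) * (m * b) ^ 2 + f 3 * (m * b) ^ 3 := by
      simp [bcfAct, bcfEv] at h1
      linear_combination (m : ℤ) ^ 3 * h1
    rw [← h3, abs_mul, abs_of_nonneg (by positivity)] at h2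
    refine le_of_mul_le_mul_left (a := (p : ℤ) ^ 2) ?_ (by positivity)
    linarith

theorem orbit_card {s T : ℤ} (hs : s = 1 ∨ s = -1) (S : Finset (Fin 4 → ℤ)) (hS : S ⊆ fBox s T)
    (h : ∀ f ∈ S, ∀ f' ∈ S, ∃ x y z w e : ℤ, IsUnit e ∧ IsUnit (x * w - y * z) ∧
      e • f' = bcfAct f x y z w) : S.card ≤ 162 := by
  rcases S.eq_empty_or_nonempty with rfl | ⟨f, hf⟩
  · simp
  let I : Finset ℤ := Finset.Icc (-1) 1
  let J : Finset ℤ := {1, -1}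
  have hsub : S ⊆ (J ×ˢ I ×ˢ I ×ˢ I ×ˢ I).image
      (fun q => q.1 • bcfAct f q.2.1 q.2.2.1 q.2.2.2.1 q.2.2.2.2) := by
    intro f' hf'
    obtain ⟨x, y, z, w, e, he, hu, hE⟩ := h f hf f' hf'
    obtain ⟨b1, b2, b3, b4⟩ := box_equiv_bd hs (hS hf) (hS hf') he hu hE
    rw [abs_le] at b1 b2 b3 b4
    rw [Finset.mem_image]
    refine ⟨⟨e, x, y, z, w⟩, ?_, ?_⟩
    · simp only [Finset.mem_product, I, J, Finset.mem_Icc, Finset.mem_insert, Finset.mem_singleton]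
      exact ⟨Int.isUnit_iff.1 he, b1, b2, b3, b4⟩
    · simp only [← hE]
      rw [smul_smul]
      rcases Int.isUnit_iff.1 he with h | h <;> simp [h]
  refine (Finset.card_le_card hsub).trans (Finset.card_image_le.trans ?_)
  simp [Finset.card_product, I, J]

theorem bcfAct_inj {h h' : Fin 4 → ℤ} {k p : ℤ} (hp : p ≠ 0)
    (e : bcfAct h 1 0 k p = bcfAct h' 1 0 k p) : h = h' := by
  apply bcf_ext_of_ev
  intro s t
  have e1 : bcfEv (bcfAct h 1 0 k p) (p * s - k * t) t = bcfEv (bcfAct h' 1 0 k p) (p * s - k * t) t := by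
    rw [e]
  rw [bcfEv_act, bcfEv_act] at e1
  have e2 : p ^ 3 * bcfEv h s t = p ^ 3 * bcfEv h' s t := by
    have : ∀ h : Fin 4 → ℤ, bcfEv h (1 * (p * s - k * t) + k * t) (0 * (p * s - k * t) + p * t)
      = p ^ 3 * bcfEv h s t := by intro h; simp [bcfEv]; ring
    rw [this, this] at e1; exact e1
  exact mul_left_cancel₀ (pow_ne_zero 3 hp) e2

theorem bcfAct_quot {f f' : Fin 4 → ℤ} {x y z w x' y' z' w' : ℤ} (hd : x * w - y * z = 1)
    (hd' : x' * w' - y' * z' = 1) (e : bcfAct f x y z w = bcfAct f' x' y' z' w') :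
    ∃ x y z w : ℤ, x * w - y * z = 1 ∧ f' = bcfAct f x y z w := by
  refine ⟨x * w' - z * y', y * w' - w * y', -x * z' + z * x', -y * z' + w * x', ?_, ?_⟩
  · linear_combination (x' * w' - y' * z') * hd + hd'
  · apply bcf_ext_of_ev
    intro a b
    have e1 : bcfEv (bcfAct f x y z w) (w' * a - z' * b) (-y' * a + x' * b)
      = bcfEv (bcfAct f' x' y' z' w') (w' * a - z' * b) (-y' * a + x' * b) := by rw [e]
    rw [bcfEv_act, bcfEv_act] at e1
    rw [bcfEv_act]
    convert e1.symm using 2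
    · linear_combination (-a) * hd'
    · linear_combination (-b) * hd'
    · ring
    · ring

theorem cubic_coeff_zero {F : Type*} [Field F] {a b c d : F}
    (h0 : C a * X ^ 3 + C b * X ^ 2 + C c * X + C d = 0) : a = 0 ∧ b = 0 ∧ c = 0 ∧ d = 0 := by
  have h3 := congrArg (fun q => q.coeff 3) h0
  have h2 := congrArg (fun q => q.coeff 2) h0
  have h1 := congrArg (fun q => q.coeff 1) h0
  have h00 := congrArg (fun q => q.coeff 0) h0
  simp [coeff_X, coeff_C] at h3 h2 h1 h00
  exact ⟨h3, h2, h1, h00⟩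

theorem root_count {p : ℕ} (hp : p.Prime) {g : Fin 4 → ℤ} (hg : ¬ BadC p g) :
    ((Finset.Ico (0 : ℤ) p).filter (fun k => (p : ℤ) ∣ bcfEv g (-k) 1)).card ≤ 3 := by
  have : Fact p.Prime := ⟨hp⟩
  let P : (ZMod p)[X] := C ((g 0 : ZMod p)) * (-X) ^ 3 + C ((g 1 : ZMod p)) * (-X) ^ 2
    + C ((g 2 : ZMod p)) * (-X) + C ((g 3 : ZMod p))
  have hP' : P = C (-(g 0 : ZMod p)) * X ^ 3 + C ((g 1 : ZMod p)) * X ^ 2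
    + C (-(g 2 : ZMod p)) * X + C ((g 3 : ZMod p)) := by
    simp only [P, C_neg]; ring
  have hP0 : P ≠ 0 := by
    intro h0
    apply hg
    intro i
    rw [← ZMod.intCast_zmod_eq_zero_iff_dvd]
    rw [hP'] at h0
    obtain ⟨h1, h2, h3, h4⟩ := cubic_coeff_zero h0
    rw [neg_eq_zero] at h1 h3
    fin_cases i <;> assumption
  have hdeg : P.natDegree ≤ 3 := by rw [hP']; exact natDegree_cubic_le
  refine le_trans ?_ ((P.card_roots').trans hdeg)
  refine le_trans ?_ (Multiset.toFinset_card_le _)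
  refine Finset.card_le_card_of_injOn (fun k : ℤ => (k : ZMod p)) ?_ ?_
  · intro k hk
    simp only [Finset.coe_filter, Set.mem_ofPred_eq, Finset.mem_Ico] at hk
    rw [Finset.mem_coe, Multiset.mem_toFinset, mem_roots hP0, IsRoot]
    have := (ZMod.intCast_zmod_eq_zero_iff_dvd _ p).2 hk.2
    simp [bcfEv] at this
    simp [P]
    exact this
  · intro a ha b hb hab
    simp only [Finset.coe_filter, Set.mem_ofPred_eq, Finset.mem_Ico] at ha hb
    simp only at hab
    rw [ZMod.intCast_eq_intCast_iff, Int.ModEq] at hab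
    rwa [Int.emod_eq_of_lt ha.1.1 ha.1.2, Int.emod_eq_of_lt hb.1.1 hb.1.2] at hab

theorem boxcard {G : Fin 4 → ℤ} {R : Fin 4 → ℝ} (hG : ∀ i, (G i : ℝ) ≤ R i) (hR : ∀ i, 1 ≤ R i) :
    ((Fintype.piFinset fun i => Finset.Icc (-G i) (G i)).card : ℝ) ≤ 81 * (R 0 * R 1 * R 2 * R 3) := by
  rw [Fintype.card_piFinset]
  push_cast
  have h1 : ∀ i, (((Finset.Icc (-G i) (G i)).card : ℕ) : ℝ) ≤ 3 * R i := by
    intro i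
    rw [Int.card_Icc]
    rcases le_or_gt 0 (G i) with h | h
    · have : (((G i + 1 - -G i).toNat : ℕ) : ℝ) = ((G i + 1 - -G i : ℤ) : ℝ) := by
        rw [← Int.cast_natCast, Int.toNat_of_nonneg (by lia)]
      rw [this]; push_cast
      linarith [hG i, hR i]
    · rw [Int.toNat_of_nonpos (by lia)]
      simp; linarith [hR i]
  calc _ ≤ ∏ i, 3 * R i := Finset.prod_le_prod (fun i _ => by positivity) (fun i _ => h1 i)
    _ = _ := by simp [Fin.prod_univ_four]; ring

theorem Rge {B p m q : ℝ} (hB : 0 < B) (hm : 1 ≤ m) (hmp : m ^ 2 ≤ p) (hq : 1 ≤ q)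
    (h : p ^ 2 * q ≤ 4 * B * m ^ 3) : p * q ≤ 4 * B * m ∧ m * q ≤ 4 * B ∧ m ^ 3 * q ≤ 4 * B * p := by
  have hp : 0 < p := by nlinarith
  have h1 : p * q ≤ 4 * B * m := by
    refine le_of_mul_le_mul_left (a := p) ?_ hp
    have : 4 * B * m * m ^ 2 ≤ 4 * B * m * p := by gcongr
    linarith
  have h2 : m * q ≤ 4 * B := by
    refine le_of_mul_le_mul_left (a := m) ?_ (by linarith)
    have : m ^ 2 * q ≤ p * q := by gcongr
    linarith
  refine ⟨h1, h2, ?_⟩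
  have : m ^ 2 * (m * q) ≤ p * (4 * B) := by gcongr
  linarith

/-- sizes -/
def Gb (B p m : ℤ) : Fin 4 → ℤ := ![4 * B * m ^ 3 / p ^ 2, 24 * B * m / p, 48 * B / m, 32 * B * p / m ^ 3]

theorem int_div_le (a b : ℤ) (hb : 0 < b) : ((a / b : ℤ) : ℝ) ≤ a / b := by
  rw [le_div_iff₀ (by exact_mod_cast hb)]
  exact_mod_cast Int.ediv_mul_le a hb.ne'

/-- real sizes -/
def Rb (B p m : ℝ) : Fin 4 → ℝ :=
  ![4 * B * m ^ 3 / p ^ 2, 24 * B * m / p, 48 * B / m, 32 * B * p / m ^ 3]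

theorem Gb_le {B p m : ℤ} (hp : 0 < p) (hm : 0 < m) (i : Fin 4) : (Gb B p m i : ℝ) ≤ Rb B p m i := by
  have i0 := int_div_le (4 * B * m ^ 3) (p ^ 2) (by positivity)
  have i1 := int_div_le (24 * B * m) p hp
  have i2 := int_div_le (48 * B) m hm
  have i3 := int_div_le (32 * B * p) (m ^ 3) (by positivity)
  push_cast at i0 i1 i2 i3
  fin_cases i
  · exact i0
  · exact i1
  · exact i2
  · exact i3

theorem Rb_ge {B p m q : ℝ} (hB : 0 < B) (hm : 1 ≤ m) (hmp : m ^ 2 ≤ p) (hq : 1 ≤ q)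
    (h : p ^ 2 * q ≤ 4 * B * m ^ 3) (i : Fin 4) : 1 ≤ Rb B p m i / q := by
  obtain ⟨r1, r2, r3⟩ := Rge hB hm hmp hq h
  have hp : 0 < p := by nlinarith
  have hm0 : 0 < m := by linarith
  have hq0 : 0 < q := by linarith
  have e1 : 0 ≤ B * m := by positivity
  have e2 : 0 ≤ B * p := by positivity
  rw [le_div_iff₀ hq0, one_mul]
  fin_cases i
  · change q ≤ 4 * B * m ^ 3 / p ^ 2
    rw [le_div_iff₀ (by positivity)]; linarith
  · change q ≤ 24 * B * m / p
    rw [le_div_iff₀ (by positivity)]; linarith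
  · change q ≤ 48 * B / m
    rw [le_div_iff₀ (by positivity)]; linarith
  · change q ≤ 32 * B * p / m ^ 3
    rw [le_div_iff₀ (by positivity)]; linarith

theorem Rb_prod {B p m q : ℝ} (hp : 0 < p) (hm : 0 < m) (hq : 0 < q) :
    81 * (Rb B p m 0 / q * (Rb B p m 1 / q) * (Rb B p m 2 / q) * (Rb B p m 3 / q))
      = 81 * 147456 * B ^ 4 / (p ^ 2 * q ^ 4) := by
  change 81 * (4 * B * m ^ 3 / p ^ 2 / q * (24 * B * m / p / q) * (48 * B / m / q)
    * (32 * B * p / m ^ 3 / q)) = _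
  field_simp; ring

theorem boxcard_q {B p m q : ℤ} (hB : 0 < B) (hm : 1 ≤ m) (hmp : m ^ 2 ≤ p) (hq : 1 ≤ q)
    (h0 : 1 ≤ Gb B p m 0 / q) :
    ((Fintype.piFinset fun i => Finset.Icc (-(Gb B p m i / q)) (Gb B p m i / q)).card : ℝ)
      ≤ 81 * 147456 * B ^ 4 / (p ^ 2 * q ^ 4) := by
  have hp : 0 < p := by nlinarith
  have hm0 : 0 < m := by lia
  have hq0 : 0 < q := by lia
  have hpR : (0 : ℝ) < p := by exact_mod_cast hp
  have hmR : (0 : ℝ) < m := by exact_mod_cast hm0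
  have hqR : (0 : ℝ) < q := by exact_mod_cast hq0
  have hBR : (0 : ℝ) < B := by exact_mod_cast hB
  have h0' : q ≤ Gb B p m 0 := by
    have := (Int.le_ediv_iff_mul_le hq0).1 h0; lia
  have h1 : q * p ^ 2 ≤ 4 * B * m ^ 3 := (Int.le_ediv_iff_mul_le (by positivity)).1 h0'
  have h1R : (q : ℝ) * p ^ 2 ≤ 4 * B * m ^ 3 := by exact_mod_cast h1
  have hR := Rb_ge (B := B) (p := p) (m := m) (q := q) hBR
    (by exact_mod_cast hm) (by exact_mod_cast hmp) (by exact_mod_cast hq) (by linarith)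
  rw [← Rb_prod hpR hmR hqR]
  refine boxcard (R := fun i => Rb B p m i / q) ?_ hR
  intro i
  refine (int_div_le _ _ hq0).trans ?_
  have := Gb_le (B := B) hp hm0 i
  gcongr

open Classical in
/-- pairs -/
def Pm (B : ℤ) (p m : ℕ) : Finset ((Fin 4 → ℤ) × ℤ) :=
  ((Fintype.piFinset fun i => Finset.Icc (-(Gb B p m i)) (Gb B p m i)) ×ˢ Finset.Ico (0 : ℤ) p).filter
    fun q => q.1 0 ≠ 0 ∧ (p : ℤ) ∣ bcfEv q.1 (-q.2) 1

open Classical in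
theorem card_Pm {B : ℤ} {p m : ℕ} (hp : p.Prime) (hB : 0 < B) (hm : 1 ≤ m) (hmp : m ^ 2 ≤ p) :
    ((Pm B p m).card : ℝ) ≤ 4 * (81 * 147456 * B ^ 4 / p ^ 2) := by
  have hp0 : 0 < p := hp.pos
  have hm' : (1 : ℤ) ≤ m := by exact_mod_cast hm
  have hmp' : (m : ℤ) ^ 2 ≤ p := by exact_mod_cast hmp
  have hp1 : (1 : ℝ) ≤ p := by exact_mod_cast hp0
  have hBR : (0 : ℝ) < B := by exact_mod_cast hB
  set N : ℝ := 81 * 147456 * B ^ 4 / p ^ 2 with hN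
  have hN0 : 0 ≤ N := by positivity
  rw [← Finset.card_filter_add_card_filter_not (s := Pm B p m) (p := fun q => BadC p q.1)]
  push_cast
  have h1 : (((Pm B p m).filter fun q => BadC p q.1).card : ℝ) ≤ N := by
    by_cases h0 : 1 ≤ Gb B p m 0 / p
    · have hb := boxcard_q (q := (p : ℤ)) hB hm' hmp' (by exact_mod_cast hp0) h0
      have : ((Pm B p m).filter fun q => BadC p q.1).card ≤
          ((Fintype.piFinset fun i => Finset.Icc (-(Gb B p m i / p)) (Gb B p m i / p))
            ×ˢ Finset.Ico (0 : ℤ) p).card := by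
        refine Finset.card_le_card_of_injOn (fun q => (fun i => q.1 i / p, q.2)) ?_ ?_
        · rintro ⟨g, k⟩ hq
          simp only [Finset.coe_filter, Set.mem_ofPred_eq, Pm, Finset.mem_filter, Finset.mem_product,
            Fintype.mem_piFinset, Finset.mem_Icc, Finset.mem_coe] at hq ⊢
          refine ⟨fun i => ?_, hq.1.1.2⟩
          obtain ⟨a, ha⟩ := hq.2 i
          have hb := hq.1.1.1 i
          have hpz : (0 : ℤ) < p := by exact_mod_cast hp0
          rw [ha, Int.mul_ediv_cancel_left _ hpz.ne']
          rw [ha] at hb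
          have e1 : a ≤ Gb B p m i / p := by rw [Int.le_ediv_iff_mul_le hpz]; lia
          have e2 : -a ≤ Gb B p m i / p := by rw [Int.le_ediv_iff_mul_le hpz]; lia
          lia
        · rintro ⟨g, k⟩ hq ⟨g', k'⟩ hq' he
          simp only [Finset.coe_filter, Set.mem_ofPred_eq] at hq hq'
          simp only [Prod.mk.injEq] at he
          ext i
          · have := congrFun he.1 i
            change g i = g' i
            rw [← Int.ediv_mul_cancel (hq.2 i), ← Int.ediv_mul_cancel (hq'.2 i), this]
          · exact he.2
      rw [Finset.card_product, Int.card_Ico] at this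
      have h2 : (((Pm B p m).filter fun q => BadC p q.1).card : ℝ) ≤ ((Fintype.piFinset fun i => Finset.Icc (-(Gb B p m i / p)) (Gb B p m i / p)).card : ℝ) * p := by
        rw [sub_zero, Int.toNat_natCast] at this
        exact_mod_cast this
      refine h2.trans ?_
      calc _ ≤ (81 * 147456 * B ^ 4 / (((p : ℤ) : ℝ) ^ 2 * ((p : ℤ) : ℝ) ^ 4)) * p := by gcongr
        _ = N / p ^ 3 := by rw [hN]; push_cast; field_simp
        _ ≤ N := div_le_self hN0 (one_le_pow₀ hp1)
    · have : ((Pm B p m).filter fun q => BadC p q.1) = ∅ := by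
        rw [Finset.filter_eq_empty_iff]
        rintro ⟨g, k⟩ hq hbad
        simp only [Pm, Finset.mem_filter, Finset.mem_product,
            Fintype.mem_piFinset, Finset.mem_Icc] at hq
        have hb := hq.1.1 0
        have hpz : (0 : ℤ) < p := by exact_mod_cast hp0
        have h1 := Int.le_of_dvd (abs_pos.2 hq.2.1) ((dvd_abs _ _).2 (hbad 0))
        apply h0
        rw [Int.le_ediv_iff_mul_le hpz, one_mul]
        refine h1.trans ?_
        rw [abs_le]; lia
      rw [this]; simpa using hN0
  have h2 : (((Pm B p m).filter fun q => ¬ BadC p q.1).card : ℝ) ≤ 3 * N := by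
    by_cases h0 : 1 ≤ Gb B p m 0
    · have hb := boxcard_q (q := 1) hB hm' hmp' le_rfl (by simpa using h0)
      simp only [Int.ediv_one] at hb
      have h3 := Finset.card_le_mul_card_image (f := Prod.fst)
        ((Pm B p m).filter fun q => ¬ BadC p q.1) 3 (by
          intro g hg
          rw [Finset.mem_image] at hg
          obtain ⟨⟨g', k⟩, hq, rfl⟩ := hg
          simp only [Finset.mem_filter] at hq
          refine le_trans ?_ (root_count hp hq.2)
          refine Finset.card_le_card_of_injOn Prod.snd ?_ ?_
          · rintro ⟨g1, k1⟩ h1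
            simp only [Finset.coe_filter, Set.mem_ofPred_eq, Pm, Finset.mem_filter, Finset.mem_product] at h1 ⊢
            obtain ⟨h1, rfl⟩ := h1
            exact ⟨h1.1.1.2, h1.1.2.2⟩
          · rintro ⟨g1, k1⟩ h1 ⟨g2, k2⟩ h2 he
            simp only [Finset.coe_filter, Set.mem_ofPred_eq] at h1 h2
            simp only at he
            rw [Prod.mk.injEq]
            exact ⟨h1.2.trans h2.2.symm, he⟩)
      have h4 : (((Pm B p m).filter fun q => ¬ BadC p q.1).image Prod.fst).card ≤
          (Fintype.piFinset fun i => Finset.Icc (-(Gb B p m i)) (Gb B p m i)).card := by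
        refine Finset.card_le_card ?_
        intro g hg
        rw [Finset.mem_image] at hg
        obtain ⟨⟨g', k⟩, hq, rfl⟩ := hg
        simp only [Finset.mem_filter, Pm, Finset.mem_product] at hq
        exact hq.1.1.1
      have h5 : (((Pm B p m).filter fun q => ¬ BadC p q.1).card : ℝ) ≤
        3 * ((Fintype.piFinset fun i => Finset.Icc (-(Gb B p m i)) (Gb B p m i)).card : ℝ) := by
        exact_mod_cast h3.trans (Nat.mul_le_mul_left 3 h4)
      refine h5.trans ?_
      have : N = 81 * 147456 * B ^ 4 / (((p : ℤ) : ℝ) ^ 2 * ((1 : ℤ) : ℝ) ^ 4) := by rw [hN]; simp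
      rw [this]; gcongr
    · have : ((Pm B p m).filter fun q => ¬ BadC p q.1) = ∅ := by
        rw [Finset.filter_eq_empty_iff]
        rintro ⟨g, k⟩ hq hbad
        simp only [Pm, Finset.mem_filter, Finset.mem_product,
            Fintype.mem_piFinset, Finset.mem_Icc] at hq
        have hb := hq.1.1 0
        have := hq.2.1
        lia
      rw [this]; simpa using hN0
  linarith

open Classical in
theorem tail_NC {s T : ℤ} (hs : s = 1 ∨ s = -1) (hT : 0 < T) {p : ℕ} (hp : p.Prime) :
    (((fBox s T).filter fun f => (∀ u v, bcfEv f u v = 0 → u = 0 ∧ v = 0) ∧ BadNC p f).card : ℝ)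
      ≤ 162 * (4 * (81 * 147456 * (101 * T) ^ 4 / p ^ 2) * Nat.sqrt p) := by
  set S := (fBox s T).filter fun f => (∀ u v, bcfEv f u v = 0 → u = 0 ∧ v = 0) ∧ BadNC p f with hS
  have hp0 : (p : ℤ) ≠ 0 := by exact_mod_cast hp.ne_zero
  have hpp : (0 : ℤ) < p := by exact_mod_cast hp.pos
  have key : ∀ f : Fin 4 → ℤ, ∃ q : (Fin 4 → ℤ) × ℤ, f ∈ S →
      ((∃ m ∈ Finset.Icc 1 (Nat.sqrt p), q ∈ Pm (101 * T) p m) ∧ ∃ x y z w, x * w - y * z = 1 ∧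
      ((p : ℤ) ^ 2) • q.1 = bcfAct (bcfAct f x y z w) 1 0 q.2 p) := by
    intro f
    by_cases hf : f ∈ S
    · have hf' := (Finset.mem_filter.1 hf)
      obtain ⟨m, k, x, y, z, w, g, h1, h2, h3, h4, h5, h6, h7, h8, h9, h10, h11, h12⟩ :=
        bad_reduce hp (B := 101 * T) (fun i => (fBox_abs hs hf'.1 i).1) hf'.2.1 hf'.2.2
      refine ⟨(g, k), fun _ => ⟨⟨m, ?_, ?_⟩, x, y, z, w, h3, h6⟩⟩
      · rw [Finset.mem_Icc, Nat.le_sqrt']; exact ⟨h1, h2⟩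
      · simp only [Pm, Finset.mem_filter, Finset.mem_product, Fintype.mem_piFinset, Finset.mem_Icc,
          Finset.mem_Ico]
        refine ⟨⟨fun i => ?_, h4, h5⟩, h7, h8⟩
        rw [← abs_le]
        have hm0 : (0 : ℤ) < m := by exact_mod_cast h1
        fin_cases i
        · exact (Int.le_ediv_iff_mul_le (by positivity)).2 h9
        · exact (Int.le_ediv_iff_mul_le (by positivity)).2 h10
        · exact (Int.le_ediv_iff_mul_le (by positivity)).2 h11
        · exact (Int.le_ediv_iff_mul_le (by positivity)).2 h12
    · exact ⟨default, fun h => absurd h hf⟩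
  choose φ hφ using key
  have h1 := Finset.card_le_mul_card_image (f := φ) S 162 (by
    intro q hq
    refine orbit_card hs _ ((Finset.filter_subset _ _).trans (Finset.filter_subset _ _)) ?_
    intro f hf f' hf'
    rw [Finset.mem_filter] at hf hf'
    obtain ⟨-, x, y, z, w, hd, he⟩ := hφ f hf.1
    obtain ⟨-, x', y', z', w', hd', he'⟩ := hφ f' hf'.1
    rw [hf.2] at he
    rw [hf'.2] at he'
    obtain ⟨a, b, c, d, hdet, hff⟩ := bcfAct_quot hd hd' (bcfAct_inj hp0 (he.symm.trans he'))
    refine ⟨a, b, c, d, 1, isUnit_one, by rw [hdet]; exact isUnit_one, by rw [one_smul]; exact hff⟩)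
  have h2 : S.image φ ⊆ (Finset.Icc 1 (Nat.sqrt p)).biUnion fun m => Pm (101 * T) p m := by
    intro q hq
    rw [Finset.mem_image] at hq
    obtain ⟨f, hf, rfl⟩ := hq
    rw [Finset.mem_biUnion]
    exact (hφ f hf).1
  have h3 := (Finset.card_le_card h2).trans Finset.card_biUnion_le
  have h4 : ((S.image φ).card : ℝ) ≤ ∑ m ∈ Finset.Icc 1 (Nat.sqrt p), ((Pm (101 * T) p m).card : ℝ) := by
    exact_mod_cast h3
  have h5 : ∑ m ∈ Finset.Icc 1 (Nat.sqrt p), ((Pm (101 * T) p m).card : ℝ) ≤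
      ∑ m ∈ Finset.Icc 1 (Nat.sqrt p), 4 * (81 * 147456 * (101 * T : ℝ) ^ 4 / p ^ 2) := by
    refine Finset.sum_le_sum fun m hm => ?_
    rw [Finset.mem_Icc, Nat.le_sqrt'] at hm
    have := card_Pm hp (B := 101 * T) (by lia) hm.1 hm.2
    push_cast at this
    exact this
  rw [Finset.sum_const, Nat.card_Icc, nsmul_eq_mul] at h5
  have h6 : (S.card : ℝ) ≤ 162 * ((S.image φ).card : ℝ) := by exact_mod_cast h1
  have : ((Nat.sqrt p + 1 - 1 : ℕ) : ℝ) = Nat.sqrt p := by simp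
  rw [this] at h5
  linarith

theorem mult_count {a T p : ℤ} (hT : 0 < T) (hp : 0 < p) (hpT : p ≤ 101 * T) :
    (((Finset.Ico a (a + T)).filter fun x => p ∣ x).card : ℝ) ≤ 102 * T / p := by
  have h := Int.Ico_filter_dvd_card a (a + T) hp
  have hpR : (0 : ℚ) < p := by exact_mod_cast hp
  have h1 : ((⌈((a + T : ℤ) : ℚ) / p⌉ - ⌈(a : ℚ) / p⌉ : ℤ) : ℚ) < T / p + 1 := by
    have e1 := Int.ceil_lt_add_one (((a + T : ℤ) : ℚ) / p)
    have e2 := Int.le_ceil ((a : ℚ) / p)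
    push_cast at e1 ⊢
    have e3 : ((a : ℚ) + T) / p = a / p + T / p := add_div _ _ _
    linarith
  have h2 : (((Finset.Ico a (a + T)).filter fun x => p ∣ x).card : ℚ) ≤ 102 * T / p := by
    have h3 : (((Finset.Ico a (a + T)).filter fun x => p ∣ x).card : ℚ)
      = ((max (⌈((a + T : ℤ) : ℚ) / p⌉ - ⌈(a : ℚ) / p⌉) 0 : ℤ) : ℚ) := by
      rw [← h]; simp
    rw [h3]
    have h4 : (1 : ℚ) ≤ 101 * T / p := by
      rw [le_div_iff₀ hpR]; rw [one_mul]; exact_mod_cast hpT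
    have h5 : (102 * T / p : ℚ) = T / p + 101 * T / p := by ring
    rcases max_choice (⌈((a + T : ℤ) : ℚ) / p⌉ - ⌈(a : ℚ) / p⌉) 0 with h' | h' <;> rw [h']
    · rw [h5]; exact h1.le.trans (by gcongr)
    · have : (0 : ℚ) < T := by exact_mod_cast hT
      rw [Int.cast_zero]; positivity
  exact_mod_cast h2

open Classical in
theorem tail_C {s T : ℤ} (hs : s = 1 ∨ s = -1) (hT : 0 < T) {p : ℕ} (hp : p.Prime) :
    (((fBox s T).filter fun f => BadC p f).card : ℝ) ≤ (102 * T / p) ^ 4 := by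
  have hp0 : (0 : ℤ) < p := by exact_mod_cast hp.pos
  by_cases hpT : (p : ℤ) ≤ 101 * T
  · have hsub : ((fBox s T).filter fun f => BadC p f) ⊆ Fintype.piFinset fun i =>
        (Finset.Ico (boxA s i * T) (boxA s i * T + T)).filter fun x => (p : ℤ) ∣ x := by
      intro f hf
      simp only [fBox, Finset.mem_filter, Fintype.mem_piFinset] at hf ⊢
      exact fun i => ⟨hf.1 i, hf.2 i⟩
    have h1 := Finset.card_le_card hsub
    rw [Fintype.card_piFinset] at h1
    have h2 : (((fBox s T).filter fun f => BadC p f).card : ℝ) ≤ ∏ i : Fin 4,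
        (((Finset.Ico (boxA s i * T) (boxA s i * T + T)).filter fun x => (p : ℤ) ∣ x).card : ℝ) := by
      exact_mod_cast h1
    refine h2.trans ?_
    calc _ ≤ ∏ i : Fin 4, (102 * T / p : ℝ) := by
          refine Finset.prod_le_prod (fun i _ => by positivity) fun i _ => ?_
          have := mult_count (a := boxA s i * T) hT hp0 hpT
          exact_mod_cast this
      _ = _ := by rw [Finset.prod_const, Finset.card_univ, Fintype.card_fin]
  · have : ((fBox s T).filter fun f => BadC p f) = ∅ := by
      rw [Finset.filter_eq_empty_iff]
      intro f hf hb
      rcases hs with rfl | rfl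
      · have h1 := mem_fBox_one hf
        have := Int.le_of_dvd (by lia) (hb 1)
        lia
      · have h1 := mem_fBox_neg hf
        have := Int.le_of_dvd (by lia) (hb 0)
        lia
    rw [this]; simp; positivity

open Classical in
/-- the tail estimate -/
theorem tail_all : ∃ C : ℝ, 0 < C ∧ ∀ s T : ℤ, (s = 1 ∨ s = -1) → 0 < T → ∀ p : ℕ, p.Prime →
    (((fBox s T).filter fun f => (∀ u v, bcfEv f u v = 0 → u = 0 ∧ v = 0) ∧
      (BadC p f ∨ BadNC p f)).card : ℝ) ≤ C * T ^ 4 * (1 / (p : ℝ) ^ (3 / 2 : ℝ)) := by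
  refine ⟨162 * (4 * (81 * 147456 * 101 ^ 4)) + 102 ^ 4, by norm_num, ?_⟩
  intro s T hs hT p hp
  have h1 := tail_NC hs hT hp
  have h2 := tail_C hs hT hp
  have hp1 : (1 : ℝ) ≤ p := by exact_mod_cast hp.pos
  have hp0 : (0 : ℝ) < p := by linarith
  have hTR : (0 : ℝ) < T := by exact_mod_cast hT
  have h3 : ((fBox s T).filter fun f => (∀ u v, bcfEv f u v = 0 → u = 0 ∧ v = 0) ∧
      (BadC p f ∨ BadNC p f)) ⊆ ((fBox s T).filter fun f => BadC p f) ∪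
      ((fBox s T).filter fun f => (∀ u v, bcfEv f u v = 0 → u = 0 ∧ v = 0) ∧ BadNC p f) := by
    intro f hf
    simp only [Finset.mem_union, Finset.mem_filter] at hf ⊢
    tauto
  have h4 := (Finset.card_le_card h3).trans (Finset.card_union_le _ _)
  have h5 : (((fBox s T).filter fun f => (∀ u v, bcfEv f u v = 0 → u = 0 ∧ v = 0) ∧
      (BadC p f ∨ BadNC p f)).card : ℝ) ≤ (((fBox s T).filter fun f => BadC p f).card : ℝ) +
      (((fBox s T).filter fun f => (∀ u v, bcfEv f u v = 0 → u = 0 ∧ v = 0) ∧ BadNC p f).card : ℝ) := by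
    exact_mod_cast h4
  set q : ℝ := 1 / (p : ℝ) ^ (3 / 2 : ℝ) with hq
  have hq1 : (Nat.sqrt p : ℝ) / p ^ 2 ≤ q := by
    have e1 : (Nat.sqrt p : ℝ) ≤ (p : ℝ) ^ (1 / 2 : ℝ) := by
      rw [← Real.sqrt_eq_rpow]; exact Real.nat_sqrt_le_real_sqrt
    have e2 : (p : ℝ) ^ 2 = (p : ℝ) ^ (1 / 2 : ℝ) * (p : ℝ) ^ (3 / 2 : ℝ) := by
      rw [← Real.rpow_add hp0, ← Real.rpow_natCast]; norm_num
    rw [hq, div_le_div_iff₀ (by positivity) (by positivity), e2, one_mul]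
    gcongr
  have hq2 : 1 / (p : ℝ) ^ 4 ≤ q := by
    rw [hq]
    apply one_div_le_one_div_of_le (by positivity)
    rw [← Real.rpow_natCast]
    exact Real.rpow_le_rpow_of_exponent_le hp1 (by norm_num)
  have h6 : 162 * (4 * (81 * 147456 * (101 * T : ℝ) ^ 4 / p ^ 2) * Nat.sqrt p) ≤
      162 * (4 * (81 * 147456 * 101 ^ 4)) * T ^ 4 * q := by
    calc _ = 162 * (4 * (81 * 147456 * 101 ^ 4)) * (T : ℝ) ^ 4 * (Nat.sqrt p / p ^ 2) := by ring
      _ ≤ _ := by gcongr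
  have h7 : (102 * T / p : ℝ) ^ 4 ≤ 102 ^ 4 * T ^ 4 * q := by
    calc _ = 102 ^ 4 * (T : ℝ) ^ 4 * (1 / p ^ 4) := by rw [div_pow, mul_pow]; ring
      _ ≤ _ := by gcongr
  calc _ ≤ _ := h5
    _ ≤ _ := add_le_add (h2.trans h7) (h1.trans h6)
    _ = _ := by ring

/-- periodic predicate -/
def Per (n : ℤ) (P : (Fin 4 → ℤ) → Prop) : Prop :=
  ∀ f f' : Fin 4 → ℤ, (∀ i, f i ≡ f' i [ZMOD n]) → P f → P f'

/-- general box -/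
def gBox (a : Fin 4 → ℤ) (T : ℤ) : Finset (Fin 4 → ℤ) :=
  Fintype.piFinset fun i => Finset.Ico (a i) (a i + T)

open Classical in
/-- number of residue classes -/
def cnt (n : ℤ) (P : (Fin 4 → ℤ) → Prop) : ℕ := ((gBox 0 n).filter P).card

theorem mem_gBox {a : Fin 4 → ℤ} {T : ℤ} {f : Fin 4 → ℤ} :
    f ∈ gBox a T ↔ ∀ i, a i ≤ f i ∧ f i < a i + T := by
  simp [gBox, Fintype.mem_piFinset]

theorem mem_gBox0 {T : ℤ} {f : Fin 4 → ℤ} :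
    f ∈ gBox 0 T ↔ ∀ i, 0 ≤ f i ∧ f i < T := by
  simp [mem_gBox]

theorem class_count {a n q v : ℤ} (hn : 0 < n) (hq : 0 ≤ q) :
    (((Finset.Ico a (a + n * q)).filter fun x => x ≡ v [ZMOD n]).card : ℤ) = q := by
  rw [Int.Ico_filter_modEq_card a (a + n * q) hn v]
  have hn' : (n : ℚ) ≠ 0 := by exact_mod_cast hn.ne'
  have : (((a + n * q : ℤ) : ℚ) - v) / n = ((a : ℚ) - v) / n + (q : ℤ) := by
    push_cast; field_simp; ring
  rw [this, Int.ceil_add_intCast]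
  simp [hq]

open Classical in
theorem box_count {n : ℤ} (hn : 0 < n) {P : (Fin 4 → ℤ) → Prop} (hP : Per n P) (a : Fin 4 → ℤ)
    (q : ℕ) : ((gBox a (n * q)).filter P).card = cnt n P * q ^ 4 := by
  rw [cnt, Finset.card_eq_sum_card_fiberwise (f := fun f i => f i % n)
    (t := (gBox 0 n).filter P)]
  · rw [Finset.sum_const_nat (m := q ^ 4)]
    intro r hr
    rw [Finset.mem_filter, mem_gBox0] at hr
    have : ((gBox a (n * q)).filter P).filter (fun f => (fun i => f i % n) = r) =
        Fintype.piFinset fun i => (Finset.Ico (a i) (a i + n * q)).filter fun x => x ≡ r i [ZMOD n] := by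
      ext f
      simp only [Finset.mem_filter, gBox, Fintype.mem_piFinset]
      have hmod : ∀ i, r i % n = r i := fun i => Int.emod_eq_of_lt (hr.1 i).1 (hr.1 i).2
      constructor
      · rintro ⟨⟨h1, -⟩, h2⟩ i
        refine ⟨h1 i, ?_⟩
        rw [Int.ModEq, hmod, ← h2]
      · intro h
        refine ⟨⟨fun i => (h i).1, hP r f (fun i => (h i).2.symm) hr.2⟩, ?_⟩
        ext i
        have := (h i).2
        rw [Int.ModEq, hmod] at this
        exact this
    rw [this, Fintype.card_piFinset]
    have : ∀ i, ((Finset.Ico (a i) (a i + n * q)).filter fun x => x ≡ r i [ZMOD n]).card = q := by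
      intro i
      have := class_count (a := a i) (v := r i) hn (Int.natCast_nonneg q)
      exact_mod_cast this
    simp [this]
  · intro f hf
    simp only [Finset.coe_filter, Set.mem_ofPred_eq] at hf ⊢
    refine ⟨mem_gBox0.2 fun i => ⟨Int.emod_nonneg _ hn.ne', Int.emod_lt_of_pos _ hn⟩, ?_⟩
    exact hP f _ (fun i => (Int.mod_modEq _ _).symm) hf.2

theorem Per.and {n n' : ℤ} {P P' : (Fin 4 → ℤ) → Prop} (h : Per n P) (h' : Per n' P') :
    Per (n * n') (fun f => P f ∧ P' f) := by
  intro f f' hm hf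
  exact ⟨h f f' (fun i => (hm i).of_mul_right _) hf.1, h' f f' (fun i => (hm i).of_mul_left _) hf.2⟩

open Classical in
theorem cnt_crt {n n' : ℤ} (hn : 0 < n) (hn' : 0 < n') (hco : IsCoprime n n')
    {P P' : (Fin 4 → ℤ) → Prop} (h : Per n P) (h' : Per n' P') :
    cnt (n * n') (fun f => P f ∧ P' f) = cnt n P * cnt n' P' := by
  rw [cnt, cnt, cnt, ← Finset.card_product]
  refine Finset.card_nbij (fun f => (fun i => f i % n, fun i => f i % n')) ?_ ?_ ?_
  · intro f hf
    simp only [Finset.coe_filter, Set.mem_ofPred_eq, Finset.coe_product, Set.mem_prod, Finset.mem_filter] at hf ⊢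
    refine ⟨⟨mem_gBox0.2 fun i => ⟨Int.emod_nonneg _ hn.ne', Int.emod_lt_of_pos _ hn⟩, ?_⟩,
      ⟨mem_gBox0.2 fun i => ⟨Int.emod_nonneg _ hn'.ne', Int.emod_lt_of_pos _ hn'⟩, ?_⟩⟩
    · exact h f _ (fun i => (Int.mod_modEq _ _).symm) hf.2.1
    · exact h' f _ (fun i => (Int.mod_modEq _ _).symm) hf.2.2
  · intro f hf g hg he
    simp only [Finset.coe_filter, Set.mem_ofPred_eq, mem_gBox0] at hf hg
    simp only [Prod.mk.injEq] at he
    ext i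
    have e1 : f i ≡ g i [ZMOD n] := congrFun he.1 i
    have e2 : f i ≡ g i [ZMOD n'] := congrFun he.2 i
    have e3 : f i ≡ g i [ZMOD n * n'] := by
      rw [Int.modEq_iff_dvd] at *
      exact hco.mul_dvd e1 e2
    rw [Int.ModEq, Int.emod_eq_of_lt (hf.1 i).1 (hf.1 i).2,
      Int.emod_eq_of_lt (hg.1 i).1 (hg.1 i).2] at e3
    exact e3
  · rintro ⟨r, r'⟩ hr
    simp only [Finset.coe_product, Finset.coe_filter, Set.mem_prod, Set.mem_ofPred_eq, mem_gBox0] at hr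
    obtain ⟨u, v, huv⟩ := hco
    let f : Fin 4 → ℤ := fun i => (r' i * u * n + r i * v * n') % (n * n')
    have e1 : ∀ i, f i ≡ r i [ZMOD n] := by
      intro i
      refine ((Int.mod_modEq _ (n * n')).of_mul_right n').trans ?_
      rw [Int.modEq_iff_dvd]
      exact ⟨r i * u - r' i * u, by linear_combination (-r i) * huv⟩
    have e2 : ∀ i, f i ≡ r' i [ZMOD n'] := by
      intro i
      refine ((Int.mod_modEq _ (n * n')).of_mul_left n).trans ?_
      rw [Int.modEq_iff_dvd]
      exact ⟨r' i * v - r i * v, by linear_combination (-r' i) * huv⟩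
    have hnn : 0 < n * n' := by positivity
    refine ⟨f, ?_, ?_⟩
    · simp only [Finset.coe_filter, Set.mem_ofPred_eq, mem_gBox0]
      exact ⟨fun i => ⟨Int.emod_nonneg _ hnn.ne', Int.emod_lt_of_pos _ hnn⟩,
        h r f (fun i => (e1 i).symm) hr.1.2, h' r' f (fun i => (e2 i).symm) hr.2.2⟩
    · ext i
      · have := e1 i
        rwa [Int.ModEq, Int.emod_eq_of_lt (hr.1.1 i).1 (hr.1.1 i).2] at this
      · have := e2 i
        rwa [Int.ModEq, Int.emod_eq_of_lt (hr.2.1 i).1 (hr.2.1 i).2] at this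

/-- nonmaximality at `p` -/
def Bad (p : ℤ) (f : Fin 4 → ℤ) : Prop := BadC p f ∨ BadNC p f

theorem BadC.per {p : ℤ} : Per p (BadC p) := by
  intro f f' h hf i
  exact (h i).dvd_iff.1 (hf i)

theorem BadAt.per {p u v : ℤ} : Per (p ^ 2) (fun f => BadAt p f u v) := by
  intro f f' h hf
  have h1 : ∀ i, ∃ k, f' i = f i + p ^ 2 * k := by
    intro i
    obtain ⟨k, hk⟩ := (Int.modEq_iff_dvd.1 (h i))
    exact ⟨k, by linarith⟩
  choose k hk using h1
  obtain ⟨⟨a, ha⟩, ⟨b, hb⟩, ⟨c, hc⟩⟩ := hf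
  refine ⟨⟨a + bcfEv k u v, ?_⟩, ⟨b + p * (3 * k 0 * u ^ 2 + 2 * k 1 * u * v + k 2 * v ^ 2), ?_⟩,
    ⟨c + p * (k 1 * u ^ 2 + 2 * k 2 * u * v + 3 * k 3 * v ^ 2), ?_⟩⟩
  · simp only [bcfEv, hk] at *; linear_combination ha
  · simp only [hk]; linear_combination hb
  · simp only [hk]; linear_combination hc

theorem Bad.per {p : ℤ} : Per (p ^ 2) (Bad p) := by
  intro f f' h hf
  rcases hf with hf | ⟨u, v, huv, hf⟩
  · left; exact BadC.per f f' (fun i => (h i).of_dvd (dvd_pow_self p two_ne_zero)) hf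
  · right; exact ⟨u, v, huv, BadAt.per f f' h hf⟩

theorem Bad.cases {p : ℤ} (hp : Prime p) (hp0 : 0 < p) {f : Fin 4 → ℤ} (h : Bad p f) :
    BadC p f ∨ BadAt p f 1 0 ∨ ∃ t ∈ Finset.Ico 0 p, BadAt p f t 1 := by
  rcases h with h | ⟨u, v, huv, h⟩
  · exact Or.inl h
  · right
    change BadAt p f u v at h
    by_cases hv : p ∣ v
    · left; exact h.transfer hp huv (by simpa using hv)
    · right
      obtain ⟨a, b, hab⟩ := (hp.coprime_iff_not_dvd).2 hv
      refine ⟨(u * b) % p, ?_, h.transfer hp huv ?_⟩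
      · rw [Finset.mem_Ico]; exact ⟨Int.emod_nonneg _ hp0.ne', Int.emod_lt_of_pos _ hp0⟩
      · have := Int.mul_ediv_add_emod (u * b) p
        refine ⟨-(v * (u * b / p)) - u * a, ?_⟩
        linear_combination v * this + u * hab

open Classical in
theorem cnt_BadC {p : ℤ} (hp0 : 0 < p) : cnt (p ^ 2) (BadC p) ≤ p.toNat ^ 4 := by
  have : ((gBox 0 p).card) = p.toNat ^ 4 := by
    simp [gBox, Fintype.card_piFinset]
  rw [← this, cnt]
  refine Finset.card_le_card_of_injOn (fun f i => f i / p) ?_ ?_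
  · intro f hf
    simp only [Finset.coe_filter, Set.mem_ofPred_eq, mem_gBox0, Finset.mem_coe] at hf ⊢
    intro i
    refine ⟨Int.ediv_nonneg (hf.1 i).1 hp0.le, Int.ediv_lt_of_lt_mul hp0 ?_⟩
    have := (hf.1 i).2; rw [sq] at this; exact this
  · intro f hf g hg he
    simp only [Finset.coe_filter, Set.mem_ofPred_eq] at hf hg
    ext i
    have := congrFun he i
    simp only at this
    rw [← Int.ediv_mul_cancel (hf.2 i), ← Int.ediv_mul_cancel (hg.2 i), this]

open Classical in
theorem cnt_BadAt10 {p : ℤ} (hp0 : 0 < p) :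
    cnt (p ^ 2) (fun f => BadAt p f 1 0) ≤ p.toNat ^ 5 := by
  let I := Finset.Ico 0 (p ^ 2)
  have : (I ×ˢ I ×ˢ Finset.Ico 0 p).card = p.toNat ^ 5 := by
    have h2 : (p ^ 2).toNat = p.toNat ^ 2 := Int.toNat_pow_of_nonneg hp0.le 2
    simp [I, h2]; ring
  rw [← this, cnt]
  refine Finset.card_le_card_of_injOn (fun f => (f 2, f 3, f 1 / p)) ?_ ?_
  · intro f hf
    simp only [Finset.coe_filter, Set.mem_ofPred_eq, mem_gBox0, Finset.coe_product, Set.mem_prod, Finset.mem_coe, I, Finset.mem_Ico] at hf ⊢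
    refine ⟨hf.1 2, hf.1 3, Int.ediv_nonneg (hf.1 1).1 hp0.le, Int.ediv_lt_of_lt_mul hp0 ?_⟩
    have := (hf.1 1).2; rw [sq] at this; exact this
  · intro f hf g hg he
    simp only [Finset.coe_filter, Set.mem_ofPred_eq, mem_gBox0, Prod.mk.injEq] at hf hg he
    have key : ∀ f : Fin 4 → ℤ, ((∀ i, 0 ≤ f i ∧ f i < p ^ 2) ∧ BadAt p f 1 0) → f 0 = 0 ∧ p ∣ f 1 := by
      rintro f ⟨h1, h2, h3, h4⟩
      simp [bcfEv] at h2 h4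
      exact ⟨Int.eq_zero_of_abs_lt_dvd h2 (by rw [abs_of_nonneg (h1 0).1]; exact (h1 0).2), h4⟩
    have k1 := key f hf
    have k2 := key g hg
    ext i
    fin_cases i
    · exact k1.1.trans k2.1.symm
    · change f 1 = g 1
      rw [← Int.ediv_mul_cancel k1.2, ← Int.ediv_mul_cancel k2.2, he.2.2]
    · exact he.1
    · exact he.2.1

open Classical in
theorem cnt_BadAt1 {p t : ℤ} (hp0 : 0 < p) :
    cnt (p ^ 2) (fun f => BadAt p f t 1) ≤ p.toNat ^ 5 := by
  let I := Finset.Ico 0 (p ^ 2)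
  have : (I ×ˢ I ×ˢ Finset.Ico 0 p).card = p.toNat ^ 5 := by
    have h2 : (p ^ 2).toNat = p.toNat ^ 2 := Int.toNat_pow_of_nonneg hp0.le 2
    simp [I, h2]; ring
  rw [← this, cnt]
  refine Finset.card_le_card_of_injOn (fun f => (f 0, f 1, f 2 / p)) ?_ ?_
  · intro f hf
    simp only [Finset.coe_filter, Set.mem_ofPred_eq, mem_gBox0, Finset.coe_product, Set.mem_prod, Finset.mem_coe, I, Finset.mem_Ico] at hf ⊢
    refine ⟨hf.1 0, hf.1 1, Int.ediv_nonneg (hf.1 2).1 hp0.le, Int.ediv_lt_of_lt_mul hp0 ?_⟩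
    have := (hf.1 2).2; rw [sq] at this; exact this
  · intro f hf g hg he
    simp only [Finset.coe_filter, Set.mem_ofPred_eq, mem_gBox0, Prod.mk.injEq] at hf hg he
    obtain ⟨hf1, hf2, hf3, -⟩ := hf
    obtain ⟨hg1, hg2, hg3, -⟩ := hg
    obtain ⟨h0, h1, h2⟩ := he
    have e2 : f 2 = g 2 := by
      have h4 : p ∣ f 2 - g 2 := by
        have := dvd_sub hf3 hg3
        rw [h0, h1] at this
        have e : f 2 - g 2 = 3 * g 0 * t ^ 2 + 2 * g 1 * t * 1 + f 2 * 1 ^ 2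
          - (3 * g 0 * t ^ 2 + 2 * g 1 * t * 1 + g 2 * 1 ^ 2) := by ring
        rw [e]; exact this
      have h6 : f 2 % p = g 2 % p := Int.emod_eq_emod_iff_emod_sub_eq_zero.2 (Int.emod_eq_zero_of_dvd h4)
      rw [← Int.mul_ediv_add_emod (f 2) p, ← Int.mul_ediv_add_emod (g 2) p, h2, h6]
    have e3 : f 3 = g 3 := by
      have h4 : p ^ 2 ∣ f 3 - g 3 := by
        have := dvd_sub hf2 hg2
        simp only [bcfEv] at this
        rw [h0, h1, e2] at this
        have e : f 3 - g 3 = g 0 * t ^ 3 + g 1 * t ^ 2 * 1 + g 2 * t * 1 ^ 2 + f 3 * 1 ^ 3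
          - (g 0 * t ^ 3 + g 1 * t ^ 2 * 1 + g 2 * t * 1 ^ 2 + g 3 * 1 ^ 3) := by ring
        rw [e]; exact this
      have h6 := Int.emod_eq_emod_iff_emod_sub_eq_zero.2 (Int.emod_eq_zero_of_dvd h4)
      rwa [Int.emod_eq_of_lt (hf1 3).1 (hf1 3).2, Int.emod_eq_of_lt (hg1 3).1 (hg1 3).2] at h6
    ext i
    fin_cases i
    · exact h0
    · exact h1
    · exact e2
    · exact e3

open Classical in
theorem cnt_Bad {p : ℕ} (hp : p.Prime) : cnt ((p : ℤ) ^ 2) (Bad p) ≤ 3 * p ^ 6 := by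
  have hpp : Prime (p : ℤ) := Nat.prime_iff_prime_int.1 hp
  have hp0 : (0 : ℤ) < p := by exact_mod_cast hp.pos
  have hsub : (gBox 0 ((p : ℤ) ^ 2)).filter (Bad p) ⊆
      ((gBox 0 ((p : ℤ) ^ 2)).filter (BadC p) ∪ (gBox 0 ((p : ℤ) ^ 2)).filter (fun f => BadAt p f 1 0)) ∪
      (Finset.Ico (0 : ℤ) p).biUnion fun t => (gBox 0 ((p : ℤ) ^ 2)).filter (fun f => BadAt p f t 1) := by
    intro f hf
    rw [Finset.mem_filter] at hf
    have := hf.2.cases hpp hp0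
    simp only [Finset.mem_union, Finset.mem_biUnion, Finset.mem_filter]
    rcases this with h | h | ⟨t, ht, h⟩
    · exact Or.inl (Or.inl ⟨hf.1, h⟩)
    · exact Or.inl (Or.inr ⟨hf.1, h⟩)
    · exact Or.inr ⟨t, ht, hf.1, h⟩
  have h1 := cnt_BadC hp0
  have h2 := cnt_BadAt10 hp0
  have h3 : ((Finset.Ico (0 : ℤ) p).biUnion fun t => (gBox 0 ((p : ℤ) ^ 2)).filter
      (fun f => BadAt p f t 1)).card ≤ p * p ^ 5 := by
    refine (Finset.card_biUnion_le_card_mul _ _ (p ^ 5) fun t _ => ?_).trans (by simp)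
    have := cnt_BadAt1 (t := t) hp0
    simpa [cnt] using this
  simp only [Int.toNat_natCast] at h1 h2
  have h4 := (Finset.card_le_card hsub).trans (Finset.card_union_le _ _)
  have h5 := Finset.card_union_le ((gBox 0 ((p : ℤ) ^ 2)).filter (BadC p)) ((gBox 0 ((p : ℤ) ^ 2)).filter (fun f => BadAt p f 1 0))
  rw [cnt] at *
  have h6 : p ^ 4 ≤ p ^ 6 := Nat.pow_le_pow_right hp.pos (by norm_num)
  have h7 : p ^ 5 ≤ p ^ 6 := Nat.pow_le_pow_right hp.pos (by norm_num)
  have h8 : p * p ^ 5 = p ^ 6 := by ring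
  lia

/-- Eisenstein condition at `p` with center `t` -/
def EisAt (p : ℤ) (f : Fin 4 → ℤ) (t σ : ℤ) : Prop :=
  ¬ p ∣ f 0 ∧ p ∣ f 1 - 3 * f 0 * t ∧ p ∣ f 2 - 2 * f 1 * t + 3 * f 0 * t ^ 2 ∧
    p ^ 2 ∣ f 0 * (f 3 - f 2 * t + f 1 * t ^ 2 - f 0 * t ^ 3) - σ * p

/-- Eisenstein condition at `p` -/
def Eis (p : ℤ) (f : Fin 4 → ℤ) : Prop := ∃ t σ : ℤ, (σ = 1 ∨ σ = -1) ∧ EisAt p f t σ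

theorem EisAt.per {p t σ : ℤ} : Per (p ^ 2) (fun f => EisAt p f t σ) := by
  intro f f' h hf
  have h1 : ∀ i, ∃ k, f' i = f i + p ^ 2 * k := by
    intro i
    obtain ⟨k, hk⟩ := (Int.modEq_iff_dvd.1 (h i))
    exact ⟨k, by linarith⟩
  choose k hk using h1
  obtain ⟨hn, ⟨a, ha⟩, ⟨b, hb⟩, ⟨c, hc⟩⟩ := hf
  refine ⟨?_, ⟨a + p * (k 1 - 3 * k 0 * t), ?_⟩, ⟨b + p * (k 2 - 2 * k 1 * t + 3 * k 0 * t ^ 2), ?_⟩,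
    ⟨c + f 0 * (k 3 - k 2 * t + k 1 * t ^ 2 - k 0 * t ^ 3)
      + k 0 * (f' 3 - f' 2 * t + f' 1 * t ^ 2 - f' 0 * t ^ 3), ?_⟩⟩
  · intro h0
    apply hn
    rw [hk 0] at h0
    exact (dvd_add_left (Dvd.intro (p * k 0) (by ring))).1 h0
  · simp only [hk]; linear_combination ha
  · simp only [hk]; linear_combination hb
  · simp only [hk]; linear_combination hc

theorem Eis.per {p : ℤ} : Per (p ^ 2) (Eis p) := by
  intro f f' h hf
  obtain ⟨t, σ, hσ, hf⟩ := hf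
  exact ⟨t, σ, hσ, EisAt.per f f' h hf⟩

theorem Eis.disc {p : ℤ} {f : Fin 4 → ℤ} (h : Eis p f) (hp : Prime p) : p ^ 3 ∣ bcfD f + 27 * p ^ 2 := by
  obtain ⟨t, σ, hσ, hn, ⟨b, hb⟩, ⟨c, hc⟩, ⟨k, hk⟩⟩ := h
  have h3 : p ∣ f 3 - f 2 * t + f 1 * t ^ 2 - f 0 * t ^ 3 := by
    refine (hp.dvd_or_dvd (a := f 0) ⟨p * k + σ, ?_⟩).resolve_left hn
    linear_combination hk
  obtain ⟨d, hd⟩ := h3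
  have hD : bcfD f = bcfDisc (f 0) (f 1 - 3 * f 0 * t) (f 2 - 2 * f 1 * t + 3 * f 0 * t ^ 2)
      (f 3 - f 2 * t + f 1 * t ^ 2 - f 0 * t ^ 3) := by
    unfold bcfD bcfDisc; ring
  rw [hD, hb, hc, hd]
  rw [hd] at hk
  have hσ2 : σ ^ 2 = 1 := by rcases hσ with rfl | rfl <;> norm_num
  refine ⟨p * b ^ 2 * c ^ 2 - 4 * f 0 * c ^ 3 - 4 * p * b ^ 3 * d + 18 * f 0 * b * c * d
    - 27 * (2 * σ * k + p * k ^ 2), ?_⟩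
  unfold bcfDisc
  linear_combination (-27) * (f 0 * (p * d) + σ * p + p ^ 2 * k) * hk - 27 * p ^ 2 * hσ2

theorem Eis.prim {p : ℤ} {f : Fin 4 → ℤ} (h : Eis p f) (hp : Prime p) {u v : ℤ}
    (huv : p ^ 2 ∣ bcfEv f u v) : p ∣ u ∧ p ∣ v := by
  obtain ⟨t, σ, hσ, hn, ⟨b, hb⟩, ⟨c, hc⟩, ⟨k, hk⟩⟩ := h
  have h3 : p ∣ f 3 - f 2 * t + f 1 * t ^ 2 - f 0 * t ^ 3 := by
    refine (hp.dvd_or_dvd (a := f 0) ⟨p * k + σ, ?_⟩).resolve_left hn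
    linear_combination hk
  obtain ⟨d, hd⟩ := h3
  obtain ⟨e, he⟩ := huv
  have hE : bcfEv f u v = f 0 * (u + t * v) ^ 3 + p * b * (u + t * v) ^ 2 * v + p * c * (u + t * v) * v ^ 2
      + p * d * v ^ 3 := by
    rw [← hb, ← hc, ← hd]; unfold bcfEv; ring
  rw [hE] at he
  have h1 : p ∣ u + t * v := by
    refine hp.dvd_of_dvd_pow (n := 3) ((hp.dvd_or_dvd (a := f 0) ⟨p * e - b * (u + t * v) ^ 2 * v
      - c * (u + t * v) * v ^ 2 - d * v ^ 3, ?_⟩).resolve_left hn)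
    linear_combination he
  obtain ⟨w, hw⟩ := h1
  rw [hw] at he
  have hd' : ¬ p ∣ d := by
    rintro ⟨d', rfl⟩
    rw [hd] at hk
    have : p * (p * (f 0 * d' - k)) = p * σ := by linear_combination hk
    have := mul_left_cancel₀ hp.ne_zero this
    have : p ∣ 1 := by
      rcases hσ with rfl | rfl
      · exact ⟨_, this.symm⟩
      · exact ⟨-(f 0 * d' - k), by linear_combination this⟩
    exact hp.not_isUnit (isUnit_of_dvd_one this)
  have hv : p ∣ v := by
    refine hp.dvd_of_dvd_pow (n := 3) ((hp.dvd_or_dvd (a := d) ⟨e - f 0 * p * w ^ 3 - p * b * w ^ 2 * v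
      - c * w * v ^ 2, ?_⟩).resolve_left hd')
    apply mul_left_cancel₀ hp.ne_zero
    linear_combination he
  refine ⟨?_, hv⟩
  have : u = p * w - t * v := by linarith
  rw [this]
  exact dvd_sub (Dvd.intro _ rfl) (hv.mul_left _)

theorem Eis.not_bad {p : ℤ} {f : Fin 4 → ℤ} (h : Eis p f) (hp : Prime p) : ¬ Bad p f := by
  rintro (hb | ⟨u, v, huv, hb, -⟩)
  · obtain ⟨t, σ, hσ, hn, -⟩ := h
    exact hn (hb 0)
  · exact huv (h.prim hp hb)

theorem Eis.aniso {p : ℤ} {f : Fin 4 → ℤ} (h : Eis p f) (hp : Prime p) (u v : ℤ)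
    (h0 : bcfEv f u v = 0) : u = 0 ∧ v = 0 := by
  by_contra hne
  have hg : 0 < Int.gcd u v := by
    rw [Int.gcd_pos_iff]; tauto
  obtain ⟨x, y, hco, hx, hy⟩ := Int.exists_gcd_one hg
  have hg1 : (Int.gcd u v : ℤ) ≠ 0 := by exact_mod_cast hg.ne'
  have h1 : (Int.gcd u v : ℤ) ^ 3 * bcfEv f x y = 0 := by
    rw [← h0]
    nth_rw 2 [hx]
    nth_rw 3 [hy]
    unfold bcfEv; ring
  have h2 := (mul_eq_zero.1 h1).resolve_left (pow_ne_zero 3 hg1)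
  obtain ⟨h3, h4⟩ := h.prim hp (u := x) (v := y) (by rw [h2]; exact dvd_zero _)
  have := (Int.isCoprime_iff_gcd_eq_one.2 hco)
  exact hp.not_isUnit (this.isUnit_of_dvd' h3 h4)

theorem eis_param {p : ℤ} (a t b c σ a' : ℤ) (hσ : σ = 1 ∨ σ = -1) (ha : ¬ p ∣ a) (h : p ^ 2 ∣ a * a' - 1) :
    Eis p ![a, p * b + 3 * a * t, p * c + 2 * p * b * t + 3 * a * t ^ 2,
      σ * p * a' + p * c * t + p * b * t ^ 2 + a * t ^ 3] := by
  refine ⟨t, σ, hσ, ?_, ?_, ?_, ?_⟩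
  · simpa using ha
  · refine ⟨b, ?_⟩; simp
  · refine ⟨c, ?_⟩; simp; ring
  · obtain ⟨k, hk⟩ := h
    refine ⟨k * σ * p, ?_⟩
    simp
    linear_combination σ * p * hk

theorem count_units {p : ℕ} (hp : p.Prime) :
    ((Finset.Ico (0 : ℤ) (p ^ 2)).filter fun x => ¬ (p : ℤ) ∣ x).card = p * (p - 1) := by
  have h1 := Finset.card_filter_add_card_filter_not (s := Finset.Ico (0 : ℤ) ((p : ℤ) ^ 2)) (fun x => (p : ℤ) ∣ x)
  have hp0 : (0 : ℤ) < p := by exact_mod_cast hp.pos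
  have h2 := class_count (a := 0) (n := p) (q := p) (v := 0) hp0 hp0.le
  simp only [Int.modEq_zero_iff_dvd, zero_add, ← sq] at h2
  have h3 : ((Finset.Ico (0 : ℤ) ((p : ℤ) ^ 2)).card : ℤ) = (p : ℤ) ^ 2 := by
    rw [Int.card_Ico, Int.toNat_of_nonneg] <;> simp
  have h4 : ((p * (p - 1) : ℕ) : ℤ) = (p : ℤ) ^ 2 - p := by
    have := hp.one_le
    push_cast [this]; ring
  zify at h1
  rw [← Int.natCast_inj, h4]
  lia

open Classical in
theorem cnt_Eis {p : ℕ} (hp : p.Prime) (hp5 : 5 ≤ p) : 2 * p ^ 4 * (p - 1) ≤ cnt ((p : ℤ) ^ 2) (Eis p) := by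
  have hpp : Prime (p : ℤ) := Nat.prime_iff_prime_int.1 hp
  have hp0 : (0 : ℤ) < p := by exact_mod_cast hp.pos
  have hp2 : (0 : ℤ) < (p : ℤ) ^ 2 := by positivity
  have hinv : ∀ a : ℤ, ∃ a' : ℤ, ¬ (p : ℤ) ∣ a → (p : ℤ) ^ 2 ∣ a * a' - 1 := by
    intro a
    by_cases ha : (p : ℤ) ∣ a
    · exact ⟨0, fun h => absurd ha h⟩
    · obtain ⟨x, y, hxy⟩ : IsCoprime ((p : ℤ) ^ 2) a := ((hpp.coprime_iff_not_dvd).2 ha).pow_left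
      exact ⟨y, fun _ => ⟨-x, by linear_combination hxy⟩⟩
  choose inv hinv using hinv
  let A := (Finset.Ico (0 : ℤ) (p ^ 2)).filter fun x => ¬ (p : ℤ) ∣ x
  let I := Finset.Ico (0 : ℤ) p
  let J : Finset ℤ := {1, -1}
  have hcard : (A ×ˢ I ×ˢ I ×ˢ I ×ˢ J).card = 2 * p ^ 4 * (p - 1) := by
    have hA : A.card = p * (p - 1) := count_units hp
    simp only [Finset.card_product, hA, I, J, Int.card_Ico]
    simp; ring
  rw [← hcard, cnt]
  let φ : ℤ × ℤ × ℤ × ℤ × ℤ → Fin 4 → ℤ := fun q =>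
    ![q.1, p * q.2.2.1 + 3 * q.1 * q.2.1, p * q.2.2.2.1 + 2 * p * q.2.2.1 * q.2.1 + 3 * q.1 * q.2.1 ^ 2,
      q.2.2.2.2 * p * inv q.1 + p * q.2.2.2.1 * q.2.1 + p * q.2.2.1 * q.2.1 ^ 2 + q.1 * q.2.1 ^ 3]
  refine Finset.card_le_card_of_injOn (fun q i => φ q i % (p : ℤ) ^ 2) ?_ ?_
  · rintro ⟨a, t, b, c, σ⟩ hq
    simp only [Finset.coe_filter, Set.mem_ofPred_eq, mem_gBox0, Finset.coe_product, Set.mem_prod, Finset.mem_coe,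
      I, J, A, Finset.mem_Ico, Finset.mem_filter, Finset.mem_insert, Finset.mem_singleton] at hq ⊢
    refine ⟨fun i => ⟨Int.emod_nonneg _ hp2.ne', Int.emod_lt_of_pos _ hp2⟩, ?_⟩
    refine Eis.per (φ (a, t, b, c, σ)) _ (fun i => (Int.mod_modEq _ _).symm) ?_
    exact eis_param a t b c σ (inv a) hq.2.2.2.2 hq.1.2 (hinv a hq.1.2)
  · rintro ⟨a, t, b, c, σ⟩ hq ⟨a', t', b', c', σ'⟩ hq' he
    simp only [Finset.coe_filter, Set.mem_ofPred_eq, Finset.coe_product, Set.mem_prod, Finset.mem_coe,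
      I, J, A, Finset.mem_Ico, Finset.mem_filter, Finset.mem_insert, Finset.mem_singleton] at hq hq'
    have heq : ∀ i, (p : ℤ) ^ 2 ∣ φ (a, t, b, c, σ) i - φ (a', t', b', c', σ') i := by
      intro i
      have := congrFun he i
      exact (Int.modEq_iff_dvd.1 (Int.ModEq.symm this))
    have e0 := heq 0
    have e1 := heq 1
    have e2 := heq 2
    have e3 := heq 3
    simp only [φ, Matrix.cons_val_zero, Matrix.cons_val_one, Matrix.cons_val] at e0 e1 e2 e3
    obtain ⟨⟨⟨a1, a2⟩, a3⟩, ⟨t1, t2⟩, ⟨b1, b2⟩, ⟨c1, c2⟩, hσ⟩ := hq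
    obtain ⟨⟨⟨a1', a2'⟩, a3'⟩, ⟨t1', t2'⟩, ⟨b1', b2'⟩, ⟨c1', c2'⟩, hσ'⟩ := hq'
    have ha : a = a' := by
      have := Int.eq_zero_of_abs_lt_dvd e0 (by rw [abs_lt]; lia)
      lia
    subst ha
    have h3a : ¬ (p : ℤ) ∣ 3 * a := by
      intro h
      rcases hpp.dvd_or_dvd h with h | h
      · have := Int.le_of_dvd (by norm_num) h
        lia
      · exact a3 h
    have hpd : (p : ℤ) ∣ (p : ℤ) ^ 2 := dvd_pow_self _ two_ne_zero
    have ht : t = t' := by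
      obtain ⟨k, hk⟩ := hpd.trans e1
      have h1 : (p : ℤ) ∣ t - t' := by
        refine (hpp.dvd_or_dvd (a := 3 * a) ⟨k - b + b', ?_⟩).resolve_left h3a
        linear_combination hk
      have := Int.eq_zero_of_abs_lt_dvd h1 (by rw [abs_lt]; lia)
      lia
    subst ht
    have hb : b = b' := by
      obtain ⟨k, hk⟩ := e1
      have h1 : (p : ℤ) ∣ b - b' := ⟨k, by
        apply mul_left_cancel₀ hp0.ne'
        linear_combination hk⟩
      have := Int.eq_zero_of_abs_lt_dvd h1 (by rw [abs_lt]; lia)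
      lia
    subst hb
    have hc : c = c' := by
      obtain ⟨k, hk⟩ := e2
      have h1 : (p : ℤ) ∣ c - c' := ⟨k, by
        apply mul_left_cancel₀ hp0.ne'
        linear_combination hk⟩
      have := Int.eq_zero_of_abs_lt_dvd h1 (by rw [abs_lt]; lia)
      lia
    subst hc
    have hs : σ = σ' := by
      obtain ⟨k, hk⟩ := e3
      obtain ⟨l, hl⟩ := hinv a a3
      have h1 : (p : ℤ) ∣ σ - σ' := by
        refine ⟨a * k - (σ - σ') * p * l, ?_⟩
        apply mul_left_cancel₀ hp0.ne'
        linear_combination a * hk - (σ - σ') * p * hl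
      have := Int.eq_zero_of_abs_lt_dvd h1 (by rw [abs_lt]; lia)
      lia
    subst hs
    rfl

theorem tail_small {f : ℕ → ℝ} (hf : Summable f) {ε : ℝ} (hε : 0 < ε) (z₀ : ℕ) :
    ∃ z : ℕ, z₀ ≤ z ∧ ∀ t : Finset ℕ, (∀ n ∈ t, z < n) → ∑ n ∈ t, f n ≤ ε := by
  obtain ⟨S, hS⟩ := summable_iff_vanishing_norm.1 hf ε hε
  refine ⟨max z₀ (S.sup id), le_max_left _ _, fun t ht => ?_⟩
  have hd : Disjoint t S := by
    rw [Finset.disjoint_left]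
    intro n hn hnS
    have h1 := ht n hn
    have h2 : n ≤ S.sup id := Finset.le_sup (f := id) hnS
    have h3 := le_max_right z₀ (S.sup id)
    omega
  exact (le_abs_self _).trans (hS t hd).le

theorem fBox_disc_bd {s T : ℤ} (hs : s = 1 ∨ s = -1) {f : Fin 4 → ℤ} (h : f ∈ fBox s T) :
    s * bcfD f ≤ 54 * 101 ^ 4 * T ^ 4 := by
  have hB := fun i => (fBox_abs hs h i).1
  have hT := (fBox_abs hs h 0).2
  have hB0 : 0 ≤ 101 * T := by linarith
  have h4 : ∀ i j k l : Fin 4, |f i * f j * (f k * f l)| ≤ (101 * T) * (101 * T) * ((101 * T) * (101 * T)) := by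
    intro i j k l
    rw [abs_mul, abs_mul, abs_mul]
    gcongr <;> exact hB _
  have e1 := abs_le.1 (h4 1 1 2 2)
  have e2 := abs_le.1 (h4 0 2 2 2)
  have e3 := abs_le.1 (h4 1 1 1 3)
  have e4 := abs_le.1 (h4 0 0 3 3)
  have e5 := abs_le.1 (h4 0 1 2 3)
  have hD : bcfD f = f 1 * f 1 * (f 2 * f 2) - 4 * (f 0 * f 2 * (f 2 * f 2))
    - 4 * (f 1 * f 1 * (f 1 * f 3)) - 27 * (f 0 * f 0 * (f 3 * f 3)) + 18 * (f 0 * f 1 * (f 2 * f 3)) := by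
    unfold bcfD bcfDisc; ring
  have hR : 54 * 101 ^ 4 * T ^ 4 = 54 * ((101 * T) * (101 * T) * ((101 * T) * (101 * T))) := by ring
  rw [hD, hR]
  rcases hs with rfl | rfl <;> linarith [e1.1, e1.2, e2.1, e2.2, e3.1, e3.2, e4.1, e4.2, e5.1, e5.2]

theorem fBox_disc_pos {s T : ℤ} (hs : s = 1 ∨ s = -1) {f : Fin 4 → ℤ} (h : f ∈ fBox s T) :
    0 < s * bcfD f := by
  rcases hs with rfl | rfl
  · obtain ⟨a0, a1, b0, b1, c0, c1, d0, d1, hT⟩ := mem_fBox_one h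
    have hD : bcfD f = f 1 * f 1 * (f 2 * f 2) - 4 * (f 0 * f 2 * (f 2 * f 2))
      - 4 * (f 1 * f 1 * (f 1 * f 3)) - 27 * (f 0 * f 0 * (f 3 * f 3)) + 18 * (f 0 * f 1 * (f 2 * f 3)) := by
      unfold bcfD bcfDisc; ring
    have hb : 0 ≤ f 1 := by linarith
    have hc : 0 ≤ f 2 := by linarith
    have h1 : (100 * T) * (100 * T) * ((100 * T) * (100 * T)) ≤ f 1 * f 1 * (f 2 * f 2) := by gcongr
    have h2 : f 0 * f 2 * (f 2 * f 2) ≤ T * (101 * T) * ((101 * T) * (101 * T)) := by gcongr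
    have h3 : f 1 * f 1 * (f 1 * f 3) ≤ (101 * T) * (101 * T) * ((101 * T) * T) := by gcongr
    have h4 : f 0 * f 0 * (f 3 * f 3) ≤ T * T * (T * T) := by gcongr
    have h5 : 0 ≤ f 0 * f 1 * (f 2 * f 3) := by positivity
    have hp : 0 < T ^ 4 := by positivity
    rw [hD]; ring_nf at h1 h2 h3 h4 h5 ⊢; linarith
  · obtain ⟨a0, a1, b0, b1, c0, c1, d0, d1, hT⟩ := mem_fBox_neg h
    have hD : bcfD f = f 1 * f 1 * (f 2 * f 2) - 4 * (f 0 * f 2 * (f 2 * f 2))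
      - 4 * (f 1 * f 1 * (f 1 * f 3)) - 27 * (f 0 * f 0 * (f 3 * f 3)) + 18 * (f 0 * f 1 * (f 2 * f 3)) := by
      unfold bcfD bcfDisc; ring
    have hb : 0 ≤ f 0 := by linarith
    have hc : 0 ≤ f 3 := by linarith
    have h1 : (100 * T) * (100 * T) * ((100 * T) * (100 * T)) ≤ f 0 * f 0 * (f 3 * f 3) := by gcongr
    have h2 : 0 ≤ f 0 * f 2 * (f 2 * f 2) := by positivity
    have h3 : 0 ≤ f 1 * f 1 * (f 1 * f 3) := by positivity
    have h4 : f 1 * f 1 * (f 2 * f 2) ≤ T * T * (T * T) := by gcongr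
    have h5 : f 0 * f 1 * (f 2 * f 3) ≤ (101 * T) * T * (T * (101 * T)) := by gcongr
    have hp : 0 < T ^ 4 := by positivity
    rw [hD]; ring_nf at h1 h2 h3 h4 h5 ⊢; linarith

theorem local_one (s : ℤ) (hs : s = 1 ∨ s = -1) (k : ℕ) (qq : ℕ → ℕ) (hqi : Function.Injective qq)
    (hq : ∀ i, k + 6 < qq i) (q : ℕ) (hp : q.Prime) :
    ∃ a : ℕ, ¬ (q : ℤ) ∣ 1 - 4 * a ∧ (q = 5 → 5 ∣ a) ∧
      ∀ i : ℕ, 2 ≤ i → i ≤ k → q = qq i → (q : ℤ) ^ 3 ∣ 1 - 4 * a + s * (i - 1) := by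
  by_cases hex : ∃ i : ℕ, 2 ≤ i ∧ i ≤ k ∧ q = qq i
  · obtain ⟨i, h2, hik, rfl⟩ := hex
    have hbig := hq i
    have hco : IsCoprime (4 : ℤ) ((qq i : ℤ) ^ 3) := by
      apply IsCoprime.pow_right
      have : Nat.Coprime 4 (qq i) := by
        refine ((Nat.Prime.coprime_iff_not_dvd hp).2 fun h => ?_).symm
        have := Nat.le_of_dvd (by norm_num) h
        omega
      exact_mod_cast Nat.isCoprime_iff_coprime.2 this
    obtain ⟨u, v, huv⟩ := hco
    have hpos : (0 : ℤ) < (qq i : ℤ) ^ 3 := by have := hp.pos; positivity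
    set a : ℤ := u * (1 + s * (i - 1)) % (qq i : ℤ) ^ 3 with ha
    have ha0 : 0 ≤ a := Int.emod_nonneg _ hpos.ne'
    have hdiv : (qq i : ℤ) ^ 3 ∣ 1 - 4 * a + s * (i - 1) := by
      have h1 : a = u * (1 + s * (i - 1)) - (qq i : ℤ) ^ 3 * (u * (1 + s * (i - 1)) / (qq i : ℤ) ^ 3) := by
        rw [ha, Int.emod_def]
      rw [h1]
      refine ⟨v * (1 + s * (i - 1)) + 4 * (u * (1 + s * (i - 1)) / (qq i : ℤ) ^ 3), ?_⟩
      linear_combination (-(1 + s * ((i : ℤ) - 1))) * huv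
    refine ⟨a.toNat, ?_, ?_, ?_⟩
    · rw [Int.toNat_of_nonneg ha0]
      intro h
      have h3 : (qq i : ℤ) ∣ s * (i - 1) := by
        have := (dvd_pow_self (qq i : ℤ) (by norm_num : 3 ≠ 0)).trans hdiv
        exact (dvd_add_right h).1 this
      have h4 : (qq i : ℤ) ∣ (i - 1) := by
        rcases hs with rfl | rfl
        · simpa using h3
        · have := (dvd_neg (a := (qq i : ℤ))).2 h3
          simpa using this
      have := Int.le_of_dvd (by omega) h4
      omega
    · intro h; omega
    · intro j h2 hj hij
      have : i = j := hqi hij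
      subst this
      rw [Int.toNat_of_nonneg ha0]
      exact hdiv
  · refine ⟨0, ?_, fun _ => dvd_zero _, fun i h2 h3 h4 => (hex ⟨i, h2, h3, h4⟩).elim⟩
    simp only [Nat.cast_zero, mul_zero, sub_zero]
    intro h
    exact (Nat.prime_iff_prime_int.1 hp).not_isUnit (isUnit_of_dvd_one h)

theorem local_data (s : ℤ) (hs : s = 1 ∨ s = -1) (k : ℕ) :
    ∃ (z Q : ℕ) (d0 : ℤ), 5 ≤ z ∧ 0 < Q ∧ (∀ q : ℕ, q.Prime → q ≤ z → q ∣ Q ∧ ¬ (q : ℤ) ∣ 1 - 4 * d0) ∧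
      (∀ q : ℕ, q.Prime → q ∣ Q → q ≤ z) ∧ (5 : ℤ) ∣ d0 ∧
      (∀ i : ℕ, 2 ≤ i → i ≤ k → ∃ q : ℕ, q.Prime ∧ 5 ≤ q ∧ (q : ℤ) ^ 3 ∣ Q ∧
        (q : ℤ) ^ 3 ∣ 1 - 4 * d0 + s * (i - 1)) ∧
      ∀ t : Finset ℕ, (∀ n ∈ t, z < n) → ∑ n ∈ t, 3 * (1 / (n : ℝ) ^ 2) ≤ 1 / 4 := by
  set qq : ℕ → ℕ := fun i => Nat.nth Nat.Prime (k + 5 + i) with hqq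
  have hqi : Function.Injective qq := by
    intro i j h
    have := Nat.nth_injective Nat.infinite_setOfPred_prime h
    omega
  have hqp : ∀ i, (qq i).Prime := fun i => Nat.prime_nth_prime _
  have hq : ∀ i, k + 6 < qq i := fun i => by
    have : k + 5 + i + 2 ≤ qq i := Nat.add_two_le_nth_prime _
    omega
  have hsum : Summable fun n : ℕ => 3 * (1 / (n : ℝ) ^ 2) :=
    (Real.summable_one_div_nat_pow.2 (by norm_num)).mul_left 3
  obtain ⟨z, hz, hz4⟩ := tail_small hsum (ε := 1 / 4) (by norm_num) (5 + (Finset.range (k + 1)).sup qq)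
  choose a ha1 ha2 ha3 using fun q : Subtype Nat.Prime => local_one s hs k qq hqi hq q.1 q.2
  set P := (Finset.range (z + 1)).filter Nat.Prime with hP
  have hPm : ∀ q, q ∈ P ↔ q.Prime ∧ q ≤ z := fun q => by
    simp only [hP, Finset.mem_filter, Finset.mem_range, Nat.lt_succ_iff]; exact and_comm
  set a' : ℕ → ℕ := fun q => if h : q.Prime then a ⟨q, h⟩ else 0 with ha'
  have hco : Set.Pairwise (P : Set ℕ) (Function.onFun Nat.Coprime fun q => q ^ 3) := by
    intro x hx y hy hxy
    exact ((Nat.coprime_primes ((hPm x).1 hx).1 ((hPm y).1 hy).1).2 hxy).pow 3 3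
  obtain ⟨d0, hd0⟩ := Nat.chineseRemainderOfFinset a' (fun q => q ^ 3) P
    (fun q hq => pow_ne_zero _ ((hPm q).1 hq).1.ne_zero) hco
  have hdd : ∀ q (hqp : q.Prime), q ≤ z → (q : ℤ) ^ 3 ∣ (d0 : ℤ) - a ⟨q, hqp⟩ := by
    intro q hqp hqz
    have h := hd0 q ((hPm q).2 ⟨hqp, hqz⟩)
    simp only [ha', hqp, dif_pos] at h
    have := (Nat.modEq_iff_dvd.1 h.symm)
    exact_mod_cast this
  have hqz : ∀ i, i ≤ k → qq i ≤ z := by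
    intro i hi
    have : qq i ≤ (Finset.range (k + 1)).sup qq := Finset.le_sup (f := qq) (by simp; omega)
    omega
  have hQd : ∀ q : ℕ, q.Prime → q ≤ z → q ^ 3 ∣ ∏ q ∈ P, q ^ 3 := by
    intro q h1 h2
    exact Finset.dvd_prod_of_mem (fun q => q ^ 3) ((hPm q).2 ⟨h1, h2⟩)
  refine ⟨z, ∏ q ∈ P, q ^ 3, d0, by omega, ?_, ?_, ?_, ?_, ?_, hz4⟩
  · exact Finset.prod_pos fun q hq => pow_pos ((hPm q).1 hq).1.pos _
  · intro q h1 h2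
    refine ⟨(dvd_pow_self q (by norm_num)).trans (hQd q h1 h2), fun h => ha1 ⟨q, h1⟩ ?_⟩
    have h3 := (dvd_pow_self (q : ℤ) (by norm_num : 3 ≠ 0)).trans (hdd q h1 h2)
    have := dvd_add h (h3.mul_left 4)
    have e : (1 : ℤ) - 4 * d0 + 4 * (d0 - a ⟨q, h1⟩) = 1 - 4 * a ⟨q, h1⟩ := by ring
    rwa [e] at this
  · intro q h1 h2
    obtain ⟨x, hx, hx2⟩ := (Prime.dvd_finsetProd_iff h1.prime _).1 h2
    have h3 := h1.dvd_of_dvd_pow hx2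
    have := (Nat.prime_dvd_prime_iff_eq h1 ((hPm x).1 hx).1).1 h3
    rw [this]; exact ((hPm x).1 hx).2
  · have h5 : Nat.Prime 5 := by norm_num
    have h3 := (dvd_pow_self (5 : ℤ) (by norm_num : 3 ≠ 0)).trans (hdd 5 h5 (by omega))
    have h4 := ha2 ⟨5, h5⟩ rfl
    have h4' : (5 : ℤ) ∣ (a ⟨5, h5⟩ : ℤ) := by exact_mod_cast h4
    exact (dvd_sub_left h4').1 h3
  · intro i h2 hi
    refine ⟨qq i, hqp i, by have := hq i; omega, by exact_mod_cast hQd _ (hqp i) (hqz i hi), ?_⟩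
    have h1 := hdd (qq i) (hqp i) (hqz i hi)
    have h3 := ha3 ⟨qq i, hqp i⟩ i h2 hi rfl
    have := dvd_sub h3 (h1.mul_left 4)
    have e : (1 : ℤ) - 4 * a ⟨qq i, hqp i⟩ + s * (i - 1) - 4 * (d0 - a ⟨qq i, hqp i⟩)
      = 1 - 4 * d0 + s * (i - 1) := by ring
    rwa [e] at this

/-- the local conditions -/
def LC (Q d0 : ℤ) (p : ℕ → ℕ) (r : ℕ) (f : Fin 4 → ℤ) : Prop :=
  (∀ i, f i ≡ (![0, 1, 1, d0] : Fin 4 → ℤ) i [ZMOD Q]) ∧ ∀ j < r, Eis (p j) f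

theorem LC_succ (Q d0 : ℤ) (p : ℕ → ℕ) (r : ℕ) :
    LC Q d0 p (r + 1) = fun f => LC Q d0 p r f ∧ Eis (p r) f := by
  funext f
  apply propext
  constructor
  · rintro ⟨h1, h2⟩
    exact ⟨⟨h1, fun j hj => h2 j (by omega)⟩, h2 r (by omega)⟩
  · rintro ⟨⟨h1, h2⟩, h3⟩
    refine ⟨h1, fun j hj => ?_⟩
    rcases Nat.lt_succ_iff_lt_or_eq.1 hj with h | rfl
    · exact h2 j h
    · exact h3

/-- modulus of the local conditions -/
def LN (Q : ℤ) (p : ℕ → ℕ) (r : ℕ) : ℤ := Q * ∏ j ∈ Finset.range r, (p j : ℤ) ^ 2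

/-- modulus of the discriminants -/
def LM (Q : ℤ) (p : ℕ → ℕ) (r : ℕ) : ℤ := Q * ∏ j ∈ Finset.range r, (p j : ℤ) ^ 3

theorem LN_succ (Q : ℤ) (p : ℕ → ℕ) (r : ℕ) : LN Q p (r + 1) = LN Q p r * (p r : ℤ) ^ 2 := by
  unfold LN; rw [Finset.prod_range_succ]; ring

theorem LM_succ (Q : ℤ) (p : ℕ → ℕ) (r : ℕ) : LM Q p (r + 1) = LM Q p r * (p r : ℤ) ^ 3 := by
  unfold LM; rw [Finset.prod_range_succ]; ring

theorem LN_pos {Q : ℤ} (hQ : 0 < Q) {p : ℕ → ℕ} (hp : ∀ j, (p j).Prime) (r : ℕ) : 0 < LN Q p r := by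
  unfold LN
  refine mul_pos hQ (Finset.prod_pos fun j _ => ?_)
  have := (hp j).pos; positivity

theorem LM_pos {Q : ℤ} (hQ : 0 < Q) {p : ℕ → ℕ} (hp : ∀ j, (p j).Prime) (r : ℕ) : 0 < LM Q p r := by
  unfold LM
  refine mul_pos hQ (Finset.prod_pos fun j _ => ?_)
  have := (hp j).pos; positivity

theorem LC_per (Q d0 : ℤ) (p : ℕ → ℕ) (r : ℕ) : Per (LN Q p r) (LC Q d0 p r) := by
  induction r with
  | zero =>
    intro f f' h hf
    have : LN Q p 0 = Q := by simp [LN]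
    rw [this] at h
    exact ⟨fun i => (h i).symm.trans (hf.1 i), fun j hj => by omega⟩
  | succ r ih =>
    rw [LC_succ, LN_succ]
    exact ih.and Eis.per

theorem LNM_coprime {Q : ℤ} {p : ℕ → ℕ} (hp : ∀ j, (p j).Prime) (hinj : Function.Injective p)
    (hQ : ∀ j, IsCoprime Q (p j)) (r : ℕ) :
    IsCoprime (LN Q p r) (p r) ∧ IsCoprime (LM Q p r) (p r) := by
  have h : ∀ j ∈ Finset.range r, IsCoprime (p j : ℤ) (p r) := by
    intro j hj
    have : j ≠ r := by have := Finset.mem_range.1 hj; omega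
    exact Nat.isCoprime_iff_coprime.2 ((Nat.coprime_primes (hp j) (hp r)).2 fun h => this (hinj h))
  exact ⟨IsCoprime.mul_left (hQ r) (IsCoprime.prod_left fun j hj => (h j hj).pow_left),
    IsCoprime.mul_left (hQ r) (IsCoprime.prod_left fun j hj => (h j hj).pow_left)⟩

theorem LC_cnt {Q d0 : ℤ} (hQ : 0 < Q) {p : ℕ → ℕ} (hp : ∀ j, (p j).Prime) (hp5 : ∀ j, 5 ≤ p j)
    (hinj : Function.Injective p) (hco : ∀ j, IsCoprime Q (p j)) (r : ℕ) :
    (8 / 5 : ℝ) ^ r * (LN Q p r : ℝ) ^ 4 ≤ (cnt (LN Q p r) (LC Q d0 p r) : ℝ) * LM Q p r * (Q : ℝ) ^ 3 := by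
  have hQ' : (0 : ℝ) < Q := by exact_mod_cast hQ
  induction r with
  | zero =>
    have h1 : LN Q p 0 = Q := by simp [LN]
    have h2 : LM Q p 0 = Q := by simp [LM]
    rw [h1, h2]
    have : 1 ≤ cnt Q (LC Q d0 p 0) := by
      classical
      unfold cnt
      rw [Nat.succ_le_iff, Finset.card_pos]
      refine ⟨fun i => (![0, 1, 1, d0] : Fin 4 → ℤ) i % Q, Finset.mem_filter.2 ⟨mem_gBox0.2 fun i =>
        ⟨Int.emod_nonneg _ hQ.ne', Int.emod_lt_of_pos _ hQ⟩, fun i => Int.mod_modEq _ _, fun j hj => by omega⟩⟩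
    have h1 : (1 : ℝ) ≤ cnt Q (LC Q d0 p 0) := by exact_mod_cast this
    calc (8 / 5 : ℝ) ^ 0 * (Q : ℝ) ^ 4 = 1 * (Q : ℝ) * (Q : ℝ) ^ 3 := by ring
      _ ≤ _ := by gcongr
  | succ r ih =>
    have hc := LNM_coprime hp hinj hco r
    have hpp : (0 : ℤ) < (p r : ℤ) ^ 2 := by have := (hp r).pos; positivity
    rw [LC_succ, LN_succ, LM_succ, cnt_crt (LN_pos hQ hp r) hpp hc.1.pow_right (LC_per Q d0 p r) Eis.per]
    have h1 := cnt_Eis (hp r) (hp5 r)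
    have h2 : 2 * (p r : ℝ) ^ 4 * ((p r : ℝ) - 1) ≤ cnt ((p r : ℤ) ^ 2) (Eis (p r)) := by
      have : (1 : ℕ) ≤ p r := (hp r).one_le
      have h3 := h1
      zify [this] at h3
      exact_mod_cast h3
    have h5 : (5 : ℝ) ≤ p r := by exact_mod_cast hp5 r
    have h6 : (8 / 5 : ℝ) * (p r : ℝ) ^ 5 ≤ cnt ((p r : ℤ) ^ 2) (Eis (p r)) := by
      refine le_trans ?_ h2
      have : (8 / 5 : ℝ) * (p r : ℝ) ^ 5 = (p r : ℝ) ^ 4 * (8 / 5 * p r) := by ring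
      rw [this]
      have : 2 * (p r : ℝ) ^ 4 * ((p r : ℝ) - 1) = (p r : ℝ) ^ 4 * (2 * ((p r : ℝ) - 1)) := by ring
      rw [this]
      refine mul_le_mul_of_nonneg_left ?_ (by positivity)
      linarith
    have hM : (0 : ℝ) < LM Q p r := by exact_mod_cast LM_pos hQ hp r
    push_cast
    calc (8 / 5 : ℝ) ^ (r + 1) * ((LN Q p r : ℝ) * (p r : ℝ) ^ 2) ^ 4
        = ((8 / 5 : ℝ) ^ r * (LN Q p r : ℝ) ^ 4) * ((8 / 5 : ℝ) * (p r : ℝ) ^ 5) * (p r : ℝ) ^ 3 := by ring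
      _ ≤ ((cnt (LN Q p r) (LC Q d0 p r) : ℝ) * LM Q p r * (Q : ℝ) ^ 3) *
          (cnt ((p r : ℤ) ^ 2) (Eis (p r)) : ℝ) * (p r : ℝ) ^ 3 := by gcongr
      _ = _ := by ring

theorem LC_disc0 {Q d0 : ℤ} {f : Fin 4 → ℤ} {p : ℕ → ℕ} {r : ℕ} (h : LC Q d0 p r f) :
    Q ∣ bcfD f - (1 - 4 * d0) := by
  have e0 : f 0 ≡ 0 [ZMOD Q] := h.1 0
  have e1 : f 1 ≡ 1 [ZMOD Q] := h.1 1
  have e2 : f 2 ≡ 1 [ZMOD Q] := h.1 2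
  have e3 : f 3 ≡ d0 [ZMOD Q] := h.1 3
  have : bcfD f ≡ 1 ^ 2 * 1 ^ 2 - 4 * 0 * 1 ^ 3 - 4 * 1 ^ 3 * d0 - 27 * 0 ^ 2 * d0 ^ 2 + 18 * 0 * 1 * 1 * d0 [ZMOD Q] := by
    unfold bcfD bcfDisc
    gcongr
  have e : (1 ^ 2 * 1 ^ 2 - 4 * 0 * 1 ^ 3 - 4 * 1 ^ 3 * d0 - 27 * 0 ^ 2 * d0 ^ 2 + 18 * 0 * 1 * 1 * d0 : ℤ)
    = 1 - 4 * d0 := by ring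
  rw [e] at this
  exact Int.modEq_iff_dvd.1 this.symm

theorem LC_disc {Q d0 : ℤ} {p : ℕ → ℕ} (hp : ∀ j, (p j).Prime)
    (hinj : Function.Injective p) (hco : ∀ j, IsCoprime Q (p j)) (r : ℕ) {f f' : Fin 4 → ℤ}
    (h : LC Q d0 p r f) (h' : LC Q d0 p r f') : LM Q p r ∣ bcfD f - bcfD f' := by
  induction r with
  | zero =>
    have h2 : LM Q p 0 = Q := by simp [LM]
    rw [h2]
    have := dvd_sub (LC_disc0 h) (LC_disc0 h')
    have e : bcfD f - (1 - 4 * d0) - (bcfD f' - (1 - 4 * d0)) = bcfD f - bcfD f' := by ring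
    rwa [e] at this
  | succ r ih =>
    rw [LC_succ] at h h'
    rw [LM_succ]
    refine ((LNM_coprime hp hinj hco r).2.pow_right).mul_dvd (ih h.1 h'.1) ?_
    have hpp := Nat.prime_iff_prime_int.1 (hp r)
    have := dvd_sub (h.2.disc hpp) (h'.2.disc hpp)
    have e : bcfD f + 27 * (p r : ℤ) ^ 2 - (bcfD f' + 27 * (p r : ℤ) ^ 2) = bcfD f - bcfD f' := by ring
    rwa [e] at this

theorem nonsq5 {D : ℤ} (h : (5 : ℤ) ∣ D - 1) (q : ℚ) : (-3 * D : ℚ) ≠ q ^ 2 := by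
  intro hq
  have hInteg : IsIntegral ℤ q := by
    refine IsIntegral.of_pow (n := 2) (by norm_num) ?_
    rw [← hq]
    have : (-3 * D : ℚ) = algebraMap ℤ ℚ (-3 * D) := by simp
    rw [this]
    exact isIntegral_algebraMap
  obtain ⟨m, hm⟩ := IsIntegrallyClosed.isIntegral_iff.1 hInteg
  have : q = (m : ℚ) := by rw [← hm]; simp
  rw [this] at hq
  have h1 : -3 * D = m ^ 2 := by exact_mod_cast hq
  obtain ⟨e, he⟩ := h
  have h2 : (m ^ 2) % 5 = 2 := by omega
  have h3 : m % 5 = 0 ∨ m % 5 = 1 ∨ m % 5 = 2 ∨ m % 5 = 3 ∨ m % 5 = 4 := by omega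
  rw [pow_two, Int.mul_emod] at h2
  rcases h3 with h | h | h | h | h <;> rw [h] at h2 <;> norm_num at h2

theorem family_data (s : ℤ) (hs : s = 1 ∨ s = -1) (k H : ℕ) (R : ℝ) :
    ∃ (z : ℕ) (N M : ℤ) (S : (Fin 4 → ℤ) → Prop), 0 < N ∧ 0 < M ∧ Per N S ∧
      (∀ q : ℕ, q.Prime → ¬ (q : ℤ) ∣ N → z < q) ∧
      (∀ t : Finset ℕ, (∀ n ∈ t, z < n) → ∑ n ∈ t, 3 * (1 / (n : ℝ) ^ 2) ≤ 1 / 4) ∧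
      (∀ f, S f → ∀ q : ℕ, q.Prime → (q : ℤ) ∣ N → ¬ Bad q f) ∧
      (∀ f, S f → ∀ u v, bcfEv f u v = 0 → u = 0 ∧ v = 0) ∧
      (∀ f f', S f → S f' → M ∣ bcfD f - bcfD f') ∧
      R * (N : ℝ) ^ 4 ≤ cnt N S * M ∧
      (∀ f, S f → bcfD f = 0 ∨ 25 ≤ |bcfD f|) ∧
      (∀ f, S f → ∀ (K : Type) [Field K] [NumberField K], Module.finrank ℚ K = 3 →
        NumberField.discr K = bcfD f → H < NumberField.classNumber K) ∧
      (∀ f, S f → ∀ i : ℕ, 2 ≤ i → i ≤ k → ∀ (K : Type) [Field K] [NumberField K],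
        Module.finrank ℚ K = 3 → NumberField.discr K ≠ bcfD f + s * (i - 1)) := by
  obtain ⟨z, Q, d0, hz, hQ, hq1, hq2, hd5, hi, hsum⟩ := local_data s hs k
  set p : ℕ → ℕ := fun j => Nat.nth Nat.Prime (z + 1 + j) with hpdef
  have hinj : Function.Injective p := by
    intro i j h
    have := Nat.nth_injective Nat.infinite_setOfPred_prime h
    omega
  have hp : ∀ i, (p i).Prime := fun i => Nat.prime_nth_prime _
  have hpz : ∀ i, z < p i := fun i => by
    have : z + 1 + i + 2 ≤ p i := Nat.add_two_le_nth_prime _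
    omega
  have hp5 : ∀ i, 5 ≤ p i := fun i => by have := hpz i; omega
  have hQZ : (0 : ℤ) < Q := by exact_mod_cast hQ
  have hco : ∀ j, IsCoprime (Q : ℤ) (p j) := fun j => by
    refine Nat.isCoprime_iff_coprime.2 (((hp j).coprime_iff_not_dvd.2 fun h => ?_).symm)
    have := hq2 _ (hp j) h
    have := hpz j
    omega
  obtain ⟨r1, hr1⟩ := pow_unbounded_of_one_lt (R * (Q : ℝ) ^ 3) (by norm_num : (1 : ℝ) < 8 / 5)
  obtain ⟨r2, hr2⟩ := pow_unbounded_of_one_lt (27 * H) (by norm_num : 1 < 3)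
  set r := r1 + r2 + 1 with hr
  refine ⟨z, LN Q p r, LM Q p r, LC Q d0 p r, LN_pos hQZ hp r, LM_pos hQZ hp r, LC_per _ _ _ _, ?_, hsum,
    ?_, ?_, ?_, ?_, ?_, ?_, ?_⟩
  · intro q hqp hqN
    by_contra hle
    apply hqN
    have : (q : ℤ) ∣ Q := by exact_mod_cast (hq1 q hqp (by omega)).1
    exact this.mul_right _
  · intro f hf q hqp hqN hbad
    have hqP := Nat.prime_iff_prime_int.1 hqp
    by_cases hqz : q ≤ z
    · have h1 := sq_dvd_of_bad hqP hbad
      have h2 := (hq1 q hqp hqz)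
      have h3 : (q : ℤ) ∣ Q := by exact_mod_cast h2.1
      have h4 := h3.trans (LC_disc0 hf)
      have h5 := (dvd_pow_self (q : ℤ) (by norm_num : 2 ≠ 0)).trans h1
      exact h2.2 ((dvd_sub_right h5).1 h4)
    · rcases hqP.dvd_or_dvd hqN with h | h
      · have := hq2 q hqp (by exact_mod_cast h)
        omega
      · obtain ⟨j, hj, hjq⟩ := (Prime.dvd_finsetProd_iff hqP _).1 h
        have h3 := hqP.dvd_of_dvd_pow hjq
        have h4 : q = p j := (Nat.prime_dvd_prime_iff_eq hqp (hp j)).1 (by exact_mod_cast h3)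
        subst h4
        exact (hf.2 j (Finset.mem_range.1 hj)).not_bad hqP hbad
  · intro f hf u v h0
    exact (hf.2 0 (by omega)).aniso (Nat.prime_iff_prime_int.1 (hp 0)) u v h0
  · intro f f' hf hf'
    exact LC_disc hp hinj hco r hf hf'
  · have h1 := LC_cnt (d0 := d0) hQZ hp hp5 hinj hco r
    have h2 : R * (Q : ℝ) ^ 3 ≤ (8 / 5 : ℝ) ^ r :=
      hr1.le.trans (pow_le_pow_right₀ (by norm_num) (by omega))
    have hQ3 : (0 : ℝ) < (Q : ℝ) ^ 3 := by have : (0 : ℝ) < Q := by exact_mod_cast hQ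
                                           positivity
    have hN4 : (0 : ℝ) ≤ (LN Q p r : ℝ) ^ 4 := by positivity
    have h3 := mul_le_mul_of_nonneg_right h2 hN4
    simp only [Int.cast_natCast] at h1
    refine le_of_mul_le_mul_right ?_ hQ3
    linarith
  · intro f hf
    by_cases h0 : bcfD f = 0
    · exact Or.inl h0
    · right
      have hpp := Nat.prime_iff_prime_int.1 (hp 0)
      have h1 := (hf.2 0 (by omega)).disc hpp
      have h2 : (p 0 : ℤ) ^ 2 ∣ bcfD f := by
        have := (pow_dvd_pow (p 0 : ℤ) (by norm_num : 2 ≤ 3)).trans h1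
        exact (dvd_add_left (Dvd.intro_left _ rfl)).1 this
      have h3 := Int.le_of_dvd (abs_pos.2 h0) ((dvd_abs _ _).2 h2)
      have h5 : (5 : ℤ) ≤ p 0 := by exact_mod_cast hp5 0
      have : (5 : ℤ) ^ 2 ≤ (p 0 : ℤ) ^ 2 := by gcongr
      linarith
  · intro f hf K _ _ hK hD
    have h5Q : (5 : ℤ) ∣ Q := by exact_mod_cast (hq1 5 (by norm_num) hz).1
    have hns : ∀ q : ℚ, (-3 * NumberField.discr K : ℚ) ≠ q ^ 2 := by
      rw [hD]
      apply nonsq5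
      have := dvd_sub (h5Q.trans (LC_disc0 hf)) (hd5.mul_left 4)
      have e : bcfD f - (1 - 4 * d0) - 4 * d0 = bcfD f - 1 := by ring
      rwa [e] at this
    have hP : ∀ j : Fin r, ∃ P : Ideal (𝓞 K), P ^ 3 = Ideal.span {((p j : ℕ) : 𝓞 K)} := by
      intro j
      have hpp := Nat.prime_iff_prime_int.1 (hp j)
      have h1 := (hf.2 j j.2).disc hpp
      have h2 : (p j : ℤ) ^ 2 ∣ bcfD f := by
        have := (pow_dvd_pow (p j : ℤ) (by norm_num : 2 ≤ 3)).trans h1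
        exact (dvd_add_left (Dvd.intro_left _ rfl)).1 this
      exact (ram_sq K hK (hp j) (hp5 j) (by rw [hD]; exact h2)).2
    have h1 := class_lower K hK hns (p := fun j : Fin r => p j) (fun j => hp j)
      (fun i j h => Fin.ext (hinj h)) hP
    have h2 : 3 ^ r2 ≤ 3 ^ r := Nat.pow_le_pow_right (by norm_num) (by omega)
    have h3 : 27 * H < 3 ^ r2 := hr2
    omega
  · intro f hf i h2 hik K _ _ hK hD
    obtain ⟨q, hqp, hq5, hqQ, hqd⟩ := hi i h2 hik
    have h3 : (q : ℤ) ^ 3 ∣ NumberField.discr K := by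
      rw [hD]
      have := dvd_add (hqQ.trans (LC_disc0 hf)) hqd
      have e : bcfD f - (1 - 4 * d0) + (1 - 4 * d0 + s * ((i : ℤ) - 1)) = bcfD f + s * (i - 1) := by ring
      rwa [e] at this
    exact (ram_sq K hK hqp hq5 ((pow_dvd_pow (q : ℤ) (by norm_num : 2 ≤ 3)).trans h3)).1 h3

theorem fBox_eq (s T : ℤ) : fBox s T = gBox (fun i => boxA s i * T) T := rfl

open Classical in
theorem sieve_small {s : ℤ} {N : ℤ} {S : (Fin 4 → ℤ) → Prop} (hN : 0 < N) (hPer : Per N S)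
    {p : ℕ} (hp : p.Prime) (hpN : ¬ (p : ℤ) ∣ N) {L : ℕ} (hL : p ^ 2 ∣ L) :
    (((fBox s (N * L)).filter fun f => S f ∧ Bad p f).card : ℝ) ≤
      cnt N S * (L : ℝ) ^ 4 * (3 * (1 / (p : ℝ) ^ 2)) := by
  obtain ⟨q, rfl⟩ := hL
  have hpp := Nat.prime_iff_prime_int.1 hp
  have hp0 : (0 : ℤ) < (p : ℤ) ^ 2 := by have := hp.pos; positivity
  have hco : IsCoprime N ((p : ℤ) ^ 2) :=
    (((Prime.coprime_iff_not_dvd hpp).2 hpN).symm).pow_right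
  have e : N * ((p ^ 2 * q : ℕ) : ℤ) = (N * (p : ℤ) ^ 2) * (q : ℕ) := by push_cast; ring
  have hb : ((gBox (fun i => boxA s i * (N * (p : ℤ) ^ 2 * (q : ℕ))) (N * (p : ℤ) ^ 2 * (q : ℕ))).filter
      fun f => S f ∧ Bad p f).card = cnt N S * cnt ((p : ℤ) ^ 2) (Bad p) * q ^ 4 := by
    rw [← cnt_crt hN hp0 hco hPer Bad.per, ← box_count (mul_pos hN hp0) (hPer.and Bad.per)
      (fun i => boxA s i * (N * (p : ℤ) ^ 2 * (q : ℕ)))]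
    congr!
  rw [fBox_eq, e, hb]
  have h1 : (cnt ((p : ℤ) ^ 2) (Bad p) : ℝ) ≤ 3 * (p : ℝ) ^ 6 := by exact_mod_cast cnt_Bad hp
  have hpR : (0 : ℝ) < p := by exact_mod_cast hp.pos
  push_cast
  calc (cnt N S : ℝ) * (cnt ((p : ℤ) ^ 2) (Bad p) : ℝ) * (q : ℝ) ^ 4
      ≤ (cnt N S : ℝ) * (3 * (p : ℝ) ^ 6) * (q : ℝ) ^ 4 := by gcongr
    _ = _ := by field_simp

open Classical in
theorem sieve {s : ℤ} (hs : s = 1 ∨ s = -1) {z : ℕ} {N : ℤ} {S : (Fin 4 → ℤ) → Prop} (hN : 0 < N)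
    (hPer : Per N S) (hz : ∀ q : ℕ, q.Prime → ¬ (q : ℤ) ∣ N → z < q)
    (hsum : ∀ t : Finset ℕ, (∀ n ∈ t, z < n) → ∑ n ∈ t, 3 * (1 / (n : ℝ) ^ 2) ≤ 1 / 4)
    (hnb : ∀ f, S f → ∀ q : ℕ, q.Prime → (q : ℤ) ∣ N → ¬ Bad q f)
    (han : ∀ f, S f → ∀ u v, bcfEv f u v = 0 → u = 0 ∧ v = 0) (hc : 0 < cnt N S) :
    ∃ W : ℕ, 0 < W ∧ ∀ m : ℕ, 0 < m → (cnt N S : ℝ) * ((W * m : ℕ) : ℝ) ^ 4 / 2 ≤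
      ((fBox s (N * (W * m : ℕ))).filter fun f => S f ∧ ∀ p : ℕ, p.Prime → ¬ Bad p f).card := by
  obtain ⟨C, hC, htail⟩ := tail_all
  have hsm : Summable fun n : ℕ => C * (N : ℝ) ^ 4 * (1 / (n : ℝ) ^ (3 / 2 : ℝ)) :=
    (Real.summable_one_div_nat_rpow.2 (by norm_num)).mul_left _
  have hcR : (0 : ℝ) < cnt N S := by exact_mod_cast hc
  obtain ⟨Y, hzY, hY⟩ := tail_small hsm (ε := (cnt N S : ℝ) / 4) (by positivity) z
  refine ⟨(Y.factorial) ^ 2, by have := Y.factorial_pos; positivity, fun m hm => ?_⟩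
  set L := (Y.factorial) ^ 2 * m with hL
  have hLpos : 0 < L := by have := Y.factorial_pos; positivity
  set T : ℤ := N * (L : ℕ) with hT
  have hTpos : 0 < T := by positivity
  set B := (54 * 101 ^ 4 * T ^ 4).toNat with hB
  set PP := (Finset.range (B + 1)).filter fun p : ℕ => p.Prime ∧ ¬ (p : ℤ) ∣ N with hPP
  set F := (fBox s T).filter fun f => S f ∧ ∀ p : ℕ, p.Prime → ¬ Bad p f with hF
  have hA : ((fBox s T).filter S).card = cnt N S * L ^ 4 := by
    rw [fBox_eq, hT, box_count hN hPer]
  have hsub : (fBox s T).filter S ⊆ F ∪ PP.biUnion fun p => (fBox s T).filter fun f => S f ∧ Bad p f := by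
    intro f hf
    obtain ⟨hfb, hfS⟩ := Finset.mem_filter.1 hf
    by_cases hbad : ∀ p : ℕ, p.Prime → ¬ Bad p f
    · exact Finset.mem_union_left _ (Finset.mem_filter.2 ⟨hfb, hfS, hbad⟩)
    · push Not at hbad
      obtain ⟨p, hp, hb⟩ := hbad
      refine Finset.mem_union_right _ (Finset.mem_biUnion.2 ⟨p, ?_, Finset.mem_filter.2 ⟨hfb, hfS, hb⟩⟩)
      have h1 := sq_dvd_of_bad (Nat.prime_iff_prime_int.1 hp) hb
      have h2 := fBox_disc_bd hs hfb
      have h3 := fBox_disc_pos hs hfb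
      have h4 := Int.le_of_dvd h3 (h1.mul_left s)
      have h5 : (p : ℤ) ≤ (p : ℤ) ^ 2 := by
        have : (1 : ℤ) ≤ p := by exact_mod_cast hp.one_le
        nlinarith
      refine Finset.mem_filter.2 ⟨Finset.mem_range.2 ?_, hp, fun h => hnb f hfS p hp h hb⟩
      omega
  have hcard : (cnt N S : ℝ) * (L : ℝ) ^ 4 ≤ F.card +
      ∑ p ∈ PP, (((fBox s T).filter fun f => S f ∧ Bad p f).card : ℝ) := by
    have h1 := (Finset.card_le_card hsub).trans ((Finset.card_union_le _ _).trans
      (Nat.add_le_add_left Finset.card_biUnion_le _))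
    rw [hA] at h1
    exact_mod_cast h1
  have hPPm : ∀ p ∈ PP, p.Prime ∧ ¬ (p : ℤ) ∣ N := fun p hp => (Finset.mem_filter.1 hp).2
  have hL4 : (0 : ℝ) < (L : ℝ) ^ 4 := by positivity
  have hs1 : ∑ p ∈ PP.filter (· ≤ Y), (((fBox s T).filter fun f => S f ∧ Bad p f).card : ℝ) ≤
      (cnt N S : ℝ) * (L : ℝ) ^ 4 * (1 / 4) := by
    calc _ ≤ ∑ p ∈ PP.filter (· ≤ Y), (cnt N S : ℝ) * (L : ℝ) ^ 4 * (3 * (1 / (p : ℝ) ^ 2)) := by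
          refine Finset.sum_le_sum fun p hp => ?_
          obtain ⟨hp1, hp2⟩ := Finset.mem_filter.1 hp
          obtain ⟨hp3, hp4⟩ := hPPm p hp1
          refine sieve_small hN hPer hp3 hp4 ?_
          exact (pow_dvd_pow_of_dvd ((Nat.Prime.dvd_factorial hp3).2 hp2) 2).mul_right m
      _ = (cnt N S : ℝ) * (L : ℝ) ^ 4 * ∑ p ∈ PP.filter (· ≤ Y), (3 * (1 / (p : ℝ) ^ 2)) := by
          rw [Finset.mul_sum]
      _ ≤ _ := by
          refine mul_le_mul_of_nonneg_left (hsum _ fun n hn => ?_) (by positivity)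
          obtain ⟨hp3, hp4⟩ := hPPm n (Finset.mem_filter.1 hn).1
          exact hz n hp3 hp4
  have hs2 : ∑ p ∈ PP.filter (fun p => ¬ p ≤ Y), (((fBox s T).filter fun f => S f ∧ Bad p f).card : ℝ) ≤
      (L : ℝ) ^ 4 * ((cnt N S : ℝ) / 4) := by
    calc _ ≤ ∑ p ∈ PP.filter (fun p => ¬ p ≤ Y), (L : ℝ) ^ 4 * (C * (N : ℝ) ^ 4 * (1 / (p : ℝ) ^ (3 / 2 : ℝ))) := by
          refine Finset.sum_le_sum fun p hp => ?_
          obtain ⟨hp1, hp2⟩ := Finset.mem_filter.1 hp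
          obtain ⟨hp3, hp4⟩ := hPPm p hp1
          have h1 := htail s T hs hTpos p hp3
          have h2 : ((fBox s T).filter fun f => S f ∧ Bad p f) ⊆
              ((fBox s T).filter fun f => (∀ u v, bcfEv f u v = 0 → u = 0 ∧ v = 0) ∧
                (BadC p f ∨ BadNC p f)) := by
            intro f hf
            obtain ⟨hf1, hf2, hf3⟩ := Finset.mem_filter.1 hf
            exact Finset.mem_filter.2 ⟨hf1, han f hf2, hf3⟩
          have h3 : (((fBox s T).filter fun f => S f ∧ Bad p f).card : ℝ) ≤
            (((fBox s T).filter fun f => (∀ u v, bcfEv f u v = 0 → u = 0 ∧ v = 0) ∧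
                (BadC p f ∨ BadNC p f)).card : ℝ) := by exact_mod_cast Finset.card_le_card h2
          refine (h3.trans h1).trans (le_of_eq ?_)
          rw [hT]; push_cast; ring
      _ = (L : ℝ) ^ 4 * ∑ p ∈ PP.filter (fun p => ¬ p ≤ Y), (C * (N : ℝ) ^ 4 * (1 / (p : ℝ) ^ (3 / 2 : ℝ))) := by
          rw [Finset.mul_sum]
      _ ≤ _ := by
          refine mul_le_mul_of_nonneg_left (hY _ fun n hn => ?_) (by positivity)
          have := (Finset.mem_filter.1 hn).2
          omega
  rw [← Finset.sum_filter_add_sum_filter_not PP (· ≤ Y)] at hcard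
  linarith

theorem CubicSet_finite {P : ℤ → Prop} (B : ℕ) (hP : ∀ D, P D → |D| ≤ B) : (CubicSet P).Finite := by
  have h := NumberField.finite_of_discr_bdd (A := ℂ) B
  refine (h.image Subtype.val).subset ?_
  rintro F ⟨h3, hF⟩
  have hfd : FiniteDimensional ℚ F := FiniteDimensional.of_finrank_eq_succ h3
  exact ⟨⟨F, hfd⟩, hP _ hF, rfl⟩

theorem quot_finite {P : ℤ → Prop} (B : ℕ) (hP : ∀ D, P D → |D| ≤ B) :
    Finite (Quotient (cubicSetoid P)) := by
  have : Finite (CubicSet P) := (CubicSet_finite B hP).to_subtype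
  infer_instance

theorem cubicCount_mono {P P' : ℤ → Prop} (h : ∀ D, P D → P' D) (B : ℕ) (hP : ∀ D, P' D → |D| ≤ B) :
    cubicCount P ≤ cubicCount P' := by
  have := quot_finite B hP
  let g : CubicSet P → CubicSet P' := fun F => ⟨F.1, by
    obtain ⟨h3, hF⟩ := F.2
    exact ⟨h3, h _ hF⟩⟩
  refine Nat.card_le_card_of_injective
    (Quotient.map (sa := cubicSetoid P) (sb := cubicSetoid P') g (fun a b hab => hab)) ?_
  intro x y
  refine Quotient.inductionOn₂ x y fun a b hab => ?_
  have h1 := Quotient.exact hab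
  exact Quotient.sound (s := cubicSetoid P) h1

theorem forms_le {s T n : ℤ} (hs : s = 1 ∨ s = -1) (A : Finset (Fin 4 → ℤ)) (hA : A ⊆ fBox s T)
    (han : ∀ f ∈ A, ∀ u v, bcfEv f u v = 0 → u = 0 ∧ v = 0)
    (hmax : ∀ f ∈ A, ∀ p : ℕ, p.Prime → ¬ Bad p f) (hn : ∀ f ∈ A, s * bcfD f = n) :
    A.card ≤ 162 * cubicCount (fun D => s * D = n) := by
  classical
  have hfin : Finite (Quotient (cubicSetoid (fun D => s * D = n))) := by
    refine quot_finite n.natAbs fun D hD => ?_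
    rcases hs with rfl | rfl <;> rw [← hD] <;> simp
  choose F hF3 ω θ hIB hDF using fun f : A => field_of_form f.1 (han f.1 f.2)
    (fun p hp => not_or.1 (hmax f.1 f.2 p hp))
  have hmem : ∀ f : A, F f ∈ CubicSet (fun D => s * D = n) := by
    intro f
    refine ⟨hF3 f, ?_⟩
    have h1 : FiniteDimensional ℚ (F f) := FiniteDimensional.of_finrank_eq_succ (hF3 f)
    have h2 : NumberField (F f) := ⟨⟩
    have h3 := discr_of_IB (F f) (hIB f) (hDF f)
    have h4 := hn f.1 f.2
    rw [← h3] at h4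
    exact h4
  let φ : A → Quotient (cubicSetoid (fun D => s * D = n)) := fun f => Quotient.mk _ ⟨F f, hmem f⟩
  have key := Finset.card_le_mul_card_image (f := φ) Finset.univ 162 (by
    intro b _
    rw [← Finset.card_map (Function.Embedding.subtype (· ∈ A))]
    refine orbit_card hs _ ?_ ?_ (T := T)
    · intro f hf
      obtain ⟨g, -, rfl⟩ := Finset.mem_map.1 hf
      exact hA g.2
    · intro f hf f' hf'
      obtain ⟨g, hg, rfl⟩ := Finset.mem_map.1 hf
      obtain ⟨g', hg', rfl⟩ := Finset.mem_map.1 hf'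
      have e1 := (Finset.mem_filter.1 hg).2
      have e2 := (Finset.mem_filter.1 hg').2
      have e3 : φ g = φ g' := e1.trans e2.symm
      obtain ⟨e⟩ := Quotient.exact e3
      obtain ⟨x, y, z, w, hu, he⟩ := equiv_of_iso e (hIB g) (hIB g') (hDF g) (hDF g')
      exact ⟨x, y, z, w, _, hu, hu, he⟩)
  rw [Finset.card_univ, Fintype.card_coe] at key
  refine key.trans (Nat.mul_le_mul_left _ ?_)
  have := Fintype.ofFinite (Quotient (cubicSetoid (fun D => s * D = n)))
  rw [cubicCount, Nat.card_eq_fintype_card]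
  exact Finset.card_le_univ _

theorem congr_card {M : ℤ} (hM : 0 < M) {X : ℝ} (hX : 0 ≤ X) (V : Finset ℤ) (h0 : ∀ v ∈ V, 0 < v ∧ (v : ℝ) ≤ X)
    (hc : ∀ v ∈ V, ∀ w ∈ V, M ∣ v - w) : (V.card : ℝ) ≤ X / M + 1 := by
  have hMR : (0 : ℝ) < M := by exact_mod_cast hM
  have h1 : V.card ≤ (Finset.range (⌊X / M⌋₊ + 1)).card := by
    refine Finset.card_le_card_of_injOn (fun v => (v / M).toNat) ?_ ?_
    · intro v hv
      obtain ⟨hv0, hvX⟩ := h0 v hv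
      have hq : 0 ≤ v / M := Int.ediv_nonneg hv0.le hM.le
      simp only [Finset.coe_range, Set.mem_Iio, Nat.lt_succ_iff]
      apply Nat.le_floor
      have h2 : v / M * M ≤ v := Int.ediv_mul_le v hM.ne'
      have h3 : ((v / M : ℤ) : ℝ) * M ≤ v := by exact_mod_cast h2
      have h4 : (((v / M).toNat : ℕ) : ℝ) = ((v / M : ℤ) : ℝ) := by
        exact_mod_cast congrArg (Int.cast : ℤ → ℝ) (Int.toNat_of_nonneg hq)
      rw [h4, le_div_iff₀ hMR]
      linarith
    · intro v hv w hw hvw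
      have hq : 0 ≤ v / M := Int.ediv_nonneg (h0 v hv).1.le hM.le
      have hq' : 0 ≤ w / M := Int.ediv_nonneg (h0 w hw).1.le hM.le
      have e : v / M = w / M := by simp only at hvw; omega
      have e2 : v % M = w % M := Int.modEq_iff_dvd.2 (hc w hw v hv)
      rw [← Int.mul_ediv_add_emod v M, ← Int.mul_ediv_add_emod w M, e, e2]
  rw [Finset.card_range] at h1
  have h2 : (V.card : ℝ) ≤ (⌊X / M⌋₊ : ℝ) + 1 := by exact_mod_cast h1
  have h3 : (⌊X / M⌋₊ : ℝ) ≤ X / M := Nat.floor_le (by positivity)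
  linarith

open Classical in
/-- combination of the counting bounds -/
theorem combine {s : ℤ} (hs : s = 1 ∨ s = -1) {k : ℕ} {C κ' X : ℝ} (hC : 0 < C) (hκ : 0 ≤ κ') (hX : 1 ≤ X)
    (hmult : ∀ Δ : ℤ, 1 < Δ → (cubicCount (fun D => |D| = Δ) : ℝ) ≤ C * (Δ : ℝ) ^ κ')
    {M : ℤ} (hM : 0 < M) (hXM : (M : ℝ) ≤ X) {T : ℤ} (A : Finset (Fin 4 → ℤ)) (hA : A ⊆ fBox s T)
    (han : ∀ f ∈ A, ∀ u v, bcfEv f u v = 0 → u = 0 ∧ v = 0)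
    (hmax : ∀ f ∈ A, ∀ p : ℕ, p.Prime → ¬ Bad p f)
    (hdisc : ∀ f ∈ A, 1 < s * bcfD f ∧ ((s * bcfD f : ℤ) : ℝ) ≤ X)
    (hcon : ∀ f ∈ A, ∀ f' ∈ A, M ∣ bcfD f - bcfD f')
    (hcard : (162 * k + 1) * (X / M) ≤ (A.card : ℝ)) :
    X / M ≤ (((A.image fun f => s * bcfD f).filter fun n =>
      (k : ℝ) / 2 ≤ (cubicCount fun D => s * D = n : ℕ)).card : ℝ) * (162 * C * X ^ κ') := by
  set V := A.image fun f => s * bcfD f with hV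
  have hMR : (0 : ℝ) < M := by exact_mod_cast hM
  have hVc : (V.card : ℝ) ≤ X / M + 1 := by
    refine congr_card hM (by linarith) V ?_ ?_
    · intro v hv
      obtain ⟨f, hf, rfl⟩ := Finset.mem_image.1 hv
      exact ⟨by have := (hdisc f hf).1; omega, (hdisc f hf).2⟩
    · intro v hv w hw
      obtain ⟨f, hf, rfl⟩ := Finset.mem_image.1 hv
      obtain ⟨f', hf', rfl⟩ := Finset.mem_image.1 hw
      have := (hcon f hf f' hf').mul_left s
      rwa [mul_sub] at this
  have hfib : ∀ n, ((A.filter fun f => s * bcfD f = n).card : ℝ) ≤ 162 * (cubicCount fun D => s * D = n : ℕ) := by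
    intro n
    have := forms_le (n := n) hs (A.filter fun f => s * bcfD f = n) ((Finset.filter_subset _ _).trans hA)
      (fun f hf => han f (Finset.mem_filter.1 hf).1) (fun f hf => hmax f (Finset.mem_filter.1 hf).1)
      (fun f hf => (Finset.mem_filter.1 hf).2)
    exact_mod_cast this
  have hsum : (A.card : ℝ) = ∑ n ∈ V, ((A.filter fun f => s * bcfD f = n).card : ℝ) := by
    exact_mod_cast Finset.card_eq_sum_card_image (fun f => s * bcfD f) A
  rw [← Finset.sum_filter_add_sum_filter_not V (fun n => (k : ℝ) / 2 ≤ (cubicCount fun D => s * D = n : ℕ))] at hsum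
  set G := V.filter fun n => (k : ℝ) / 2 ≤ (cubicCount fun D => s * D = n : ℕ) with hG
  have h1 : ∑ n ∈ G, ((A.filter fun f => s * bcfD f = n).card : ℝ) ≤ (G.card : ℝ) * (162 * C * X ^ κ') := by
    rw [← nsmul_eq_mul]
    refine Finset.sum_le_card_nsmul _ _ _ fun n hn => ?_
    obtain ⟨f, hf, rfl⟩ := Finset.mem_image.1 (Finset.mem_filter.1 hn).1
    obtain ⟨hn1, hnX⟩ := hdisc f hf
    set n := s * bcfD f with hnd
    have h2 : cubicCount (fun D => s * D = n) ≤ cubicCount (fun D => |D| = n) := by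
      refine cubicCount_mono (fun D hD => ?_) n.natAbs (fun D hD => ?_)
      · rcases hs with rfl | rfl
        · rw [one_mul] at hD; rw [hD]; exact abs_of_pos (by omega)
        · have : D = - n := by omega
          rw [this, abs_neg]; exact abs_of_pos (by omega)
      · rw [hD]; omega
    have h3 : ((cubicCount fun D => s * D = n : ℕ) : ℝ) ≤ (cubicCount (fun D => |D| = n) : ℕ) := by
      exact_mod_cast h2
    have h4 := hmult n hn1
    have hn0 : (0 : ℝ) ≤ n := by exact_mod_cast (by omega : (0 : ℤ) ≤ n)
    have h5 : (n : ℝ) ^ κ' ≤ X ^ κ' := Real.rpow_le_rpow hn0 hnX hκ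
    have h6 := mul_le_mul_of_nonneg_left h5 hC.le
    have h7 := hfib n
    linarith
  have h2 : ∑ n ∈ V.filter (fun n => ¬ (k : ℝ) / 2 ≤ (cubicCount fun D => s * D = n : ℕ)),
      ((A.filter fun f => s * bcfD f = n).card : ℝ) ≤ (X / M + 1) * (81 * k) := by
    refine (Finset.sum_le_card_nsmul _ _ (81 * k : ℝ) fun n hn => ?_).trans ?_
    · have h3 := (Finset.mem_filter.1 hn).2
      push Not at h3
      have := hfib n
      linarith
    · rw [nsmul_eq_mul]
      refine mul_le_mul_of_nonneg_right (le_trans ?_ hVc) (by positivity)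
      exact_mod_cast Finset.card_le_card (Finset.filter_subset _ _)
  have h3 : 1 ≤ X / M := by rwa [one_le_div hMR]
  have h4 : (X / M + 1) * (81 * k) ≤ (2 * (X / M)) * (81 * k) :=
    mul_le_mul_of_nonneg_right (by linarith) (by positivity)
  linarith

theorem consecutive_cubic_fields_large_class_number
    (s : ℤ) (hs : s = 1 ∨ s = -1) (ε κ : ℝ) (hε : 0 < ε) (hκ0 : 0 < κ) (hκ1 : κ < 1)
    (k H : ℕ) (hk : 0 < k) (hH : 0 < H)
    (hmult : ∀ ε' : ℝ, 0 < ε' → ∃ C : ℝ, 0 < C ∧ ∀ Δ : ℤ, 1 < Δ →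
      (cubicCount (fun D => |D| = Δ) : ℝ) ≤ C * (Δ : ℝ) ^ (κ + ε')) :
    ∃ c : ℝ, 0 < c ∧ ∃ X₀ : ℝ, ∀ X : ℝ, X₀ ≤ X →
      c * X ^ (1 - κ - ε) ≤
        (Nat.card {d : ℕ | 0 < d ∧ (d : ℝ) ≤ X ∧
          (∀ i : ℕ, 1 ≤ i → i ≤ k →
            ∀ (K : Type) [Field K] [NumberField K],
              Module.finrank ℚ K = 3 → s * NumberField.discr K = (d : ℤ) + i →
              H < NumberField.classNumber K) ∧
          (k : ℝ) / 2 ≤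
            (cubicCount fun D => ∃ i : ℕ, 1 ≤ i ∧ i ≤ k ∧ s * D = (d : ℤ) + i : ℕ)} : ℝ) := by
  classical
  obtain ⟨C, hC, hm⟩ := hmult ε hε
  obtain ⟨z, N, M, S, hN, hM, hPer, hz, hsum, hnb, han, hcon, hR, h25, hcl, hno⟩ :=
    family_data s hs k H (32 * (54 * 101 ^ 4) * (162 * k + 1))
  have hNR : (0 : ℝ) < N := by exact_mod_cast hN
  have hMR : (0 : ℝ) < M := by exact_mod_cast hM
  have hcnt : 0 < cnt N S := by
    rcases Nat.eq_zero_or_pos (cnt N S) with h | h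
    · rw [h] at hR
      have : (0 : ℝ) < 32 * (54 * 101 ^ 4) * (162 * k + 1) * (N : ℝ) ^ 4 := by positivity
      simp at hR
      linarith
    · exact h
  obtain ⟨W, hW, hsieve⟩ := sieve hs hN hPer hz hsum hnb han hcnt
  have hWR : (0 : ℝ) < W := by exact_mod_cast hW
  have hGpos : (0 : ℝ) < N * W := by positivity
  refine ⟨1 / (162 * C * M), by positivity, max (max 1 M) (54 * 101 ^ 4 * (N * W) ^ 4), fun X hX => ?_⟩
  have hX1 : 1 ≤ X := (le_max_left _ _).trans ((le_max_left _ _).trans hX)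
  have hXM : (M : ℝ) ≤ X := (le_max_right _ _).trans ((le_max_left _ _).trans hX)
  have hXG : 54 * 101 ^ 4 * (N * W : ℝ) ^ 4 ≤ X := (le_max_right _ _).trans hX
  have hX0 : 0 < X := by linarith
  -- choice of m
  set Y : ℝ := (X / (54 * 101 ^ 4)) ^ (1 / 4 : ℝ) with hY
  have hY4 : Y ^ 4 = X / (54 * 101 ^ 4) := by
    rw [hY, ← Real.rpow_natCast, ← Real.rpow_mul (by positivity)]
    norm_num
  have hY0 : 0 ≤ Y := by positivity
  have hYG : N * W ≤ Y := by
    refine le_of_pow_le_pow_left₀ (n := 4) (by norm_num) hY0 ?_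
    rw [hY4, le_div_iff₀ (by norm_num)]
    linarith
  set m := ⌊Y / (N * W)⌋₊ with hmdef
  have hm1 : 1 ≤ m := Nat.le_floor (by rw [Nat.cast_one, one_le_div hGpos]; exact hYG)
  have hmle : (m : ℝ) * (N * W) ≤ Y := by
    have := Nat.floor_le (a := Y / (N * W)) (by positivity)
    rwa [le_div_iff₀ hGpos] at this
  have hmge : Y ≤ 2 * (m * (N * W)) := by
    have h1 := Nat.lt_floor_add_one (Y / (N * W))
    rw [div_lt_iff₀ hGpos] at h1
    have h2 : (1 : ℝ) ≤ m := by exact_mod_cast hm1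
    have h3 : ((m : ℝ) + 1) * (N * W) ≤ (2 * m) * (N * W) := mul_le_mul_of_nonneg_right (by linarith) hGpos.le
    linarith
  set T : ℤ := N * (W * m : ℕ) with hT
  have hTR : (T : ℝ) = m * (N * W) := by rw [hT]; push_cast; ring
  have hTX : 54 * 101 ^ 4 * (T : ℝ) ^ 4 ≤ X := by
    have : (T : ℝ) ^ 4 ≤ Y ^ 4 := by
      rw [hTR]
      exact pow_le_pow_left₀ (by positivity) hmle 4
    rw [hY4, le_div_iff₀ (by norm_num)] at this
    linarith
  have hTX' : X ≤ 16 * (54 * 101 ^ 4) * (T : ℝ) ^ 4 := by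
    have : Y ^ 4 ≤ (2 * (T : ℝ)) ^ 4 := by
      rw [hTR]
      exact pow_le_pow_left₀ hY0 hmge 4
    rw [hY4, div_le_iff₀ (by norm_num)] at this
    linarith
  set A := (fBox s T).filter fun f => S f ∧ ∀ p : ℕ, p.Prime → ¬ Bad p f with hA
  have hAm : ∀ f ∈ A, f ∈ fBox s T ∧ S f ∧ ∀ p : ℕ, p.Prime → ¬ Bad p f := fun f hf => Finset.mem_filter.1 hf
  have hdisc : ∀ f ∈ A, 25 ≤ s * bcfD f ∧ ((s * bcfD f : ℤ) : ℝ) ≤ X := by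
    intro f hf
    obtain ⟨h1, h2, -⟩ := hAm f hf
    have hp := fBox_disc_pos hs h1
    have hb := fBox_disc_bd hs h1
    refine ⟨?_, le_trans ?_ hTX⟩
    · rcases h25 f h2 with h | h
      · rw [h] at hp; simp at hp
      · rcases hs with rfl | rfl
        · rw [one_mul] at hp ⊢; rwa [abs_of_pos hp] at h
        · rw [abs_of_neg (by linarith)] at h; linarith
    · exact_mod_cast hb
  have hAcard : (162 * k + 1) * (X / M) ≤ (A.card : ℝ) := by
    have h1 := hsieve m hm1
    refine le_trans ?_ h1
    have h2 : (T : ℝ) ^ 4 = (N : ℝ) ^ 4 * ((W * m : ℕ) : ℝ) ^ 4 := by rw [hT]; push_cast; ring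
    set L : ℝ := ((W * m : ℕ) : ℝ) with hL
    have h3 : (162 * (k : ℝ) + 1) * X ≤ (162 * k + 1) * (16 * (54 * 101 ^ 4) * ((N : ℝ) ^ 4 * L ^ 4)) := by
      rw [← h2]
      exact mul_le_mul_of_nonneg_left hTX' (by positivity)
    have h4 := mul_le_mul_of_nonneg_right hR (by positivity : (0 : ℝ) ≤ L ^ 4 / 2)
    rw [← mul_div_assoc, div_le_iff₀ hMR]
    linarith
  have hcomb := combine hs (k := k) hC (by linarith : (0 : ℝ) ≤ κ + ε) hX1 hm hM hXM A
    (Finset.filter_subset _ _) (fun f hf => han f (hAm f hf).2.1) (fun f hf => (hAm f hf).2.2)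
    (fun f hf => ⟨by have := (hdisc f hf).1; omega, (hdisc f hf).2⟩)
    (fun f hf f' hf' => hcon f f' (hAm f hf).2.1 (hAm f' hf').2.1) hAcard
  set G := (A.image fun f => s * bcfD f).filter fun n =>
      (k : ℝ) / 2 ≤ (cubicCount fun D => s * D = n : ℕ) with hG
  have hGm : ∀ n ∈ G, 25 ≤ n := by
    intro n hn
    obtain ⟨f, hf, rfl⟩ := Finset.mem_image.1 (Finset.mem_filter.1 hn).1
    exact (hdisc f hf).1
  have hfinal : (G.card : ℝ) ≤ (Nat.card {d : ℕ | 0 < d ∧ (d : ℝ) ≤ X ∧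
          (∀ i : ℕ, 1 ≤ i → i ≤ k →
            ∀ (K : Type) [Field K] [NumberField K],
              Module.finrank ℚ K = 3 → s * NumberField.discr K = (d : ℤ) + i →
              H < NumberField.classNumber K) ∧
          (k : ℝ) / 2 ≤
            (cubicCount fun D => ∃ i : ℕ, 1 ≤ i ∧ i ≤ k ∧ s * D = (d : ℤ) + i : ℕ)} : ℝ) := by
    have hinj : (G.image fun n => (n - 1).toNat).card = G.card := by
      refine Finset.card_image_of_injOn fun n hn n' hn' h => ?_
      have h1 := hGm n hn
      have h2 := hGm n' hn'
      omega
    rw [← hinj, Nat.card_coe_set_eq, ← Set.ncard_coe_finset]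
    refine Nat.cast_le.2 (Set.ncard_le_ncard ?_ ?_)
    · intro d hd
      obtain ⟨n, hn, rfl⟩ := Finset.mem_image.1 (Finset.mem_coe.1 hd)
      have hn25 := hGm n hn
      obtain ⟨hn1, hn2⟩ := Finset.mem_filter.1 hn
      obtain ⟨f, hf, hfn⟩ := Finset.mem_image.1 hn1
      obtain ⟨-, hfS, -⟩ := hAm f hf
      have hnX : (n : ℝ) ≤ X := by rw [← hfn]; exact (hdisc f hf).2
      have hd1 : (((n - 1).toNat : ℕ) : ℤ) = n - 1 := Int.toNat_of_nonneg (by omega)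
      refine ⟨by omega, ?_, ?_, ?_⟩
      · have : (((n - 1).toNat : ℕ) : ℝ) = (n : ℝ) - 1 := by
          have := congrArg (Int.cast : ℤ → ℝ) hd1
          push_cast at this
          exact this
        rw [this]; linarith
      · intro i hi1 hik K _ _ hK hD
        rw [hd1] at hD
        have hs2 : s * s = 1 := by rcases hs with rfl | rfl <;> norm_num
        have hD' : NumberField.discr K = bcfD f + s * (i - 1) := by
          have h1 : s * (s * NumberField.discr K) = s * (n - 1 + i) := by rw [hD]
          rw [← hfn] at h1
          linear_combination h1 - (NumberField.discr K - bcfD f) * hs2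
        rcases Nat.lt_or_ge i 2 with h | h
        · have : i = 1 := by omega
          subst this
          refine hcl f hfS K hK ?_
          rw [hD']; simp
        · exact (hno f hfS i h hik K hK hD').elim
      · refine hn2.trans (Nat.cast_le.2 (cubicCount_mono (fun D hD => ?_) (n.natAbs + k) fun D hD => ?_))
        · exact ⟨1, le_rfl, hk, by rw [hd1, hD]; push_cast; ring⟩
        · obtain ⟨i, hi1, hik, hi⟩ := hD
          rw [hd1] at hi
          have habs : |D| = |s * D| := by
            rcases hs with rfl | rfl <;> simp
          rw [habs, hi, abs_of_nonneg (by omega)]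
          omega
    · refine (Set.finite_Iic ⌊X⌋₊).subset fun d hd => ?_
      exact Nat.le_floor hd.2.1
  refine le_trans ?_ hfinal
  have hXp : (0 : ℝ) < X ^ (κ + ε) := Real.rpow_pos_of_pos hX0 _
  have e : X ^ (1 - κ - ε) = X / X ^ (κ + ε) := by
    rw [sub_sub, Real.rpow_sub hX0, Real.rpow_one]
  rw [e, div_mul_div_comm, one_mul, div_le_iff₀ (by positivity)]
  rw [div_le_iff₀ hMR] at hcomb
  linarith

end
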